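/- Let I be a Cohen-Macaulay R-ideal of positive grade and let C be an R-ideal with C properly contained in the maximal ideal m. Then the following are equivalent: (a) L^e(I) ⊆ C·R(X) for every e ≥ 1; (b) C contains every ideal in the linkage class of I. -/

import Mathlib

open RingTheory IsLocalRing

/-- A proper ideal generated by a regular sequence is a complete intersection. -/
def IsCompleteIntersectionIdeal (R : Type) [CommRing R] (I : Ideal R) : Prop :=
  I ≠ ⊤ ∧ ∃ rs : List R, RingTheory.Sequence.IsRegular R rs ∧ Ideal.ofList rs = I

/-- Two proper ideals are directly linked if there is a complete intersection
`c ⊆ I ⊓ J` with `I = c : J` and `J = c : I`. -/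
def IsDirectlyLinked (R : Type) [CommRing R] (I J : Ideal R) : Prop :=
  I ≠ ⊤ ∧ J ≠ ⊤ ∧ ∃ c : Ideal R, IsCompleteIntersectionIdeal R c ∧ c ≤ I ⊓ J ∧
    Submodule.colon c J = I ∧ Submodule.colon c I = J

/-- The linkage (liaison) equivalence: the equivalence relation generated by direct linkage. -/
def InSameLinkageClass (R : Type) [CommRing R] (I J : Ideal R) : Prop :=
  Relation.EqvGen (IsDirectlyLinked R) I J

/-- An ideal is licci if its linkage class contains a complete intersection. -/
def Licci (R : Type) [CommRing R] (I : Ideal R) : Prop :=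
  ∃ J, InSameLinkageClass R I J ∧ IsCompleteIntersectionIdeal R J

open Classical in
/-- `∫ I` : the sum of all ideals in the linkage class of `I` if `I` is not licci,
and the unit ideal otherwise. -/
noncomputable def intLink (R : Type) [CommRing R] (I : Ideal R) : Ideal R :=
  if Licci R I then ⊤ else sSup {J : Ideal R | InSameLinkageClass R I J}

/-- An ideal is maximal in its linkage class if it contains every ideal in its linkage class. -/
def MaximalInLinkageClass (R : Type) [CommRing R] (I : Ideal R) : Prop :=
  ∀ J, InSameLinkageClass R I J → J ≤ I

/-- Linked in `n` steps. -/
def LinkedInSteps (R : Type) [CommRing R] : ℕ → Ideal R → Ideal R → Prop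
  | 0, I, J => I = J
  | (n+1), I, J => ∃ K, IsDirectlyLinked R I K ∧ LinkedInSteps R n K J

/-- The grade of an ideal: the supremum of lengths of regular sequences contained in it. -/
noncomputable def gradeOf (R : Type) [CommRing R] (I : Ideal R) : ℕ :=
  sSup {n : ℕ | ∃ rs : List R, rs.length = n ∧ (∀ r ∈ rs, r ∈ I) ∧
    RingTheory.Sequence.IsRegular R rs}

/-- A Noetherian local ring is Cohen-Macaulay if its depth (the grade of its maximal ideal)
equals its Krull dimension. -/
def IsCMLocalRing (A : Type) [CommRing A] [IsLocalRing A] : Prop :=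
  ringKrullDim A = (gradeOf A (maximalIdeal A) : WithBot (WithTop ℕ))

/-- An ideal `I` of `R` is a Cohen-Macaulay ideal if `R/I` is a Cohen-Macaulay local ring. -/
def IsCMIdeal (R : Type) [CommRing R] (I : Ideal R) : Prop :=
  ∃ h : IsLocalRing (R ⧸ I), @IsCMLocalRing (R ⧸ I) _ h

/-- A Noetherian local ring is Gorenstein if it is Cohen-Macaulay and some ideal generated
by a regular sequence and primary to the maximal ideal is irreducible. -/
def IsGorensteinLocalRing (A : Type) [CommRing A] [IsLocalRing A] : Prop :=
  IsCMLocalRing A ∧ ∃ rs : List A, RingTheory.Sequence.IsRegular A rs ∧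
    (Ideal.ofList rs).radical = maximalIdeal A ∧ InfIrred (Ideal.ofList rs)

open MvPolynomial in
/-- The first generic link `(α₁,…,α_g) : L·B[X]` built from a generating set `f` of `L`,
where `αᵢ = Σⱼ Xⱼᵢ·fⱼ`. -/
noncomputable def genericLinkIdeal {B : Type} [CommRing B] {n : ℕ} (g : ℕ)
    (f : Fin n → B) (L : Ideal B) : Ideal (MvPolynomial (Fin n × Fin g) B) :=
  Submodule.colon
    (Ideal.span (Set.range fun i : Fin g =>
      ∑ j : Fin n, (X (j, i) : MvPolynomial (Fin n × Fin g) B) * C (f j)))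
    (L.map (C : B →+* MvPolynomial (Fin n × Fin g) B))

/-- `IsGenericLinkOf R e I B φ L` says that `L ⊆ B` is an `e`-th generic link of `I`,
obtained by iterating the first generic link construction (with respect to some choice
of finite generating set at each stage); `φ : R →+* B` is the natural inclusion into the
iterated polynomial extension. -/
inductive IsGenericLinkOf (R : Type) [CommRing R] :
    ℕ → Ideal R → (B : CommRingCat.{0}) → (R →+* B) → Ideal B → Prop
  | zero (I : Ideal R) : IsGenericLinkOf R 0 I (CommRingCat.of R) (RingHom.id R) I
  | succ {e : ℕ} {I : Ideal R} {B : CommRingCat.{0}} {φ : R →+* B} {L : Ideal B}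
      (h : IsGenericLinkOf R e I B φ L) (n : ℕ) (f : Fin n → B)
      (hf : Ideal.span (Set.range f) = L) :
      IsGenericLinkOf R (e+1) I
        (CommRingCat.of (MvPolynomial (Fin n × Fin (gradeOf B L)) B))
        ((MvPolynomial.C : B →+* MvPolynomial (Fin n × Fin (gradeOf B L)) B).comp φ)
        (genericLinkIdeal (gradeOf B L) f L)

/-- `IsUniversalLinkOf R e I B φ L` says that `L ⊆ B` is an `e`-th universal link of `I`:
at each stage one passes from the current local ring `B'` to
`B'(X) = B'[X]` localized at the extension of the maximal ideal of `B'`, and extends the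
first generic link there. -/
inductive IsUniversalLinkOf (R : Type) [CommRing R] :
    ℕ → Ideal R → (B : CommRingCat.{0}) → (R →+* B) → Ideal B → Prop
  | zero (I : Ideal R) : IsUniversalLinkOf R 0 I (CommRingCat.of R) (RingHom.id R) I
  | succ {e : ℕ} {I : Ideal R} {B : CommRingCat.{0}} {φ : R →+* B} {L : Ideal B}
      (h : IsUniversalLinkOf R e I B φ L) (hB : IsLocalRing B) (n : ℕ) (f : Fin n → B)
      (hf : Ideal.span (Set.range f) = L)
      (hQ : (((@IsLocalRing.maximalIdeal B _ hB).map
          (MvPolynomial.C : B →+* MvPolynomial (Fin n × Fin (gradeOf B L)) B))).IsPrime) :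
      IsUniversalLinkOf R (e+1) I
        (CommRingCat.of (Localization (@Ideal.primeCompl _ _ _ hQ)))
        ((algebraMap (MvPolynomial (Fin n × Fin (gradeOf B L)) B)
            (Localization (@Ideal.primeCompl _ _ _ hQ))).comp
          ((MvPolynomial.C : B →+* MvPolynomial (Fin n × Fin (gradeOf B L)) B).comp φ))
        ((genericLinkIdeal (gradeOf B L) f L).map
          (algebraMap (MvPolynomial (Fin n × Fin (gradeOf B L)) B)
            (Localization (@Ideal.primeCompl _ _ _ hQ))))

section RegularModulo

open scoped Pointwise

variable {A : Type} [CommRing A]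

/-- `x` is a nonzerodivisor modulo `c`. -/
def RegMod (c : Ideal A) (x : A) : Prop := ∀ b, x * b ∈ c → b ∈ c

/-- `xs` is a weakly regular sequence on `A ⧸ c`. -/
def RegSeq : Ideal A → List A → Prop
  | _, [] => True
  | c, x :: xs => RegMod c x ∧ RegSeq (c ⊔ Ideal.span {x}) xs

@[simp] lemma regSeq_nil (c : Ideal A) : RegSeq c [] := trivial

lemma regSeq_cons (c : Ideal A) (x : A) (xs : List A) :
    RegSeq c (x :: xs) ↔ RegMod c x ∧ RegSeq (c ⊔ Ideal.span {x}) xs := Iff.rfl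

lemma sup_ofList_cons (c : Ideal A) (x : A) (xs : List A) :
    c ⊔ Ideal.ofList (x :: xs) = c ⊔ Ideal.span {x} ⊔ Ideal.ofList xs := by
  rw [Ideal.ofList_cons, sup_assoc]

lemma sup_ofList_append (c : Ideal A) (xs ys : List A) :
    c ⊔ Ideal.ofList (xs ++ ys) = c ⊔ Ideal.ofList xs ⊔ Ideal.ofList ys := by
  rw [Ideal.ofList_append, sup_assoc]

lemma regSeq_append (c : Ideal A) (xs ys : List A) :
    RegSeq c (xs ++ ys) ↔ RegSeq c xs ∧ RegSeq (c ⊔ Ideal.ofList xs) ys := by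
  induction xs generalizing c with
  | nil => simp
  | cons x xs ih => rw [List.cons_append, regSeq_cons, regSeq_cons, ih, sup_ofList_cons, and_assoc]

lemma ofList_le_of_forall_mem {I : Ideal A} {xs : List A} (h : ∀ x ∈ xs, x ∈ I) :
    Ideal.ofList xs ≤ I := Ideal.span_le.2 h

lemma mem_ofList {xs : List A} {x : A} (h : x ∈ xs) : x ∈ Ideal.ofList xs :=
  Ideal.subset_span h

lemma regMod_iff_isSMulRegular (c : Ideal A) (x : A) : RegMod c x ↔ IsSMulRegular (A ⧸ c) x := by
  rw [isSMulRegular_quotient_iff_mem_of_smul_mem]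
  rfl

lemma mem_sup_span_singleton {c : Ideal A} {x b : A} :
    b ∈ c ⊔ Ideal.span {x} ↔ ∃ a, b - a * x ∈ c := by
  rw [Submodule.mem_sup]
  constructor
  · rintro ⟨y, hy, z, hz, rfl⟩
    obtain ⟨a, rfl⟩ := Ideal.mem_span_singleton'.1 hz
    exact ⟨a, by simpa using hy⟩
  · rintro ⟨a, ha⟩
    exact ⟨_, ha, a * x, Ideal.mem_span_singleton'.2 ⟨a, rfl⟩, by ring⟩

lemma regSeq_iff_isWeaklyRegular (c : Ideal A) (xs : List A) :
    RegSeq c xs ↔ RingTheory.Sequence.IsWeaklyRegular (A ⧸ c) xs := by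
  induction xs generalizing c with
  | nil => simp
  | cons x xs ih =>
    rw [regSeq_cons, RingTheory.Sequence.isWeaklyRegular_cons_iff, regMod_iff_isSMulRegular, ih]
    refine and_congr_right fun _ => ?_
    refine LinearEquiv.isWeaklyRegular_congr ?_ xs
    have hk : (x • (⊤ : Submodule A (A ⧸ c))) = Submodule.map (Submodule.mkQ c)
        (c ⊔ Ideal.span {x}) := by
      ext b
      obtain ⟨b, rfl⟩ := Submodule.mkQ_surjective c b
      constructor
      · intro hb
        obtain ⟨a, -, ha⟩ := (Submodule.mem_smul_pointwise_iff_exists _ _ _).1 hb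
        obtain ⟨a, rfl⟩ := Submodule.mkQ_surjective c a
        refine ⟨x * a, ?_, ha⟩
        exact Ideal.mem_sup_right (Ideal.mul_mem_right _ _ (Ideal.mem_span_singleton_self x))
      · rintro ⟨b', hb', h⟩
        obtain ⟨a, ha⟩ := mem_sup_span_singleton.1 hb'
        rw [← h]
        refine (Submodule.mem_smul_pointwise_iff_exists _ _ _).2
          ⟨Submodule.mkQ c a, trivial, ?_⟩
        rw [← map_smul]
        refine ((Submodule.Quotient.eq c).2 ?_).symm
        simpa [mul_comm] using ha
    exact (Submodule.quotEquivOfEq _ _ hk ≪≫ₗ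
      Submodule.quotientQuotientEquivQuotient c (c ⊔ Ideal.span {x}) le_sup_left).symm

lemma regSeq_bot_iff (xs : List A) :
    RegSeq (⊥ : Ideal A) xs ↔ RingTheory.Sequence.IsWeaklyRegular A xs := by
  rw [regSeq_iff_isWeaklyRegular]
  exact LinearEquiv.isWeaklyRegular_congr (Submodule.quotEquivOfEqBot ⊥ rfl) xs

lemma isRegular_iff_regSeq (xs : List A) :
    RingTheory.Sequence.IsRegular A xs ↔ RegSeq (⊥ : Ideal A) xs ∧ Ideal.ofList xs ≠ ⊤ := by
  rw [RingTheory.Sequence.isRegular_iff, regSeq_bot_iff]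
  simp [eq_comm]

lemma regSeq_perm [IsLocalRing A] [IsNoetherianRing A] {c : Ideal A} {xs ys : List A}
    (h : xs.Perm ys) (hm : ∀ x ∈ xs, x ∈ maximalIdeal A) (hr : RegSeq c xs) : RegSeq c ys := by
  rw [regSeq_iff_isWeaklyRegular] at *
  exact IsLocalRing.isWeaklyRegular_of_perm_of_subset_maximalIdeal hr h hm

lemma RegMod.mul {c : Ideal A} {x y : A} (hx : RegMod c x) (hy : RegMod c y) :
    RegMod c (x * y) := fun b hb => hy b (hx _ (by rwa [← mul_assoc]))

end RegularModulo

section FlatColon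

variable {A B : Type} [CommRing A] [CommRing B] [Algebra A B]

lemma exists_fin_generators [IsNoetherianRing A] (J : Ideal A) :
    ∃ (n : ℕ) (f : Fin n → A), Ideal.span (Set.range f) = J :=
  Submodule.fg_iff_exists_fin_generating_family.1 (IsNoetherian.noetherian J)

lemma mem_colon_span_range {ι : Type} {c : Ideal A} {f : ι → A} {b : A} :
    b ∈ c.colon (Ideal.span (Set.range f) : Ideal A) ↔ ∀ j, b * f j ∈ c := by
  rw [Ideal.colon_span, Submodule.mem_colon]
  simp

lemma mem_span_range_iff {ι : Type} [Fintype ι] {f : ι → A} {b : A} :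
    b ∈ Ideal.span (Set.range f) ↔ ∃ a : ι → A, ∑ i, a i * f i = b :=
  Ideal.mem_span_range_iff_exists_fun

lemma map_colon_of_flat [IsNoetherianRing A] [Module.Flat A B] (c J : Ideal A) :
    (c.colon (J : Set A)).map (algebraMap A B) =
      (c.map (algebraMap A B)).colon (J.map (algebraMap A B) : Ideal B) := by
  classical
  obtain ⟨n, f, rfl⟩ := exists_fin_generators J
  obtain ⟨r, g, rfl⟩ := exists_fin_generators c
  rw [Ideal.map_span (algebraMap A B) (Set.range f), Ideal.map_span (algebraMap A B) (Set.range g),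
    ← Set.range_comp, ← Set.range_comp]
  refine le_antisymm ?_ ?_
  · rw [Ideal.map_le_iff_le_comap]
    intro b hb
    rw [mem_colon_span_range] at hb
    rw [Ideal.mem_comap, mem_colon_span_range]
    intro j
    rw [Function.comp_apply, ← map_mul, Set.range_comp, ← Ideal.map_span]
    exact Ideal.mem_map_of_mem _ (hb j)
  · intro b hb
    rw [mem_colon_span_range] at hb
    simp only [mem_span_range_iff] at hb
    choose y hy using hb
    let rel : (Fin n → A) →ₗ[A] A × (Fin n → Fin r → A) :=
      { toFun := fun v => (∑ j, v j * f j, fun j s => - (v j * g s))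
        map_add' := fun u v => by
          ext <;> simp [add_mul, Finset.sum_add_distrib]; ring
        map_smul' := fun u v => by
          ext <;> simp [mul_assoc, Finset.mul_sum] }
    let x : A × (Fin n → Fin r → A) →ₗ[A] B :=
      { toFun := fun p => algebraMap A B p.1 * b + ∑ j, ∑ s, algebraMap A B (p.2 j s) * y j s
        map_add' := fun u v => by
          simp only [Prod.fst_add, Prod.snd_add, Pi.add_apply, map_add, add_mul,
            Finset.sum_add_distrib]; ring
        map_smul' := fun u v => by
          simp [Algebra.smul_def, mul_add, Finset.mul_sum, mul_assoc] }
    have hx : x ∘ₗ rel = 0 := by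
      ext v
      simp only [LinearMap.comp_apply, LinearMap.coe_single, LinearMap.zero_apply]
      change algebraMap A B (∑ j, _ * f j) * b + ∑ j, ∑ s, algebraMap A B (-(_ * g s)) * y j s = 0
      simp only [map_sum, map_neg, map_mul, neg_mul, Finset.sum_neg_distrib, Finset.sum_mul]
      rw [← sub_eq_add_neg, sub_eq_zero]
      refine Finset.sum_congr rfl fun j _ => ?_
      rw [mul_assoc, mul_comm _ b, ← Function.comp_apply (f := algebraMap A B) (g := f), ← hy j,
        Finset.mul_sum]
      refine Finset.sum_congr rfl fun s _ => ?_
      simp only [Function.comp_apply]; ring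
    obtain ⟨k, a, z, hz, ha⟩ := Module.Flat.exists_factorization_of_comp_eq_zero_of_free hx
    have hb : b = z (a (1, 0)) := by
      rw [← LinearMap.comp_apply, ← hz]
      simp [x]
    rw [hb, ← Finsupp.univ_sum_single (a (1, 0)), map_sum]
    refine Ideal.sum_mem _ fun i _ => ?_
    have : z (Finsupp.single i (a (1, 0) i)) =
        algebraMap A B (a (1, 0) i) * z (Finsupp.single i 1) := by
      rw [← Algebra.smul_def, ← map_smul, Finsupp.smul_single, smul_eq_mul, mul_one]
    rw [this]
    refine Ideal.mul_mem_right _ _ (Ideal.mem_map_of_mem _ ?_)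
    rw [mem_colon_span_range]
    intro j
    have h1 : a (rel (Pi.single j 1)) i = 0 := by
      rw [← LinearMap.comp_apply, ha]; simp
    have h2 : rel (Pi.single j 1) = f j • ((1 : A), (0 : Fin n → Fin r → A)) +
        ∑ s, g s • ((0 : A), (Pi.single j (Pi.single s (-1)) : Fin n → Fin r → A)) := by
      refine Prod.ext ?_ ?_
      · simp [rel, Pi.single_apply, Prod.fst_sum]
      · ext j' s'
        simp only [rel, LinearMap.coe_mk, AddHom.coe_mk, Prod.snd_add, Prod.snd_sum, Prod.smul_snd,
          Pi.add_apply, Finset.sum_apply, Pi.smul_apply, smul_eq_mul, Pi.zero_apply, mul_zero,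
          zero_add, Pi.single_apply]
        by_cases hj : j' = j
        · subst hj; simp [Pi.single_apply]
        · simp [hj]
    rw [h2, map_add, map_smul, map_sum] at h1
    simp only [map_smul, Finsupp.add_apply, Finsupp.smul_apply, smul_eq_mul,
      Finsupp.finsetSum_apply] at h1
    rw [mul_comm, eq_neg_of_add_eq_zero_left h1]
    exact neg_mem (Ideal.sum_mem _ fun s _ =>
      Ideal.mul_mem_right _ _ (Ideal.subset_span ⟨s, rfl⟩))

end FlatColon

section Transfer

variable {A B : Type} [CommRing A] [CommRing B]

lemma regMod_iff_colon_le (c : Ideal A) (x : A) :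
    RegMod c x ↔ c.colon (Ideal.span {x} : Ideal A) ≤ c := by
  constructor
  · intro h b hb
    exact h b (by simpa [mul_comm] using Ideal.mem_colon_span_singleton.1 hb)
  · intro h b hb
    exact h (Ideal.mem_colon_span_singleton.2 (by simpa [mul_comm] using hb))

lemma map_ofList (φ : A →+* B) (xs : List A) :
    (Ideal.ofList xs).map φ = Ideal.ofList (xs.map φ) := by
  induction xs with
  | nil => simp
  | cons x xs ih => simp [Ideal.ofList_cons, Ideal.map_sup, ih, Ideal.map_span]

lemma RegMod.map_of_flat [IsNoetherianRing A] [Algebra A B] [Module.Flat A B] {c : Ideal A} {x : A}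
    (h : RegMod c x) : RegMod (c.map (algebraMap A B)) (algebraMap A B x) := by
  rw [regMod_iff_colon_le] at *
  have := Ideal.map_mono (f := algebraMap A B) h
  rwa [map_colon_of_flat, Ideal.map_span, Set.image_singleton] at this

lemma RegSeq.map_of_flat [IsNoetherianRing A] [Algebra A B] [Module.Flat A B] {c : Ideal A}
    {xs : List A} (h : RegSeq c xs) :
    RegSeq (c.map (algebraMap A B)) (xs.map (algebraMap A B)) := by
  induction xs generalizing c with
  | nil => simp
  | cons x xs ih =>
    refine ⟨h.1.map_of_flat, ?_⟩
    have := ih h.2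
    rwa [Ideal.map_sup, Ideal.map_span, Set.image_singleton] at this

lemma regMod_comap_iff {π : A →+* B} (hπ : Function.Surjective π) (c : Ideal B) (x : A) :
    RegMod (c.comap π) x ↔ RegMod c (π x) := by
  constructor
  · intro h b hb
    obtain ⟨b, rfl⟩ := hπ b
    exact h b (by simpa using hb)
  · intro h b hb
    exact h (π b) (by simpa using hb)

lemma comap_sup_map {π : A →+* B} (hπ : Function.Surjective π) (c : Ideal B) (d : Ideal A) :
    (c ⊔ d.map π).comap π = c.comap π ⊔ d := by
  ext x
  constructor
  · intro hx
    obtain ⟨y, hy, z, hz, h⟩ := Submodule.mem_sup.1 (Ideal.mem_comap.1 hx)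
    obtain ⟨w, hw, rfl⟩ := (Ideal.mem_map_iff_of_surjective π hπ).1 hz
    refine Submodule.mem_sup.2 ⟨x - w, ?_, w, hw, by ring⟩
    rw [Ideal.mem_comap, map_sub, ← h]; simpa using hy
  · intro hx
    obtain ⟨y, hy, z, hz, rfl⟩ := Submodule.mem_sup.1 hx
    rw [Ideal.mem_comap, map_add]
    exact Submodule.add_mem_sup hy (Ideal.mem_map_of_mem _ hz)

lemma comap_sup_ofList {π : A →+* B} (hπ : Function.Surjective π) (c : Ideal B) (xs : List A) :
    (c ⊔ Ideal.ofList (xs.map π)).comap π = c.comap π ⊔ Ideal.ofList xs := by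
  rw [← map_ofList, comap_sup_map hπ]

lemma regSeq_comap_iff {π : A →+* B} (hπ : Function.Surjective π) (c : Ideal B) (xs : List A) :
    RegSeq (c.comap π) xs ↔ RegSeq c (xs.map π) := by
  induction xs generalizing c with
  | nil => simp
  | cons x xs ih =>
    rw [regSeq_cons, List.map_cons, regSeq_cons, regMod_comap_iff hπ, ← ih]
    have := comap_sup_map hπ c (Ideal.span {x})
    rw [Ideal.map_span, Set.image_singleton] at this
    rw [this]

end Transfer

section Socle

variable {A : Type} [CommRing A]

/-- `I` annihilates a nonzero element of `A ⧸ c`. -/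
def HasSocle (I c : Ideal A) : Prop := ∃ b, b ∉ c ∧ ∀ r ∈ I, r * b ∈ c

lemma RegMod.not_hasSocle {I c : Ideal A} {z : A} (hz : z ∈ I) (h : RegMod c z) :
    ¬ HasSocle I c := fun ⟨b, hb, hI⟩ => hb (h b (hI z hz))

lemma HasSocle.exists_prime [IsNoetherianRing A] {I c : Ideal A} {b : A} (hb : b ∉ c)
    (h : ∀ r ∈ I, r * b ∈ c) : ∃ p : Ideal A, p.IsPrime ∧ I ≤ p ∧ c ≤ p ∧ HasSocle p c := by
  obtain ⟨p, hp, hle⟩ := exists_le_isAssociatedPrime_of_isNoetherianRing A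
    (Ideal.Quotient.mk c b) (by rwa [Ne, Ideal.Quotient.eq_zero_iff_mem])
  obtain ⟨hpp, x, hx⟩ := isAssociatedPrime_iff.1 hp
  obtain ⟨x, rfl⟩ := Ideal.Quotient.mk_surjective x
  have key : ∀ r d, r • (Ideal.Quotient.mk c d) = 0 ↔ r * d ∈ c := fun r d => by
    rw [Algebra.smul_def, Ideal.Quotient.algebraMap_eq, ← map_mul, Ideal.Quotient.eq_zero_iff_mem]
  have hmem : ∀ r d, r ∈ (⊥ : Submodule A (A ⧸ c)).colon {Ideal.Quotient.mk c d} ↔ r * d ∈ c :=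
    fun r d => by rw [Submodule.mem_colon_singleton, Submodule.mem_bot, key]
  refine ⟨p, hpp, fun r hr => hle ((hmem r b).2 (h r hr)),
    fun r hr => hle ((hmem r b).2 (c.mul_mem_right _ hr)), x, ?_, ?_⟩
  · intro hxc
    apply hpp.ne_top
    rw [hx, Ideal.eq_top_iff_one, hmem, one_mul]
    exact hxc
  · intro r hr
    rw [hx, hmem] at hr
    exact hr

lemma exists_regMod_of_not_hasSocle [IsNoetherianRing A] {I : Ideal A} (s : Set (Ideal A))
    (hfin : s.Finite) (hs : ∀ c ∈ s, ¬ HasSocle I c) {C : Ideal A} (hC : ¬ I ≤ C) :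
    ∃ z ∈ I, z ∉ C ∧ ∀ c ∈ s, RegMod c z := by
  classical
  set T : Set (Ideal A) := ⋃ c ∈ s, associatedPrimes A (A ⧸ c)
  have hT : T.Finite := hfin.biUnion fun c _ => associatedPrimes.finite A (A ⧸ c)
  by_contra! hcon
  have hsub : (I : Set A) ⊆ ⋃ p ∈ (insert C hT.toFinset : Finset (Ideal A)), (p : Set A) := by
    intro z hz
    simp only [Finset.mem_insert, Set.mem_iUnion]
    by_cases hzC : z ∈ C
    · exact ⟨C, Or.inl rfl, hzC⟩
    · obtain ⟨c, hc, hcz⟩ := hcon z hz hzC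
      rw [regMod_iff_isSMulRegular] at hcz
      have : z ∈ ⋃ p ∈ associatedPrimes A (A ⧸ c), (p : Set A) := by
        rw [biUnion_associatedPrimes_eq_compl_regular]; exact hcz
      simp only [Set.mem_iUnion] at this
      obtain ⟨p, hp, hzp⟩ := this
      exact ⟨p, Or.inr (hT.mem_toFinset.2 (Set.mem_biUnion hc hp)), hzp⟩
  obtain ⟨p, hp, hle⟩ := (Ideal.subset_union_prime (f := fun p : Ideal A => p) C C (by
    intro p hp hpC _
    rcases Finset.mem_insert.1 hp with rfl | hp
    · exact absurd rfl hpC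
    · rw [hT.mem_toFinset] at hp
      simp only [T, Set.mem_iUnion] at hp
      obtain ⟨c, hc, hp⟩ := hp
      exact hp.isPrime)).1 hsub
  rcases Finset.mem_insert.1 hp with rfl | hp
  · exact hC hle
  · rw [hT.mem_toFinset] at hp
    simp only [T, Set.mem_iUnion] at hp
    obtain ⟨c, hc, hp⟩ := hp
    obtain ⟨hpp, x, hx⟩ := isAssociatedPrime_iff.1 hp
    obtain ⟨x, rfl⟩ := Ideal.Quotient.mk_surjective x
    have hmem : ∀ r, r ∈ p ↔ r * x ∈ c := fun r => by
      rw [hx, Submodule.mem_colon_singleton, Submodule.mem_bot, Algebra.smul_def,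
        Ideal.Quotient.algebraMap_eq, ← map_mul, Ideal.Quotient.eq_zero_iff_mem]
    refine hs c hc ⟨x, fun hxc => hpp.ne_top ?_, fun r hr => (hmem r).1 (hle hr)⟩
    rw [Ideal.eq_top_iff_one, hmem, one_mul]
    exact hxc

lemma exists_regMod_pair [IsNoetherianRing A] {I c d : Ideal A} (hc : ¬ HasSocle I c)
    (hd : ¬ HasSocle I d) : ∃ z ∈ I, RegMod c z ∧ RegMod d z := by
  by_cases hI : I ≤ ⊥
  · have : ∀ e : Ideal A, ¬ HasSocle I e → RegMod e 0 := by
      intro e he b _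
      by_contra hb
      refine he ⟨b, hb, fun r hr => ?_⟩
      rw [(Submodule.mem_bot A).1 (hI hr), zero_mul]; exact e.zero_mem
    exact ⟨0, I.zero_mem, this c hc, this d hd⟩
  · obtain ⟨z, hz, -, h⟩ := exists_regMod_of_not_hasSocle {c, d} (by simp) (by
      rintro e (rfl | rfl)
      exacts [hc, hd]) hI
    exact ⟨z, hz, h c (by simp), h d (by simp)⟩

lemma exists_socle_swap {I c : Ideal A} {u v : A} (hv : v ∈ I) (hu : RegMod c u)
    (hv' : RegMod c v) {b : A} (hb : ∀ r ∈ I, r * b ∈ c ⊔ Ideal.span {u}) :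
    ∃ b', v * b - u * b' ∈ c ∧ (∀ r ∈ I, r * b' ∈ c ⊔ Ideal.span {v}) ∧
      (b' ∈ c ⊔ Ideal.span {v} → b ∈ c ⊔ Ideal.span {u}) := by
  obtain ⟨b', hb'⟩ := mem_sup_span_singleton.1 (hb v hv)
  refine ⟨b', by rwa [mul_comm u], fun r hr => ?_, fun h => ?_⟩
  · obtain ⟨r', hr'⟩ := mem_sup_span_singleton.1 (hb r hr)
    refine mem_sup_span_singleton.2 ⟨r', hu _ ?_⟩
    have : u * (r * b' - r' * v) = v * (r * b - r' * u) - r * (v * b - b' * u) := by ring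
    rw [this]
    exact c.sub_mem (c.mul_mem_left _ hr') (c.mul_mem_left _ hb')
  · obtain ⟨a, ha⟩ := mem_sup_span_singleton.1 h
    refine mem_sup_span_singleton.2 ⟨a, hv' _ ?_⟩
    have : v * (b - a * u) = (v * b - b' * u) + u * (b' - a * v) := by ring
    rw [this]
    exact c.add_mem hb' (c.mul_mem_left _ ha)

lemma HasSocle.swap {I c : Ideal A} {u v : A} (hv : v ∈ I) (hu : RegMod c u)
    (hv' : RegMod c v) (h : HasSocle I (c ⊔ Ideal.span {u})) :
    HasSocle I (c ⊔ Ideal.span {v}) := by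
  obtain ⟨b, hb, hI⟩ := h
  obtain ⟨b', -, h2, h3⟩ := exists_socle_swap hv hu hv' hI
  exact ⟨b', fun h => hb (h3 h), h2⟩

/-- The elements of `A ⧸ q` annihilated by `I` form a nonzero cyclic module generated
by an element killed by `I`. -/
def SocPrincipal (I q : Ideal A) : Prop :=
  ∃ σ, σ ∉ q ∧ (∀ r ∈ I, r * σ ∈ q) ∧ ∀ b, (∀ r ∈ I, r * b ∈ q) → ∃ a, b - a * σ ∈ q

lemma SocPrincipal.swap {I c : Ideal A} {u v : A} (hu' : u ∈ I) (hv : v ∈ I) (hu : RegMod c u)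
    (hv' : RegMod c v) (h : SocPrincipal I (c ⊔ Ideal.span {u})) :
    SocPrincipal I (c ⊔ Ideal.span {v}) := by
  obtain ⟨σ, hσ, hI, hp⟩ := h
  obtain ⟨σ', h1, h2, h3⟩ := exists_socle_swap hv hu hv' hI
  refine ⟨σ', fun h => hσ (h3 h), h2, fun b' hb' => ?_⟩
  obtain ⟨b, h1', h2', -⟩ := exists_socle_swap hu' hv' hu hb'
  obtain ⟨a, ha⟩ := hp b h2'
  obtain ⟨e, he⟩ := mem_sup_span_singleton.1 ha
  refine ⟨a, mem_sup_span_singleton.2 ⟨e, hu _ ?_⟩⟩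
  have : u * (b' - a * σ' - e * v) =
      (u * b' - v * b) + v * (b - a * σ - e * u) + a * (v * σ - u * σ') := by ring
  rw [this]
  exact c.add_mem (c.add_mem h1' (c.mul_mem_left _ he)) (c.mul_mem_left _ h1)

lemma regSeq_cons_of_concat [IsLocalRing A] [IsNoetherianRing A] {c : Ideal A} {xs : List A}
    {z : A} (hxs : ∀ x ∈ xs, x ∈ maximalIdeal A) (hz : z ∈ maximalIdeal A) (h : RegSeq c xs)
    (hz' : RegMod (c ⊔ Ideal.ofList xs) z) : RegSeq c (z :: xs) := by
  refine regSeq_perm (xs := xs ++ [z]) (by simp) ?_ ((regSeq_append _ _ _).2 ⟨h, hz', trivial⟩)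
  intro x hx
  rcases List.mem_append.1 hx with hx | hx
  · exact hxs x hx
  · rw [List.mem_singleton.1 hx]; exact hz

lemma ofList_singleton (x : A) : Ideal.ofList [x] = Ideal.span {x} := by
  simp [Ideal.ofList_cons]

theorem exchange [IsLocalRing A] [IsNoetherianRing A] {P : Ideal A → Prop} {I : Ideal A}
    (hI : I ≤ maximalIdeal A)
    (hP : ∀ c u v, u ∈ I → v ∈ I → RegMod c u → RegMod c v →
      P (c ⊔ Ideal.span {u}) → P (c ⊔ Ideal.span {v}))
    {c : Ideal A} {xs ys : List A} (hx : ∀ x ∈ xs, x ∈ I) (hy : ∀ y ∈ ys, y ∈ I)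
    (hl : xs.length = ys.length) (hxr : RegSeq c xs) (hyr : RegSeq c ys)
    (h : P (c ⊔ Ideal.ofList xs)) : P (c ⊔ Ideal.ofList ys) := by
  induction hn : xs.length generalizing c xs ys with
  | zero =>
    obtain rfl := List.eq_nil_of_length_eq_zero hn
    obtain rfl := List.eq_nil_of_length_eq_zero (hl ▸ hn)
    exact h
  | succ n ih =>
    rcases List.eq_nil_or_concat' xs with rfl | ⟨xs, x, rfl⟩
    · simp at hn
    rcases List.eq_nil_or_concat' ys with rfl | ⟨ys, y, rfl⟩
    · simp at hl
    simp only [List.length_append, List.length_singleton, Nat.add_right_cancel_iff] at hl hn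
    rw [regSeq_append] at hxr hyr
    have hxI : x ∈ I := hx x (by simp)
    have hyI : y ∈ I := hy y (by simp)
    have hx' : ∀ x ∈ xs, x ∈ I := fun z hz => hx z (by simp [hz])
    have hy' : ∀ x ∈ ys, x ∈ I := fun z hz => hy z (by simp [hz])
    obtain ⟨z, hz, hzx, hzy⟩ := exists_regMod_pair (hxr.2.1.not_hasSocle hxI)
      (hyr.2.1.not_hasSocle hyI)
    have h1 := regSeq_cons_of_concat (fun x h => hI (hx' x h)) (hI hz) hxr.1 hzx
    have h2 := regSeq_cons_of_concat (fun x h => hI (hy' x h)) (hI hz) hyr.1 hzy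
    rw [sup_ofList_append, ofList_singleton] at h ⊢
    refine hP _ _ _ hz hyI hzy hyr.2.1 ?_
    have h3 := hP _ _ _ hxI hz hxr.2.1 hzx h
    rw [sup_right_comm] at h3 ⊢
    exact ih hx' hy' hl h1.2 h2.2 h3 hn

lemma HasSocle.exchange [IsLocalRing A] [IsNoetherianRing A] {I c : Ideal A}
    (hI : I ≤ maximalIdeal A) {xs ys : List A} (hx : ∀ x ∈ xs, x ∈ I) (hy : ∀ y ∈ ys, y ∈ I)
    (hl : xs.length = ys.length) (hxr : RegSeq c xs) (hyr : RegSeq c ys)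
    (h : HasSocle I (c ⊔ Ideal.ofList xs)) : HasSocle I (c ⊔ Ideal.ofList ys) :=
  _root_.exchange (P := HasSocle I) hI
    (fun _ _ _ _ hv hu' hv' h => h.swap hv hu' hv') hx hy hl hxr hyr h

lemma SocPrincipal.exchange [IsLocalRing A] [IsNoetherianRing A] {I c : Ideal A}
    (hI : I ≤ maximalIdeal A) {xs ys : List A} (hx : ∀ x ∈ xs, x ∈ I) (hy : ∀ y ∈ ys, y ∈ I)
    (hl : xs.length = ys.length) (hxr : RegSeq c xs) (hyr : RegSeq c ys)
    (h : SocPrincipal I (c ⊔ Ideal.ofList xs)) : SocPrincipal I (c ⊔ Ideal.ofList ys) :=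
  _root_.exchange (P := SocPrincipal I) hI
    (fun _ _ _ hu hv hu' hv' h => h.swap hu hv hu' hv') hx hy hl hxr hyr h

end Socle

lemma eq_zero_of_add_natCast_eq {d : WithBot ℕ∞} {n : ℕ} (h : d + n = n) : d = 0 := by
  induction d using WithBot.recBotCoe with
  | bot => simp at h
  | coe d =>
    have h' : d + n = n := by exact_mod_cast h
    have : d = 0 := by
      refine (ENat.add_left_injective_of_ne_top (n := (n : ℕ∞)) (ENat.natCast_ne_top n)) ?_
      simpa using h'
    rw [this]; rfl

section Nice

set_option linter.unusedSectionVars false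

variable {A : Type} [CommRing A] [IsLocalRing A] [IsNoetherianRing A]

lemma ofList_le_maximalIdeal {xs : List A} (h : ∀ x ∈ xs, x ∈ maximalIdeal A) :
    Ideal.ofList xs ≤ maximalIdeal A := ofList_le_of_forall_mem h

lemma sup_ofList_ne_top {c : Ideal A} {xs : List A} (hc : c ≠ ⊤)
    (h : ∀ x ∈ xs, x ∈ maximalIdeal A) : c ⊔ Ideal.ofList xs ≠ ⊤ := fun h' =>
  (IsLocalRing.maximalIdeal.isMaximal A).ne_top (top_le_iff.1 (h' ▸
    sup_le (IsLocalRing.le_maximalIdeal hc) (ofList_le_maximalIdeal h)))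

lemma ringKrullDim_add_length {c : Ideal A} {xs : List A} (hc : c ≠ ⊤)
    (h : ∀ x ∈ xs, x ∈ maximalIdeal A) (hr : RegSeq c xs) :
    ringKrullDim (A ⧸ (c ⊔ Ideal.ofList xs)) + xs.length = ringKrullDim (A ⧸ c) := by
  have hnt : Nontrivial (A ⧸ c) := Ideal.Quotient.nontrivial_iff.2 hc
  have hreg : RingTheory.Sequence.IsRegular (A ⧸ c) xs :=
    (IsLocalRing.isRegular_iff_isWeaklyRegular_of_subset_maximalIdeal h).2
      ((regSeq_iff_isWeaklyRegular c xs).1 hr)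
  rw [← Module.supportDim_quotient_eq_ringKrullDim, ← Module.supportDim_quotient_eq_ringKrullDim,
    ← Module.supportDim_add_length_eq_supportDim_of_isRegular xs hreg]
  congr 1
  have hk : (Ideal.ofList xs • (⊤ : Submodule A (A ⧸ c))) =
      Submodule.map (Submodule.mkQ c) (c ⊔ Ideal.ofList xs) := by
    have h1 : (⊤ : Submodule A (A ⧸ c)) = Submodule.map (Submodule.mkQ c) ⊤ := by simp
    rw [h1, ← Submodule.map_smul'', Submodule.map_sup]
    have h2 : Submodule.map (Submodule.mkQ c) c = ⊥ := by simp
    rw [h2, bot_sup_eq]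
    simp
  exact Module.supportDim_eq_of_equiv ((Submodule.quotEquivOfEq _ _ hk ≪≫ₗ
      Submodule.quotientQuotientEquivQuotient c (c ⊔ Ideal.ofList xs) le_sup_left).symm)

lemma ringKrullDim_quotient_eq_zero_iff {c : Ideal A} (hc : c ≠ ⊤) :
    ringKrullDim (A ⧸ c) = 0 ↔ ∃ k, maximalIdeal A ^ k ≤ c := by
  have hnt : Nontrivial (A ⧸ c) := Ideal.Quotient.nontrivial_iff.2 hc
  rw [← ringKrullDimZero_iff_ringKrullDim_eq_zero,
    Ideal.krullDimLE_zero_quotient_iff_forall_minimalPrimes_isMaximal]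
  constructor
  · intro h
    refine Ideal.exists_pow_le_of_le_radical_of_fg ?_ (IsNoetherian.noetherian _)
    rw [← Ideal.sInf_minimalPrimes]
    exact le_sInf fun q hq => (IsLocalRing.eq_maximalIdeal (h q hq)).ge
  · rintro ⟨k, hk⟩ p hp
    have h1 : maximalIdeal A ≤ p := hp.1.1.le_of_pow_le (n := k) (hk.trans hp.1.2)
    rw [(IsLocalRing.maximalIdeal.isMaximal A).eq_of_le hp.1.1.ne_top h1 |>.symm]
    infer_instance

/-- There is a sequence of length `t` in the maximal ideal that is regular modulo `c`. -/
def Dp (c : Ideal A) (t : ℕ) : Prop :=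
  ∃ ys : List A, ys.length = t ∧ (∀ y ∈ ys, y ∈ maximalIdeal A) ∧ RegSeq c ys

/-- `A ⧸ c` is a Gorenstein local ring of dimension `t`. -/
def Nice (c : Ideal A) (t : ℕ) : Prop :=
  ∃ ys : List A, ys.length = t ∧ (∀ y ∈ ys, y ∈ maximalIdeal A) ∧ RegSeq c ys ∧
    (∃ k, maximalIdeal A ^ k ≤ c ⊔ Ideal.ofList ys) ∧
    SocPrincipal (maximalIdeal A) (c ⊔ Ideal.ofList ys)

lemma Nice.dp {c : Ideal A} {t : ℕ} (h : Nice c t) : Dp c t := by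
  obtain ⟨ys, h1, h2, h3, -⟩ := h
  exact ⟨ys, h1, h2, h3⟩

lemma Nice.ne_top {c : Ideal A} {t : ℕ} (h : Nice c t) : c ≠ ⊤ := by
  obtain ⟨ys, h1, h2, h3, -, σ, hσ, -⟩ := h
  rintro rfl
  simp at hσ

lemma Nice.ringKrullDim_eq {c : Ideal A} {t : ℕ} (h : Nice c t) : ringKrullDim (A ⧸ c) = t := by
  have hc := h.ne_top
  obtain ⟨ys, h1, h2, h3, h4, -⟩ := h
  rw [← ringKrullDim_add_length hc h2 h3,
    (ringKrullDim_quotient_eq_zero_iff (sup_ofList_ne_top hc h2)).2 h4, h1, zero_add]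

lemma Dp.mono {c : Ideal A} {s t : ℕ} (h : Dp c t) (hst : s ≤ t) : Dp c s := by
  obtain ⟨ys, rfl, h2, h3⟩ := h
  refine ⟨ys.take s, by simpa using hst, fun y hy => h2 y (List.mem_of_mem_take hy), ?_⟩
  rw [← List.take_append_drop s ys, regSeq_append] at h3
  exact h3.1

lemma Dp.not_hasSocle {c : Ideal A} {t : ℕ} (h : Dp c t) (ht : 0 < t) :
    ¬ HasSocle (maximalIdeal A) c := by
  obtain ⟨ys, rfl, h2, h3⟩ := h
  cases ys with
  | nil => simp at ht
  | cons y ys => exact h3.1.not_hasSocle (h2 y (by simp))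

lemma Dp.sup {c : Ideal A} {t : ℕ} {zs : List A} (h : Dp c (t + zs.length))
    (hz : ∀ z ∈ zs, z ∈ maximalIdeal A) (hr : RegSeq c zs) : Dp (c ⊔ Ideal.ofList zs) t := by
  induction t with
  | zero => exact ⟨[], rfl, by simp, trivial⟩
  | succ t ih =>
    obtain ⟨ws, hw1, hw2, hw3⟩ := ih (h.mono (by omega))
    have hcat : RegSeq c (zs ++ ws) := (regSeq_append _ _ _).2 ⟨hr, hw3⟩
    obtain ⟨ys, hy1, hy2, hy3⟩ := h
    set n := t + zs.length with hn
    have hlen : (ys.take n).length = (zs ++ ws).length := by simp; omega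
    rw [← List.take_append_drop n ys, regSeq_append] at hy3
    have hdrop : 0 < (ys.drop n).length := by simp; omega
    have hns : ¬ HasSocle (maximalIdeal A) (c ⊔ Ideal.ofList (ys.take n)) :=
      Dp.not_hasSocle ⟨_, rfl, fun y hy => hy2 y (List.mem_of_mem_drop hy), hy3.2⟩ hdrop
    have hzw : ∀ z ∈ zs ++ ws, z ∈ maximalIdeal A := fun z hz' =>
      (List.mem_append.1 hz').elim (hz z) (hw2 z)
    have hns' : ¬ HasSocle (maximalIdeal A) (c ⊔ Ideal.ofList (zs ++ ws)) := fun hs =>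
      hns (hs.exchange le_rfl hzw (fun y hy => hy2 y (List.mem_of_mem_take hy)) hlen.symm hcat
        hy3.1)
    obtain ⟨w, hw, hwr, -⟩ := exists_regMod_pair hns' hns'
    refine ⟨ws ++ [w], by simp [hw1], ?_, (regSeq_append _ _ _).2 ⟨hw3, ?_, trivial⟩⟩
    · intro y hy
      rcases List.mem_append.1 hy with hy | hy
      · exact hw2 y hy
      · rw [List.mem_singleton.1 hy]; exact hw
    · rwa [← sup_ofList_append]

lemma Dp.of_sup {c : Ideal A} {t : ℕ} {zs : List A} (h : Dp (c ⊔ Ideal.ofList zs) t)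
    (hz : ∀ z ∈ zs, z ∈ maximalIdeal A) (hr : RegSeq c zs) : Dp c (t + zs.length) := by
  obtain ⟨ys, rfl, h2, h3⟩ := h
  refine ⟨zs ++ ys, by simp [add_comm], ?_, (regSeq_append _ _ _).2 ⟨hr, h3⟩⟩
  exact fun z hz' => (List.mem_append.1 hz').elim (hz z) (h2 z)

lemma Nice.of_sup {c : Ideal A} {t : ℕ} {zs : List A} (h : Nice (c ⊔ Ideal.ofList zs) t)
    (hz : ∀ z ∈ zs, z ∈ maximalIdeal A) (hr : RegSeq c zs) : Nice c (t + zs.length) := by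
  obtain ⟨ys, rfl, h2, h3, h4, h5⟩ := h
  refine ⟨zs ++ ys, by simp [add_comm], ?_, (regSeq_append _ _ _).2 ⟨hr, h3⟩, ?_, ?_⟩
  · exact fun z hz' => (List.mem_append.1 hz').elim (hz z) (h2 z)
  · rwa [sup_ofList_append]
  · rwa [sup_ofList_append]

lemma Nice.sup {c : Ideal A} {t : ℕ} {zs : List A} (h : Nice c (t + zs.length))
    (hz : ∀ z ∈ zs, z ∈ maximalIdeal A) (hr : RegSeq c zs) : Nice (c ⊔ Ideal.ofList zs) t := by
  have hd := h.ringKrullDim_eq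
  have hc := h.ne_top
  obtain ⟨ws, hw1, hw2, hw3⟩ := h.dp.sup hz hr
  obtain ⟨ys, hy1, hy2, hy3, hy4, hy5⟩ := h
  have hzw : ∀ z ∈ zs ++ ws, z ∈ maximalIdeal A := fun z hz' =>
    (List.mem_append.1 hz').elim (hz z) (hw2 z)
  have hcat : RegSeq c (zs ++ ws) := (regSeq_append _ _ _).2 ⟨hr, hw3⟩
  refine ⟨ws, hw1, hw2, hw3, ?_, ?_⟩
  · rw [← sup_ofList_append, ← ringKrullDim_quotient_eq_zero_iff (sup_ofList_ne_top hc hzw)]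
    have h1 := ringKrullDim_add_length hc hzw hcat
    have h2 := ringKrullDim_add_length hc hy2 hy3
    rw [(ringKrullDim_quotient_eq_zero_iff (sup_ofList_ne_top hc hy2)).2 hy4, zero_add] at h2
    rw [← h2, List.length_append, hw1, hy1, add_comm zs.length] at h1
    exact eq_zero_of_add_natCast_eq h1
  · rw [← sup_ofList_append]
    exact hy5.exchange le_rfl hy2 hzw (by simp [hy1, hw1, add_comm]) hy3 hcat

end Nice

section NiceTransfer

set_option linter.unusedSectionVars false

variable {S R : Type} [CommRing S] [CommRing R] [IsLocalRing S] [IsLocalRing R]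
  [IsNoetherianRing S] [IsNoetherianRing R] {π : S →+* R}

lemma comap_maximalIdeal_of_surjective (hπ : Function.Surjective π) :
    (maximalIdeal R).comap π = maximalIdeal S :=
  IsLocalRing.eq_maximalIdeal (Ideal.comap_isMaximal_of_surjective π hπ)

lemma exists_list_lift (hπ : Function.Surjective π) (I : Ideal R) (ys : List R)
    (h : ∀ y ∈ ys, y ∈ I) : ∃ zs : List S, zs.map π = ys ∧ ∀ z ∈ zs, z ∈ I.comap π := by
  obtain ⟨zs, rfl⟩ := (List.map_surjective_iff.2 hπ) ys
  exact ⟨zs, rfl, fun z hz => h _ (List.mem_map_of_mem hz)⟩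

lemma Dp.comap (hπ : Function.Surjective π) {c : Ideal R} {t : ℕ} (h : Dp c t) :
    Dp (c.comap π) t := by
  obtain ⟨ys, rfl, h2, h3⟩ := h
  obtain ⟨zs, rfl, hz⟩ := exists_list_lift hπ _ ys h2
  rw [comap_maximalIdeal_of_surjective hπ] at hz
  exact ⟨zs, by simp, hz, (regSeq_comap_iff hπ c zs).2 h3⟩

lemma Nice.comap (hπ : Function.Surjective π) {c : Ideal R} {t : ℕ} (h : Nice c t) :
    Nice (c.comap π) t := by
  obtain ⟨ys, rfl, h2, h3, ⟨k, hk⟩, σ, hσ, h5, h6⟩ := h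
  obtain ⟨zs, rfl, hz⟩ := exists_list_lift hπ _ ys h2
  rw [comap_maximalIdeal_of_surjective hπ] at hz
  obtain ⟨σ, rfl⟩ := hπ σ
  have hm : maximalIdeal R = (maximalIdeal S).map π := by
    rw [← comap_maximalIdeal_of_surjective hπ, Ideal.map_comap_of_surjective π hπ]
  refine ⟨zs, by simp, hz, (regSeq_comap_iff hπ c zs).2 h3, ⟨k, ?_⟩, σ, ?_, ?_, ?_⟩
  · rw [← comap_sup_ofList hπ, ← Ideal.map_le_iff_le_comap, Ideal.map_pow, ← hm]
    exact hk
  · rw [← comap_sup_ofList hπ]; exact hσ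
  · intro r hr
    rw [← comap_sup_ofList hπ, Ideal.mem_comap, map_mul]
    exact h5 _ (hm ▸ Ideal.mem_map_of_mem _ hr)
  · intro b hb
    obtain ⟨a, ha⟩ := h6 (π b) (fun r hr => by
      obtain ⟨r, rfl⟩ := hπ r
      rw [← map_mul, ← Ideal.mem_comap, comap_sup_ofList hπ]
      exact hb r (by rwa [← comap_maximalIdeal_of_surjective hπ]))
    obtain ⟨a, rfl⟩ := hπ a
    exact ⟨a, by rw [← comap_sup_ofList hπ, Ideal.mem_comap]; simpa using ha⟩

end NiceTransfer

section SelfInjective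

set_option linter.unusedSectionVars false

variable {A : Type} [CommRing A] [IsLocalRing A] {Q : Type} [AddCommGroup Q] [Module A Q]

lemma length_le_one_of_forall_eq_smul {T : Type} [AddCommGroup T] [Module A T] {σ : T}
    (hσ : ∀ r ∈ maximalIdeal A, r • σ = 0) (h : ∀ x : T, ∃ a : A, x = a • σ) :
    Module.length A T ≤ 1 := by
  have hsimple : IsSimpleModule A (A ⧸ maximalIdeal A) :=
    isSimpleModule_iff_isCoatom.2 (IsLocalRing.maximalIdeal.isMaximal A).1
  have h1 : Module.length A (A ⧸ maximalIdeal A) = 1 := Module.length_eq_one_iff.2 hsimple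
  rw [← h1]
  refine Module.length_le_of_surjective
    (Submodule.liftQ (maximalIdeal A) (LinearMap.toSpanSingleton A T σ) ?_) ?_
  · intro r hr
    simpa using hσ r hr
  · intro x
    obtain ⟨a, rfl⟩ := h x
    exact ⟨(maximalIdeal A).mkQ a, by rw [Submodule.mkQ_apply, Submodule.liftQ_apply]; rfl⟩

lemma length_hom_simple_le {σ : Q} (hσ : ∀ r ∈ maximalIdeal A, r • σ = 0)
    (h : ∀ x : Q, (∀ r ∈ maximalIdeal A, r • x = 0) → ∃ a : A, x = a • σ)
    (M : Type) [AddCommGroup M] [Module A M] [hM : IsSimpleModule A M] :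
    Module.length A (M →ₗ[A] Q) ≤ 1 := by
  have : Nontrivial M := IsSimpleModule.nontrivial A M
  obtain ⟨x, hx⟩ := exists_ne (0 : M)
  have hgen := IsSimpleModule.toSpanSingleton_surjective A hx
  have hmx : ∀ r ∈ maximalIdeal A, r • x = 0 := by
    have hmax : Ideal.IsMaximal (LinearMap.ker (LinearMap.toSpanSingleton A M x)) :=
      IsSimpleModule.ker_toSpanSingleton_isMaximal A hx
    intro r hr
    rw [← IsLocalRing.eq_maximalIdeal hmax] at hr
    simpa using hr
  have hTle : Module.length A (Submodule.span A {σ}) ≤ 1 := by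
    refine length_le_one_of_forall_eq_smul (σ := ⟨σ, Submodule.mem_span_singleton_self σ⟩) ?_ ?_
    · intro r hr
      exact Subtype.ext (hσ r hr)
    · rintro ⟨y, hy⟩
      obtain ⟨a, rfl⟩ := Submodule.mem_span_singleton.1 hy
      exact ⟨a, rfl⟩
  refine le_trans (Module.length_le_of_injective
    (LinearMap.codRestrict (Submodule.span A {σ}) (LinearMap.applyₗ x) ?_) ?_) hTle
  · intro φ
    obtain ⟨a, ha⟩ := h (φ x) (fun r hr => by rw [← map_smul, hmx r hr, map_zero])
    exact Submodule.mem_span_singleton.2 ⟨a, ha.symm⟩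
  · intro φ ψ hφ
    have : φ x = ψ x := congrArg Subtype.val hφ
    ext y
    obtain ⟨a, rfl⟩ := hgen y
    simp [this]

lemma length_hom_le {σ : Q} (hσ : ∀ r ∈ maximalIdeal A, r • σ = 0)
    (h : ∀ x : Q, (∀ r ∈ maximalIdeal A, r • x = 0) → ∃ a : A, x = a • σ)
    (M : Type) [AddCommGroup M] [Module A M] (hM : IsFiniteLength A M) :
    Module.length A (M →ₗ[A] Q) ≤ Module.length A M := by
  induction hM with
  | @of_subsingleton M _ _ _ =>
    have : Subsingleton (M →ₗ[A] Q) := ⟨fun f g => by ext x; rw [Subsingleton.elim x 0]; simp⟩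
    simp
  | @of_simple_quotient M _ _ N hs hN ih =>
    have h1 : Module.length A M = Module.length A N + Module.length A (M ⧸ N) :=
      Module.length_eq_add_of_exact N.subtype N.mkQ N.subtype_injective N.mkQ_surjective
        (LinearMap.exact_subtype_mkQ N)
    set res : (M →ₗ[A] Q) →ₗ[A] (N →ₗ[A] Q) := LinearMap.lcomp A Q N.subtype with hres
    have h2 : Module.length A (M →ₗ[A] Q) =
        Module.length A (LinearMap.ker res) + Module.length A (LinearMap.range res) :=
      Module.length_eq_add_of_exact (LinearMap.ker res).subtype res.rangeRestrict
        (Submodule.subtype_injective _) res.surjective_rangeRestrict (by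
          rw [LinearMap.exact_iff]; simp)
    have h3 : Module.length A (LinearMap.range res) ≤ Module.length A (N →ₗ[A] Q) :=
      Module.length_le_of_injective (Submodule.subtype _) (Submodule.subtype_injective _)
    have h4 : Module.length A (LinearMap.ker res) ≤ 1 := by
      refine le_trans (Module.length_le_of_surjective
        (LinearMap.codRestrict (LinearMap.ker res) (LinearMap.lcomp A Q N.mkQ) ?_) ?_)
        (length_hom_simple_le hσ h (M ⧸ N))
      · intro φ
        ext x
        have : N.mkQ (x : M) = 0 := by simp
        rw [hres, LinearMap.lcomp_apply, LinearMap.lcomp_apply, Submodule.subtype_apply, this]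
        simp
      · rintro ⟨φ, hφ⟩
        refine ⟨N.liftQ φ ?_, ?_⟩
        · intro x hx
          have := LinearMap.congr_fun (LinearMap.mem_ker.1 hφ) ⟨x, hx⟩
          simpa [hres] using this
        · ext x; rfl
    have h5 : Module.length A (M ⧸ N) = 1 := Module.length_eq_one_iff.2 hs
    rw [h1, h2, h5, add_comm]
    exact add_le_add (h3.trans ih) h4

lemma lcomp_surjective {σ : Q} (hσ : ∀ r ∈ maximalIdeal A, r • σ = 0)
    (h : ∀ x : Q, (∀ r ∈ maximalIdeal A, r • x = 0) → ∃ a : A, x = a • σ)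
    (hQ : IsFiniteLength A Q) (hQQ : Module.length A Q ≤ Module.length A (Q →ₗ[A] Q))
    {M : Type} [AddCommGroup M] [Module A M] (ι : M →ₗ[A] Q) (hι : Function.Injective ι) :
    Function.Surjective (LinearMap.lcomp A Q ι) := by
  set res : (Q →ₗ[A] Q) →ₗ[A] (M →ₗ[A] Q) := LinearMap.lcomp A Q ι with hres
  set N := LinearMap.range ι
  have hM : IsFiniteLength A M := hQ.of_injective hι
  have h1 : Module.length A Q = Module.length A M + Module.length A (Q ⧸ N) :=
      Module.length_eq_add_of_exact ι N.mkQ hι N.mkQ_surjective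
        (LinearMap.exact_map_mkQ_range ι)
  have h2 : Module.length A (Q →ₗ[A] Q) =
      Module.length A (LinearMap.ker res) + Module.length A (LinearMap.range res) :=
    Module.length_eq_add_of_exact (LinearMap.ker res).subtype res.rangeRestrict
      (Submodule.subtype_injective _) res.surjective_rangeRestrict (by
        rw [LinearMap.exact_iff]; simp)
  have h4 : Module.length A (LinearMap.ker res) ≤ Module.length A (Q ⧸ N) := by
    refine le_trans (Module.length_le_of_surjective
      (LinearMap.codRestrict (LinearMap.ker res) (LinearMap.lcomp A Q N.mkQ) ?_) ?_)
      (length_hom_le hσ h (Q ⧸ N) (hQ.of_surjective N.mkQ_surjective))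
    · intro φ
      ext x
      have : N.mkQ (ι x) = 0 := by simp [N]
      simp [hres, this]
    · rintro ⟨φ, hφ⟩
      refine ⟨N.liftQ φ ?_, ?_⟩
      · rintro _ ⟨x, rfl⟩
        have := LinearMap.congr_fun (LinearMap.mem_ker.1 hφ) x
        simpa [hres] using this
      · ext x; rfl
  have h5 : Module.length A (M →ₗ[A] Q) =
      Module.length A (LinearMap.range res) +
        Module.length A ((M →ₗ[A] Q) ⧸ LinearMap.range res) :=
    Module.length_eq_add_of_exact (LinearMap.range res).subtype (LinearMap.range res).mkQ
      (Submodule.subtype_injective _) (Submodule.mkQ_surjective _)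
      (LinearMap.exact_subtype_mkQ _)
  have h6 := length_hom_le hσ h M hM
  have hne : Module.length A Q ≠ ⊤ := Module.length_ne_top_iff.2 hQ
  have h7 : Module.length A ((M →ₗ[A] Q) ⧸ LinearMap.range res) = 0 := by
    rw [h1] at hQQ hne
    rw [h2] at hQQ
    rw [h5] at h6
    generalize Module.length A M = a at *
    generalize Module.length A (Q ⧸ N) = b at *
    generalize Module.length A (LinearMap.ker res) = c at *
    generalize Module.length A (LinearMap.range res) = d at *
    generalize Module.length A ((M →ₗ[A] Q) ⧸ LinearMap.range res) = e at *
    have ha : a ≠ ⊤ := fun h => hne (by simp [h])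
    have hb : b ≠ ⊤ := fun h => hne (by simp [h])
    have hd : d ≠ ⊤ := fun h => by rw [h] at h6; simp at h6; exact ha h6
    have he : e ≠ ⊤ := fun h => by rw [h] at h6; simp at h6; exact ha h6
    have hc : c ≠ ⊤ := fun h => by rw [h] at h4; simp at h4; exact hb h4
    lift a to ℕ using ha
    lift b to ℕ using hb
    lift c to ℕ using hc
    lift d to ℕ using hd
    lift e to ℕ using he
    norm_cast at *
    omega
  rw [Module.length_eq_zero_iff, Submodule.Quotient.subsingleton_iff] at h7
  exact LinearMap.range_eq_top.1 h7

end SelfInjective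

section DualInj

set_option linter.unusedSectionVars false

variable {A : Type} [CommRing A]

/-- Every map `(l) ⧸ c → A ⧸ c` prescribed on generators is a multiplication map. -/
def DualInj (c : Ideal A) {n : ℕ} (l : Fin n → A) : Prop :=
  ∀ b : Fin n → A, (∀ s : Fin n → A, ∑ j, s j * l j ∈ c → ∑ j, s j * b j ∈ c) →
    ∃ a, ∀ j, b j - a * l j ∈ c

variable [IsLocalRing A] [IsNoetherianRing A]

lemma isFiniteLength_quotient {q : Ideal A} {k : ℕ} (hk : maximalIdeal A ^ k ≤ q) :
    IsFiniteLength A (A ⧸ q) := by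
  rw [isFiniteLength_iff_isNoetherian_isArtinian]
  refine ⟨inferInstance, ?_⟩
  by_cases hq : q = ⊤
  · have : Subsingleton (A ⧸ q) := Ideal.Quotient.subsingleton_iff.2 hq
    infer_instance
  have hnt : Nontrivial (A ⧸ q) := Ideal.Quotient.nontrivial_iff.2 hq
  have h0 : Ring.KrullDimLE 0 (A ⧸ q) := by
    rw [ringKrullDimZero_iff_ringKrullDim_eq_zero, ringKrullDim_quotient_eq_zero_iff hq]
    exact ⟨k, hk⟩
  have : IsArtinianRing (A ⧸ q) := isArtinianRing_iff_isNoetherianRing_krullDimLE_zero.2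
    ⟨inferInstance, h0⟩
  exact isArtinian_of_surjective_algebraMap (R := A ⧸ q) (M := A ⧸ q) (S := A)
    Ideal.Quotient.mk_surjective

lemma SocPrincipal.dualInj {q : Ideal A} {k : ℕ} (hk : maximalIdeal A ^ k ≤ q)
    (h : SocPrincipal (maximalIdeal A) q) {n : ℕ} (l : Fin n → A) : DualInj q l := by
  obtain ⟨σ, -, hσ, h⟩ := h
  have key : ∀ r d : A, r • q.mkQ d = 0 ↔ r * d ∈ q := fun r d => by
    rw [← map_smul, Submodule.mkQ_apply, Submodule.Quotient.mk_eq_zero, smul_eq_mul]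
  intro b hb
  set f : (Fin n → A) →ₗ[A] A ⧸ q := q.mkQ ∘ₗ Fintype.linearCombination A l with hf
  set g : (Fin n → A) →ₗ[A] A ⧸ q := q.mkQ ∘ₗ Fintype.linearCombination A b with hg
  have hmemf : ∀ s, f s = 0 ↔ ∑ j, s j * l j ∈ q := fun s => by
    rw [hf, LinearMap.comp_apply, Submodule.mkQ_apply, Submodule.Quotient.mk_eq_zero,
      Fintype.linearCombination_apply]
    rfl
  have hmemg : ∀ s, g s = 0 ↔ ∑ j, s j * b j ∈ q := fun s => by
    rw [hg, LinearMap.comp_apply, Submodule.mkQ_apply, Submodule.Quotient.mk_eq_zero,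
      Fintype.linearCombination_apply]
    rfl
  have hle : LinearMap.ker f ≤ LinearMap.ker g := by
    intro s hs
    rw [LinearMap.mem_ker] at *
    exact (hmemg s).2 (hb s ((hmemf s).1 hs))
  obtain ⟨φ, hφ⟩ := lcomp_surjective (σ := q.mkQ σ) (fun r hr => (key r σ).2 (hσ r hr))
    (fun x hx => by
      obtain ⟨x, rfl⟩ := q.mkQ_surjective x
      obtain ⟨a, ha⟩ := h x (fun r hr => (key r x).1 (hx r hr))
      refine ⟨a, ?_⟩
      rw [← map_smul]
      exact (Submodule.Quotient.eq q).2 ha)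
    (isFiniteLength_quotient hk)
    (Module.length_le_of_injective (LinearMap.mul A (A ⧸ q)) (fun x y hxy => by
      simpa using LinearMap.congr_fun hxy 1))
    ((LinearMap.ker f).liftQ f le_rfl) (LinearMap.ker_eq_bot.1 (by
      rw [Submodule.ker_liftQ, Submodule.mkQ_map_self]))
    ((LinearMap.ker f).liftQ g hle)
  obtain ⟨a, ha⟩ := q.mkQ_surjective (φ 1)
  refine ⟨a, fun j => ?_⟩
  have h1 := LinearMap.congr_fun hφ ((LinearMap.ker f).mkQ (Pi.single j 1))
  simp only [LinearMap.lcomp_apply, Submodule.mkQ_apply, Submodule.liftQ_apply] at h1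
  have h2 : f (Pi.single j 1) = l j • (1 : A ⧸ q) := by
    simp [hf, Fintype.linearCombination_apply, Pi.single_apply, Algebra.smul_def]
  have h3 : g (Pi.single j 1) = q.mkQ (b j) := by
    simp [hg, Fintype.linearCombination_apply, Pi.single_apply]
  rw [h2, h3, map_smul, ← ha, ← map_smul, smul_eq_mul] at h1
  have := (Submodule.Quotient.eq q).1 h1
  rw [← neg_mem_iff, neg_sub, mul_comm a]
  exact this

end DualInj

section Duality

set_option linter.unusedSectionVars false

variable {A : Type} [CommRing A]

lemma mem_colon_iff {c L : Ideal A} {x : A} :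
    x ∈ c.colon (L : Set A) ↔ ∀ l ∈ L, x * l ∈ c := by
  simp [Submodule.mem_colon]

lemma RegMod.colon {c : Ideal A} {y : A} (h : RegMod c y) (L : Ideal A) :
    RegMod (c.colon (L : Set A)) y := by
  intro b hb
  rw [mem_colon_iff] at *
  intro l hl
  refine h _ ?_
  simpa [mul_assoc] using hb l hl

lemma colon_sup_le (c L d : Ideal A) :
    c.colon (L : Set A) ⊔ d ≤ (c ⊔ d).colon ((L ⊔ d : Ideal A) : Set A) := by
  refine sup_le ?_ ?_
  · intro x hx
    rw [mem_colon_iff] at *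
    intro l hl
    obtain ⟨u, hu, v, hv, rfl⟩ := Submodule.mem_sup.1 hl
    rw [mul_add]
    exact add_mem (Ideal.mem_sup_left (hx u hu)) (Ideal.mem_sup_right (Ideal.mul_mem_left _ _ hv))
  · intro x hx
    rw [mem_colon_iff]
    intro l _
    exact Ideal.mem_sup_right (Ideal.mul_mem_right _ _ hx)

lemma mem_colon_generators {c L : Ideal A} {n : ℕ} {l : Fin n → A}
    (hl : Ideal.span (Set.range l) ⊔ c = L) {x : A} (hx : ∀ j, x * l j ∈ c) :
    x ∈ c.colon (L : Set A) := by
  rw [mem_colon_iff]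
  have : L ≤ Submodule.comap (LinearMap.mulLeft A x) c := by
    rw [← hl]
    refine sup_le (Ideal.span_le.2 ?_) fun y hy => Ideal.mul_mem_left _ _ hy
    rintro _ ⟨j, rfl⟩
    exact hx j
  exact this

lemma DualInj.colon_sup {c L : Ideal A} {n : ℕ} {l : Fin n → A}
    (hl : Ideal.span (Set.range l) ⊔ c = L) (h : DualInj c l) {x : A} (hx : RegMod c x) :
    (c ⊔ Ideal.span {x}).colon ((L ⊔ Ideal.span {x} : Ideal A) : Set A) =
      c.colon (L : Set A) ⊔ Ideal.span {x} := by
  refine le_antisymm ?_ (colon_sup_le c L _)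
  intro r hr
  rw [mem_colon_iff] at hr
  have hlL : ∀ j, l j ∈ L := fun j =>
    hl ▸ Ideal.mem_sup_left (Ideal.subset_span ⟨j, rfl⟩)
  have hb : ∀ j, ∃ b, r * l j - b * x ∈ c := fun j =>
    mem_sup_span_singleton.1 (hr (l j) (Ideal.mem_sup_left (hlL j)))
  choose b hb using hb
  obtain ⟨a, ha⟩ := h b fun s hs => by
    refine hx _ ?_
    have h1 : ∑ j, s j * (r * l j - b j * x) ∈ c :=
      sum_mem fun j _ => Ideal.mul_mem_left _ _ (hb j)
    have h2 : x * ∑ j, s j * b j = r * ∑ j, s j * l j - ∑ j, s j * (r * l j - b j * x) := by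
      simp only [Finset.mul_sum, ← Finset.sum_sub_distrib]
      exact Finset.sum_congr rfl fun j _ => by ring
    rw [h2]
    exact sub_mem (Ideal.mul_mem_left _ _ hs) h1
  refine mem_sup_span_singleton.2 ⟨a, mem_colon_generators hl fun j => ?_⟩
  have : (r - a * x) * l j = (r * l j - b j * x) + x * (b j - a * l j) := by ring
  rw [this]
  exact add_mem (hb j) (Ideal.mul_mem_left _ _ (ha j))

variable [IsLocalRing A] [IsNoetherianRing A]

lemma DualInj.of_sup_span_singleton {c L : Ideal A} {n : ℕ} {l : Fin n → A}
    (hl : Ideal.span (Set.range l) ⊔ c = L) {y : A} (hy : y ∈ maximalIdeal A)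
    (hc : RegMod c y) (hL : RegMod L y) (h : DualInj (c ⊔ Ideal.span {y}) l) : DualInj c l := by
  let M : Submodule A (Fin n → A) :=
    { carrier := {b | ∀ s : Fin n → A, ∑ j, s j * l j ∈ c → ∑ j, s j * b j ∈ c}
      add_mem' := fun {a b} ha hb s hs => by
        simpa [mul_add, Finset.sum_add_distrib] using add_mem (ha s hs) (hb s hs)
      zero_mem' := fun s _ => by simp
      smul_mem' := fun a b hb s hs => by
        have := Ideal.mul_mem_left _ a (hb s hs)
        rw [Finset.mul_sum] at this
        convert this using 2 with j
        simp only [Pi.smul_apply, smul_eq_mul]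
        ring }
  let N : Submodule A (Fin n → A) :=
    { carrier := {b | ∃ a, ∀ j, b j - a * l j ∈ c}
      add_mem' := by
        rintro b b' ⟨a, ha⟩ ⟨a', ha'⟩
        refine ⟨a + a', fun j => ?_⟩
        have := add_mem (ha j) (ha' j)
        convert this using 1
        simp only [Pi.add_apply]
        ring
      zero_mem' := ⟨0, fun j => by simp⟩
      smul_mem' := by
        rintro r b ⟨a, ha⟩
        refine ⟨r * a, fun j => ?_⟩
        have := Ideal.mul_mem_left _ r (ha j)
        convert this using 1
        simp only [Pi.smul_apply, smul_eq_mul]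
        ring }
  have key : M ≤ N := by
    refine Submodule.le_of_le_smul_of_le_jacobson_bot (I := Ideal.span {y})
      (IsNoetherian.noetherian M) ?_ ?_
    · rw [IsLocalRing.jacobson_eq_maximalIdeal _ bot_ne_top]
      simpa [Ideal.span_le] using hy
    · intro b hb
      obtain ⟨a, ha⟩ := h b (by
        intro s hs
        obtain ⟨w, hw⟩ := mem_sup_span_singleton.1 hs
        have hwL : w ∈ L := by
          refine hL w ?_
          have h1 : ∑ j, s j * l j ∈ L := by
            rw [← hl]
            exact Ideal.mem_sup_left
              (sum_mem fun j _ => Ideal.mul_mem_left _ _ (Ideal.subset_span ⟨j, rfl⟩))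
          have h2 : ∑ j, s j * l j - w * y ∈ L := by
            rw [← hl]; exact Ideal.mem_sup_right hw
          have h3 := sub_mem h1 h2
          simpa [mul_comm] using h3
        rw [← hl] at hwL
        obtain ⟨u, hu, v, hv, huv⟩ := Submodule.mem_sup.1 hwL
        obtain ⟨w', hw'⟩ := mem_span_range_iff.1 hu
        have h4 := hb (fun j => s j - y * w' j) (by
          have : ∑ j, (s j - y * w' j) * l j = (∑ j, s j * l j - w * y) + y * v := by
            rw [← huv, ← hw']
            simp only [sub_mul, Finset.sum_sub_distrib, mul_assoc, ← Finset.mul_sum]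
            ring
          rw [this]
          exact add_mem hw (Ideal.mul_mem_left _ _ hv))
        refine mem_sup_span_singleton.2 ⟨∑ j, w' j * b j, ?_⟩
        convert h4 using 1
        simp only [sub_mul, Finset.sum_sub_distrib, mul_assoc, ← Finset.mul_sum]
        ring)
      choose b' hb' using fun j => mem_sup_span_singleton.1 (ha j)
      have hb'M : b' ∈ M := by
        intro s hs
        refine hc _ ?_
        have h1 : ∑ j, s j * (b j - a * l j - b' j * y) ∈ c :=
          sum_mem fun j _ => Ideal.mul_mem_left _ _ (hb' j)
        have h2 : y * ∑ j, s j * b' j = (∑ j, s j * b j - a * ∑ j, s j * l j) -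
            ∑ j, s j * (b j - a * l j - b' j * y) := by
          simp only [Finset.mul_sum, ← Finset.sum_sub_distrib]
          exact Finset.sum_congr rfl fun j _ => by ring
        rw [h2]
        exact sub_mem (sub_mem (hb s hs) (Ideal.mul_mem_left _ _ hs)) h1
      refine Submodule.mem_sup.2 ⟨b - y • b', ⟨a, fun j => ?_⟩, y • b',
        Submodule.smul_mem_smul (Ideal.mem_span_singleton_self y) hb'M, by simp⟩
      convert hb' j using 1
      simp only [Pi.sub_apply, Pi.smul_apply, smul_eq_mul]
      ring
  exact fun b hb => key hb

lemma SocPrincipal.colon_colon_le {q L : Ideal A} {k : ℕ} (hk : maximalIdeal A ^ k ≤ q)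
    (h : SocPrincipal (maximalIdeal A) q) (hqL : q ≤ L) :
    q.colon ((q.colon (L : Set A) : Ideal A) : Set A) ≤ L := by
  by_contra hne
  obtain ⟨x, hx, hxL⟩ : ∃ x ∈ q.colon ((q.colon (L : Set A) : Ideal A) : Set A), x ∉ L ∧
      ∀ r ∈ maximalIdeal A, r * x ∈ L := by
    by_contra hcon
    push Not at hcon
    refine hne ?_
    have : ∀ i, maximalIdeal A ^ i *
        q.colon ((q.colon (L : Set A) : Ideal A) : Set A) ≤ L → 
        q.colon ((q.colon (L : Set A) : Ideal A) : Set A) ≤ L := by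
      intro i
      induction i with
      | zero => intro h; simpa using h
      | succ i ih =>
        intro hi
        refine ih (Ideal.mul_le.2 ?_)
        intro r hr s hs
        by_contra hrs
        obtain ⟨u, hu, hu'⟩ := hcon (r * s) (Ideal.mul_mem_left _ _ hs) hrs
        refine hu' (hi ?_)
        rw [← mul_assoc, pow_succ']
        exact Ideal.mul_mem_mul (Ideal.mul_mem_mul hu hr) hs
    exact this k (Ideal.mul_le_left.trans (hk.trans hqL))
  obtain ⟨n, l, hl⟩ := exists_fin_generators L
  have hD := h.dualInj hk (Fin.cons x l : Fin (n + 1) → A)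
  obtain ⟨σ, hσ, hσ', -⟩ := h
  obtain ⟨a, ha⟩ := hD (Fin.cons σ 0 : Fin (n + 1) → A) (by
    intro s hs
    rw [Fin.sum_univ_succ] at *
    simp only [Fin.cons_zero, Fin.cons_succ, Pi.zero_apply, mul_zero, Finset.sum_const_zero,
      add_zero] at *
    refine hσ' _ ((IsLocalRing.mem_maximalIdeal _).2 fun hu => hxL.1 ?_)
    have h1 : s 0 * x ∈ L := by
      have h2 : ∑ i : Fin n, s i.succ * l i ∈ L := by
        rw [← hl]
        exact sum_mem fun j _ => Ideal.mul_mem_left _ _ (Ideal.subset_span ⟨j, rfl⟩)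
      simpa using sub_mem (hqL hs) h2
    exact (Ideal.unit_mul_mem_iff_mem _ hu).1 h1)
  have h0 := ha 0
  simp only [Fin.cons_zero] at h0
  have haL : a ∈ q.colon (L : Set A) := by
    refine mem_colon_generators (l := l) (by rw [hl]; exact sup_eq_left.2 hqL) fun j => ?_
    simpa using ha j.succ
  refine hσ ?_
  have h2 := mem_colon_iff.1 hx a haL
  have := add_mem h0 h2
  rwa [mul_comm x, sub_add_cancel] at this

theorem Nice.duality {t : ℕ} : ∀ {c L : Ideal A}, c ≤ L → Nice c t → Dp L t →
    (∀ (n : ℕ) (l : Fin n → A), Ideal.span (Set.range l) ⊔ c = L → DualInj c l) ∧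
      c.colon ((c.colon (L : Set A) : Ideal A) : Set A) = L ∧ Dp (c.colon (L : Set A)) t := by
  have hle : ∀ c L : Ideal A, L ≤ c.colon ((c.colon (L : Set A) : Ideal A) : Set A) := by
    intro c L x hx
    rw [mem_colon_iff]
    intro r hr
    rw [mul_comm]
    exact mem_colon_iff.1 hr x hx
  induction t with
  | zero =>
    intro c L hcL hc hL
    obtain ⟨ys, h1, h2, h3, ⟨k, hk⟩, h5⟩ := hc
    obtain rfl := List.length_eq_zero_iff.1 h1
    simp only [Ideal.ofList_nil, sup_bot_eq] at hk h5
    exact ⟨fun n l _ => h5.dualInj hk l, le_antisymm (h5.colon_colon_le hk hcL) (hle c L),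
      [], rfl, by simp, trivial⟩
  | succ t ih =>
    intro c L hcL hc hL
    obtain ⟨y, hy, hyc, hyL⟩ := exists_regMod_pair (hc.dp.not_hasSocle (Nat.succ_pos t))
      (hL.not_hasSocle (Nat.succ_pos t))
    have hy' : ∀ z ∈ [y], z ∈ maximalIdeal A := by simpa using hy
    have hc1 := Nice.sup (zs := [y]) hc hy' ⟨hyc, trivial⟩
    have hL1 := Dp.sup (zs := [y]) hL hy' ⟨hyL, trivial⟩
    rw [ofList_singleton] at hc1 hL1
    obtain ⟨i1, i2, i3⟩ := ih (sup_le_sup_right hcL _) hc1 hL1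
    have hD : ∀ (n : ℕ) (l : Fin n → A), Ideal.span (Set.range l) ⊔ c = L → DualInj c l := by
      intro n l hl
      refine DualInj.of_sup_span_singleton hl hy hyc hyL (i1 n l ?_)
      rw [← sup_assoc, hl]
    obtain ⟨n, l, hl⟩ := exists_fin_generators L
    have hl' : Ideal.span (Set.range l) ⊔ c = L := by rw [hl]; exact sup_eq_left.2 hcL
    have hS := (hD n l hl').colon_sup hl' hyc
    refine ⟨hD, le_antisymm ?_ (hle c L), ?_⟩
    · refine Submodule.le_of_le_smul_of_le_jacobson_bot (I := Ideal.span {y})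
        (IsNoetherian.noetherian _) ?_ ?_
      · rw [IsLocalRing.jacobson_eq_maximalIdeal _ bot_ne_top]
        simpa [Ideal.span_le] using hy
      · intro d hd
        have h1 := colon_sup_le c (c.colon (L : Set A)) (Ideal.span {y}) (Ideal.mem_sup_left hd)
        rw [← hS, i2] at h1
        obtain ⟨a, ha⟩ := mem_sup_span_singleton.1 h1
        have h2 := sub_mem hd (hle c L ha)
        refine Submodule.mem_sup.2 ⟨_, ha, y * a, Submodule.smul_mem_smul
          (Ideal.mem_span_singleton_self y) (hyc.colon _ a ?_), by ring⟩
        convert h2 using 1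
        ring
    · rw [hS] at i3
      exact Dp.of_sup (zs := [y]) (by rwa [ofList_singleton]) hy' ⟨hyc.colon _, trivial⟩

theorem Nice.colon_sup_ofList {t : ℕ} : ∀ {zs : List A} {c L : Ideal A}, c ≤ L →
    Nice c (t + zs.length) → Dp L (t + zs.length) → (∀ z ∈ zs, z ∈ maximalIdeal A) →
    RegSeq c zs → RegSeq L zs →
    (c ⊔ Ideal.ofList zs).colon ((L ⊔ Ideal.ofList zs : Ideal A) : Set A) =
      c.colon (L : Set A) ⊔ Ideal.ofList zs ∧ RegSeq (c.colon (L : Set A)) zs := by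
  intro zs
  induction zs with
  | nil => intro c L _ _ _ _ _ _; simp
  | cons z zs ih =>
    intro c L hcL hc hL hz hcz hLz
    rw [regSeq_cons] at hcz hLz
    have hz' : ∀ x ∈ [z], x ∈ maximalIdeal A := by simpa using hz z (by simp)
    rw [List.length_cons, ← add_assoc] at hc hL
    have hc1 := Nice.sup (zs := [z]) hc hz' ⟨hcz.1, trivial⟩
    have hL1 := Dp.sup (zs := [z]) hL hz' ⟨hLz.1, trivial⟩
    rw [ofList_singleton] at hc1 hL1
    obtain ⟨n, l, hl⟩ := exists_fin_generators L
    have hl' : Ideal.span (Set.range l) ⊔ c = L := by rw [hl]; exact sup_eq_left.2 hcL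
    have hS := ((Nice.duality hcL hc hL).1 n l hl').colon_sup hl' hcz.1
    obtain ⟨j1, j2⟩ := ih (sup_le_sup_right hcL _) hc1 hL1
      (fun x hx => hz x (by simp [hx])) hcz.2 hLz.2
    rw [hS] at j1 j2
    simp only [sup_ofList_cons]
    exact ⟨j1, hcz.1.colon _, j2⟩

end Duality

section Grade

set_option linter.unusedSectionVars false

variable {A : Type} [CommRing A] [IsLocalRing A] [IsNoetherianRing A]

lemma isRegular_iff_of_mem_maximalIdeal {xs : List A} (h : ∀ x ∈ xs, x ∈ maximalIdeal A) :
    RingTheory.Sequence.IsRegular A xs ↔ RegSeq (⊥ : Ideal A) xs := by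
  rw [isRegular_iff_regSeq, and_iff_left]
  have := sup_ofList_ne_top (c := (⊥ : Ideal A)) bot_ne_top h
  rwa [bot_sup_eq] at this

lemma forall_mem_maximalIdeal_of_ofList_ne_top {xs : List A} (h : Ideal.ofList xs ≠ ⊤) :
    ∀ x ∈ xs, x ∈ maximalIdeal A := fun _ hx => IsLocalRing.le_maximalIdeal h (mem_ofList hx)

lemma length_le_of_hasSocle {L : Ideal A} (hL : L ≤ maximalIdeal A) {xs ys : List A}
    (hx : ∀ x ∈ xs, x ∈ L) (hxr : RegSeq ⊥ xs) (hs : HasSocle L (Ideal.ofList xs))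
    (hy : ∀ y ∈ ys, y ∈ L) (hyr : RegSeq ⊥ ys) : ys.length ≤ xs.length := by
  by_contra! hlt
  have h1 := List.take_append_drop xs.length ys
  obtain ⟨y, zs, hd⟩ : ∃ y zs, ys.drop xs.length = y :: zs := by
    cases hd : ys.drop xs.length with
    | nil => have := congrArg List.length hd; simp at this; omega
    | cons y zs => exact ⟨y, zs, rfl⟩
  rw [hd] at h1
  have hmem : ∀ z, z ∈ ys.take xs.length ++ y :: zs → z ∈ L := by rw [h1]; exact hy
  rw [← h1, regSeq_append, regSeq_cons] at hyr
  have := HasSocle.exchange (c := ⊥) hL (ys := ys.take xs.length) hx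
    (fun z hz => hmem z (by simp [hz])) (by simp; omega) hxr hyr.1 (by rwa [bot_sup_eq])
  exact RegMod.not_hasSocle (hmem y (by simp)) hyr.2.1 this

lemma gradeOf_eq_length {L : Ideal A} (hL : L ≤ maximalIdeal A) {xs : List A}
    (hx : ∀ x ∈ xs, x ∈ L) (hxr : RegSeq ⊥ xs) (hs : HasSocle L (Ideal.ofList xs)) :
    gradeOf A L = xs.length := by
  refine IsGreatest.csSup_eq ⟨⟨xs, rfl, hx, ?_⟩, ?_⟩
  · exact (isRegular_iff_of_mem_maximalIdeal fun x h => hL (hx x h)).2 hxr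
  · rintro _ ⟨ys, rfl, hy, hyr⟩
    exact length_le_of_hasSocle hL hx hxr hs hy
      ((isRegular_iff_of_mem_maximalIdeal fun x h => hL (hy x h)).1 hyr)

lemma length_le_ringKrullDim {c : Ideal A} (hc : c ≠ ⊤) {xs : List A}
    (h : ∀ x ∈ xs, x ∈ maximalIdeal A) (hr : RegSeq c xs) :
    (xs.length : WithBot ℕ∞) ≤ ringKrullDim (A ⧸ c) := by
  rw [← ringKrullDim_add_length hc h hr]
  have : Nontrivial (A ⧸ (c ⊔ Ideal.ofList xs)) :=
    Ideal.Quotient.nontrivial_iff.2 (sup_ofList_ne_top hc h)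
  exact le_add_of_nonneg_left ringKrullDim_nonneg_of_nontrivial

lemma exists_regSeq_length_eq_gradeOf {L : Ideal A} (hL : L ≤ maximalIdeal A) :
    ∃ xs : List A, (∀ x ∈ xs, x ∈ L) ∧ RegSeq ⊥ xs ∧ HasSocle L (Ideal.ofList xs) ∧
      xs.length = gradeOf A L := by
  obtain ⟨xs, hx, hxr, hs⟩ : ∃ xs : List A, (∀ x ∈ xs, x ∈ L) ∧ RegSeq ⊥ xs ∧
      HasSocle L (Ideal.ofList xs) := by
    by_contra! hcon
    have : ∀ n : ℕ, ∃ xs : List A, xs.length = n ∧ (∀ x ∈ xs, x ∈ L) ∧ RegSeq ⊥ xs := by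
      intro n
      induction n with
      | zero => exact ⟨[], rfl, by simp, trivial⟩
      | succ n ih =>
        obtain ⟨xs, rfl, hx, hxr⟩ := ih
        have hns := hcon xs hx hxr
        obtain ⟨z, hz, hz', -⟩ := exists_regMod_pair hns hns
        refine ⟨xs ++ [z], by simp, ?_, (regSeq_append _ _ _).2 ⟨hxr, by rwa [bot_sup_eq],
          trivial⟩⟩
        intro x h
        rcases List.mem_append.1 h with h | h
        · exact hx x h
        · rw [List.mem_singleton.1 h]; exact hz
    have hfin : ringKrullDim (A ⧸ (⊥ : Ideal A)) < ⊤ := by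
      have : Nontrivial (A ⧸ (⊥ : Ideal A)) := Ideal.Quotient.nontrivial_iff.2 bot_ne_top
      have : IsLocalRing (A ⧸ (⊥ : Ideal A)) :=
        IsLocalRing.of_surjective' _ Ideal.Quotient.mk_surjective
      exact ringKrullDim_lt_top
    have hle : ∀ n : ℕ, (n : WithBot ℕ∞) ≤ ringKrullDim (A ⧸ (⊥ : Ideal A)) := fun n => by
      obtain ⟨xs, rfl, hx, hxr⟩ := this n
      exact length_le_ringKrullDim bot_ne_top (fun x h => hL (hx x h)) hxr
    generalize ringKrullDim (A ⧸ (⊥ : Ideal A)) = d at hfin hle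
    induction d using WithBot.recBotCoe with
    | bot => simpa using hle 0
    | coe d =>
      have hd : d ≠ ⊤ := fun h => by simp [h] at hfin
      lift d to ℕ using hd
      have := hle (d + 1)
      norm_cast at this
      omega
  exact ⟨xs, hx, hxr, hs, (gradeOf_eq_length hL hx hxr hs).symm⟩

lemma one_le_gradeOf {L : Ideal A} (hL : L ≤ maximalIdeal A)
    (h : ∃ r ∈ L, r ∈ nonZeroDivisors A) : 1 ≤ gradeOf A L := by
  obtain ⟨xs, hx, hxr, hs, hl⟩ := exists_regSeq_length_eq_gradeOf hL
  obtain ⟨r, hr, hr'⟩ := h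
  by_contra! h0
  obtain rfl := List.length_eq_zero_iff.1 (by omega : xs.length = 0)
  refine RegMod.not_hasSocle hr ?_ hs
  intro b hb
  simpa using (mem_nonZeroDivisors_iff.1 hr').1 b (by simpa using hb)

lemma IsGorensteinLocalRing.exists_nice (h : IsGorensteinLocalRing A) :
    ∃ D, Nice (⊥ : Ideal A) D := by
  obtain ⟨-, rs, hrs, hrad, hirr⟩ := h
  rw [isRegular_iff_regSeq] at hrs
  obtain ⟨k, hk⟩ : ∃ k, maximalIdeal A ^ k ≤ Ideal.ofList rs :=
    Ideal.exists_pow_le_of_le_radical_of_fg hrad.ge (IsNoetherian.noetherian _)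
  refine ⟨rs.length, rs, rfl, forall_mem_maximalIdeal_of_ofList_ne_top hrs.2, hrs.1,
    ⟨k, by rwa [bot_sup_eq]⟩, ?_⟩
  rw [bot_sup_eq]
  set q := Ideal.ofList rs
  have hsoc : HasSocle (maximalIdeal A) q := by
    by_contra hcon
    obtain ⟨z, hz, hzq, -⟩ := exists_regMod_pair hcon hcon
    have : ∀ i, z ^ i ∈ q → (1 : A) ∈ q := by
      intro i
      induction i with
      | zero => simp
      | succ i ih => exact fun h => ih (hzq _ (by rwa [← pow_succ']))
    exact hrs.2 ((Ideal.eq_top_iff_one _).2 (this k (hk (Ideal.pow_mem_pow hz k))))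
  obtain ⟨σ, hσ, hσ'⟩ := hsoc
  refine ⟨σ, hσ, hσ', fun b hb => ?_⟩
  by_cases hbq : b ∈ q
  · exact ⟨0, by simpa⟩
  have hne : (q ⊔ Ideal.span {b}) ⊓ (q ⊔ Ideal.span {σ}) ≠ q := by
    intro heq
    rcases hirr.2 heq with h | h
    · exact hbq (h ▸ Ideal.mem_sup_right (Ideal.mem_span_singleton_self b))
    · exact hσ (h ▸ Ideal.mem_sup_right (Ideal.mem_span_singleton_self σ))
  obtain ⟨x, ⟨hx1, hx2⟩, hx⟩ : ∃ x ∈ (q ⊔ Ideal.span {b}) ⊓ (q ⊔ Ideal.span {σ}), x ∉ q := by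
    by_contra! hcon
    exact hne (le_antisymm hcon (le_inf le_sup_left le_sup_left))
  obtain ⟨u, hu⟩ := mem_sup_span_singleton.1 hx1
  obtain ⟨v, hv⟩ := mem_sup_span_singleton.1 hx2
  have hunit : IsUnit u := by
    by_contra hcon
    have := add_mem hu (hb u ((IsLocalRing.mem_maximalIdeal _).2 hcon))
    exact hx (by simpa using this)
  obtain ⟨w, hw⟩ := hunit.exists_left_inv
  refine ⟨w * v, ?_⟩
  have h1 := Ideal.mul_mem_left q w (sub_mem hv hu)
  have h2 : w * (x - v * σ - (x - u * b)) = (w * u) * b - w * v * σ := by ring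
  rwa [h2, hw, one_mul] at h1

lemma ringKrullDim_quotient_succ_le {p q : Ideal A} (hp : p.IsPrime) (hpq : p ≤ q) {y : A}
    (hy : y ∈ q) (hyp : y ∉ p) : ringKrullDim (A ⧸ q) + 1 ≤ ringKrullDim (A ⧸ p) := by
  refine ringKrullDim_succ_le_of_surjective (Ideal.Quotient.factor hpq)
    (Ideal.Quotient.factor_surjective hpq) (r := Ideal.Quotient.mk p y) ?_ ?_
  · rw [mem_nonZeroDivisors_iff_ne_zero, Ne, Ideal.Quotient.eq_zero_iff_mem]
    exact hyp
  · rw [Ideal.Quotient.factor_mk, Ideal.Quotient.eq_zero_iff_mem]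
    exact hy

lemma Dp.le_ringKrullDim {t : ℕ} : ∀ {c p : Ideal A}, Dp c t → p.IsPrime → c ≤ p → HasSocle p c →
    (t : WithBot ℕ∞) ≤ ringKrullDim (A ⧸ p) := by
  induction t with
  | zero =>
    intro c p _ hp _ _
    have : Nontrivial (A ⧸ p) := Ideal.Quotient.nontrivial_iff.2 hp.ne_top
    exact_mod_cast ringKrullDim_nonneg_of_nontrivial
  | succ t ih =>
    rintro c p ⟨ys, hl, hy, hr⟩ hp hcp hs
    obtain ⟨y, zs, rfl⟩ := List.exists_cons_of_length_eq_add_one hl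
    rw [regSeq_cons] at hr
    have hyp : y ∉ p := fun h => RegMod.not_hasSocle h hr.1 hs
    obtain ⟨d, hd, hdc⟩ : ∃ d ∈ c.colon (p : Set A), d ∉ c ⊔ Ideal.span {y} := by
      by_contra! hcon
      have : c.colon (p : Set A) ≤ c := by
        refine Submodule.le_of_le_smul_of_le_jacobson_bot (I := Ideal.span {y})
          (IsNoetherian.noetherian _) ?_ ?_
        · rw [IsLocalRing.jacobson_eq_maximalIdeal _ bot_ne_top]
          simpa [Ideal.span_le] using hy y (by simp)
        · intro d hd
          obtain ⟨a, ha⟩ := mem_sup_span_singleton.1 (hcon d hd)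
          refine Submodule.mem_sup.2 ⟨_, ha, y * a, Submodule.smul_mem_smul
            (Ideal.mem_span_singleton_self y) (hr.1.colon _ a ?_), by ring⟩
          have := sub_mem hd (Ideal.le_colon (S := (p : Set A)) ha)
          convert this using 1
          ring
      obtain ⟨b, hb, hpb⟩ := hs
      exact hb (this (mem_colon_iff.2 fun l hl => by rw [mul_comm]; exact hpb l hl))
    obtain ⟨q, hq, h1, h2, h3⟩ := HasSocle.exists_prime (I := p ⊔ Ideal.span {y}) hdc (by
      intro r hr'
      obtain ⟨a, ha⟩ := mem_sup_span_singleton.1 hr'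
      have h4 := mem_colon_iff.1 hd _ ha
      have : r * d = d * (r - a * y) + (a * d) * y := by ring
      rw [this]
      exact add_mem (Ideal.mem_sup_left h4)
        (Ideal.mem_sup_right (Ideal.mul_mem_left _ _ (Ideal.mem_span_singleton_self y))))
    have h4 := ih (c := c ⊔ Ideal.span {y}) ⟨zs, by simpa using hl,
      fun z hz => hy z (by simp [hz]), hr.2⟩ hq h2 h3
    have h5 := ringKrullDim_quotient_succ_le hp (le_sup_left.trans h1)
      (h1 (Ideal.mem_sup_right (Ideal.mem_span_singleton_self y))) hyp
    refine le_trans ?_ h5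
    push_cast
    gcongr

lemma IsCMIdeal.dp {I : Ideal A} (h : IsCMIdeal A I) {D : ℕ} (hD : Nice (⊥ : Ideal A) D) :
    gradeOf A I ≤ D ∧ Dp I (D - gradeOf A I) := by
  obtain ⟨hloc, hcm⟩ := h
  have hI : I ≠ ⊤ := Ideal.Quotient.nontrivial_iff.1 inferInstance
  have hIm := IsLocalRing.le_maximalIdeal hI
  obtain ⟨xs, hx, hxr, hs, hl⟩ := exists_regSeq_length_eq_gradeOf hIm
  have hxm := fun x h => hIm (hx x h)
  have hle : gradeOf A I ≤ D := by
    have := length_le_ringKrullDim bot_ne_top hxm hxr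
    rw [hD.ringKrullDim_eq, hl] at this
    exact_mod_cast this
  refine ⟨hle, ?_⟩
  obtain ⟨b, hb, hsb⟩ := hs
  obtain ⟨p, hp, hIp, hcp, hsp⟩ := HasSocle.exists_prime hb hsb
  have hdp : Dp (Ideal.ofList xs) (D - gradeOf A I) := by
    have := Nice.sup (t := D - gradeOf A I) (zs := xs) (c := ⊥)
      (by rwa [hl, Nat.sub_add_cancel hle]) hxm hxr
    rw [bot_sup_eq] at this
    exact this.dp
  have h1 := hdp.le_ringKrullDim hp hcp hsp
  have h2 : ringKrullDim (A ⧸ p) ≤ ringKrullDim (A ⧸ I) :=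
    ringKrullDim_le_of_surjective (Ideal.Quotient.factor hIp)
      (Ideal.Quotient.factor_surjective hIp)
  have h3 := h1.trans (h2.trans_eq hcm)
  obtain ⟨zs, hz, hzr, -, hzl⟩ := exists_regSeq_length_eq_gradeOf (A := A ⧸ I) le_rfl
  have h4 : Dp (⊥ : Ideal (A ⧸ I)) zs.length := ⟨zs, rfl, hz, hzr⟩
  have h5 := Dp.comap (π := Ideal.Quotient.mk I) Ideal.Quotient.mk_surjective h4
  rw [← RingHom.ker_eq_comap_bot, Ideal.mk_ker] at h5
  refine h5.mono ?_
  rw [hzl]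
  exact (Nat.cast_le (α := WithBot ℕ∞)).1 h3

lemma isDirectlyLinked_concat {xs : List A} {x y : A} (hxs : ∀ z ∈ xs, z ∈ maximalIdeal A)
    (hxm : x ∈ maximalIdeal A) (hym : y ∈ maximalIdeal A) (hr : RegSeq ⊥ xs)
    (hx : RegMod (Ideal.ofList xs) x) (hy : RegMod (Ideal.ofList xs) y) :
    IsDirectlyLinked A (Ideal.ofList (xs ++ [x])) (Ideal.ofList (xs ++ [y])) := by
  have hmem : ∀ w ∈ maximalIdeal A, ∀ z ∈ xs ++ [w], z ∈ maximalIdeal A := by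
    intro w hw z hz
    rcases List.mem_append.1 hz with h | h
    · exact hxs z h
    · rw [List.mem_singleton.1 h]; exact hw
  have hne : ∀ w ∈ maximalIdeal A, Ideal.ofList (xs ++ [w]) ≠ ⊤ := by
    intro w hw
    have := sup_ofList_ne_top (c := (⊥ : Ideal A)) bot_ne_top (hmem w hw)
    rwa [bot_sup_eq] at this
  have hcol : ∀ u v : A, RegMod (Ideal.ofList xs) v →
      (Ideal.ofList (xs ++ [u * v])).colon ((Ideal.ofList (xs ++ [v]) : Ideal A) : Set A) =
        Ideal.ofList (xs ++ [u]) := by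
    intro u v hv
    simp only [Ideal.ofList_append, ofList_singleton]
    refine le_antisymm ?_ ?_
    · intro r hr
      obtain ⟨a, ha⟩ := mem_sup_span_singleton.1
        (mem_colon_iff.1 hr v (Ideal.mem_sup_right (Ideal.mem_span_singleton_self v)))
      refine mem_sup_span_singleton.2 ⟨a, hv _ ?_⟩
      convert ha using 1
      ring
    · intro r hr
      rw [mem_colon_iff]
      intro l hl
      obtain ⟨a, ha⟩ := mem_sup_span_singleton.1 hr
      obtain ⟨b, hb⟩ := mem_sup_span_singleton.1 hl
      refine mem_sup_span_singleton.2 ⟨a * b, ?_⟩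
      have : r * l - a * b * (u * v) = (r - a * u) * l + a * u * (l - b * v) := by ring
      rw [this]
      exact add_mem (Ideal.mul_mem_right _ _ ha) (Ideal.mul_mem_left _ _ hb)
  refine ⟨hne x hxm, hne y hym, Ideal.ofList (xs ++ [x * y]), ⟨hne _ (Ideal.mul_mem_left _ _ hym),
    xs ++ [x * y], ?_, rfl⟩, ?_, hcol x y hy, ?_⟩
  · rw [isRegular_iff_of_mem_maximalIdeal (hmem _ (Ideal.mul_mem_left _ _ hym)), regSeq_append,
      bot_sup_eq]
    exact ⟨hr, hx.mul hy, trivial⟩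
  · simp only [Ideal.ofList_append, ofList_singleton]
    refine le_inf (sup_le_sup_left ?_ _) (sup_le_sup_left ?_ _)
    · rw [Ideal.span_singleton_le_span_singleton]; exact dvd_mul_right _ _
    · rw [Ideal.span_singleton_le_span_singleton]; exact dvd_mul_left _ _
  · rw [mul_comm]
    exact hcol y x hx

lemma exists_eq_concat_of_ne_nil {xs : List A} (h : xs ≠ []) : ∃ ys x, xs = ys ++ [x] :=
  ⟨xs.dropLast, xs.getLast h, (List.dropLast_append_getLast h).symm⟩

lemma isDirectlyLinked_self_ofList {xs : List A} (h : xs ≠ []) (hm : ∀ z ∈ xs, z ∈ maximalIdeal A)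
    (hr : RegSeq ⊥ xs) : IsDirectlyLinked A (Ideal.ofList xs) (Ideal.ofList xs) := by
  obtain ⟨ys, x, rfl⟩ := exists_eq_concat_of_ne_nil h
  rw [regSeq_append, bot_sup_eq, regSeq_cons] at hr
  exact isDirectlyLinked_concat (fun z hz => hm z (by simp [hz])) (hm x (by simp))
    (hm x (by simp)) hr.1 hr.2.1 hr.2.1

lemma exists_isDirectlyLinked_not_le {C : Ideal A} (hC : C < maximalIdeal A) {xs : List A}
    (h : xs ≠ []) (hm : ∀ z ∈ xs, z ∈ maximalIdeal A) (hr : RegSeq ⊥ xs) :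
    ∃ J, IsDirectlyLinked A (Ideal.ofList xs) J ∧ ¬ J ≤ C := by
  obtain ⟨ys, x, rfl⟩ := exists_eq_concat_of_ne_nil h
  rw [regSeq_append, bot_sup_eq, regSeq_cons] at hr
  obtain ⟨z, hz, hzC, hzr⟩ := exists_regMod_of_not_hasSocle {Ideal.ofList ys} (Set.finite_singleton _)
    (by simpa using RegMod.not_hasSocle (hm x (by simp)) hr.2.1) (not_le_of_gt hC)
  exact ⟨_, isDirectlyLinked_concat (fun z hz => hm z (by simp [hz])) (hm x (by simp)) hz hr.1
    hr.2.1 (hzr _ rfl), fun hle => hzC (hle (mem_ofList (by simp)))⟩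

end Grade

section Links

set_option linter.unusedSectionVars false

variable {A : Type} [CommRing A]

/-- `I` and `J` are directly linked via the regular sequence `xs`. -/
structure LinkVia (xs : List A) (I J : Ideal A) : Prop where
  ne_top_left : I ≠ ⊤
  ne_top_right : J ≠ ⊤
  mem_left : ∀ x ∈ xs, x ∈ I
  mem_right : ∀ x ∈ xs, x ∈ J
  regSeq : RegSeq ⊥ xs
  colon_right : (Ideal.ofList xs).colon (J : Set A) = I
  colon_left : (Ideal.ofList xs).colon (I : Set A) = J

lemma LinkVia.symm {xs : List A} {I J : Ideal A} (h : LinkVia xs I J) : LinkVia xs J I :=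
  ⟨h.2, h.1, h.4, h.3, h.5, h.7, h.6⟩

lemma isDirectlyLinked_iff {I J : Ideal A} :
    IsDirectlyLinked A I J ↔ ∃ xs, LinkVia xs I J := by
  constructor
  · rintro ⟨h1, h2, _, ⟨h3, xs, h4, rfl⟩, h5, h6, h7⟩
    exact ⟨xs, h1, h2, fun x hx => (h5 (mem_ofList hx)).1, fun x hx => (h5 (mem_ofList hx)).2,
      ((isRegular_iff_regSeq xs).1 h4).1, h6, h7⟩
  · rintro ⟨xs, h⟩
    have hne : Ideal.ofList xs ≠ ⊤ := fun h' =>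
      h.1 (top_le_iff.1 (h' ▸ ofList_le_of_forall_mem h.mem_left))
    exact ⟨h.1, h.2, _, ⟨hne, xs, (isRegular_iff_regSeq xs).2 ⟨h.regSeq, hne⟩, rfl⟩,
      le_inf (ofList_le_of_forall_mem h.mem_left) (ofList_le_of_forall_mem h.mem_right),
      h.colon_right, h.colon_left⟩

lemma IsDirectlyLinked.symm {I J : Ideal A} (h : IsDirectlyLinked A I J) :
    IsDirectlyLinked A J I := by
  rw [isDirectlyLinked_iff] at *
  obtain ⟨xs, h⟩ := h
  exact ⟨xs, h.symm⟩

lemma colon_eq_top_iff {c I : Ideal A} : c.colon (I : Set A) = ⊤ ↔ I ≤ c := by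
  rw [Ideal.eq_top_iff_one, mem_colon_iff]
  simp [SetLike.le_def]

lemma LinkVia.hasSocle {xs : List A} {I J : Ideal A} (h : LinkVia xs I J) :
    HasSocle I (Ideal.ofList xs) := by
  by_contra hcon
  have : J ≤ Ideal.ofList xs := by
    intro b hb
    by_contra hb'
    rw [← h.colon_left] at hb
    exact hcon ⟨b, hb', fun r hr => by rw [mul_comm]; exact mem_colon_iff.1 hb r hr⟩
  rw [← colon_eq_top_iff, h.colon_right] at this
  exact h.ne_top_left this

variable [IsLocalRing A] [IsNoetherianRing A]

/-- `A` is Gorenstein of dimension `D`, and `I` is a Cohen-Macaulay ideal of grade `g ≥ 1`. -/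
structure CMGrade (D g : ℕ) (I : Ideal A) : Prop where
  nice : Nice (⊥ : Ideal A) D
  le : g ≤ D
  pos : 1 ≤ g
  ne_top : I ≠ ⊤
  gradeOf_eq : gradeOf A I = g
  dp : Dp I (D - g)

lemma Nice.ofList {D g : ℕ} (h : Nice (⊥ : Ideal A) D) (hle : g ≤ D) {xs : List A}
    (hx : ∀ x ∈ xs, x ∈ maximalIdeal A) (hr : RegSeq ⊥ xs) (hl : xs.length = g) :
    Nice (Ideal.ofList xs) (D - g) := by
  have := Nice.sup (t := D - g) (zs := xs) (c := ⊥) (by rwa [hl, Nat.sub_add_cancel hle]) hx hr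
  rwa [bot_sup_eq] at this

lemma LinkVia.length_eq {xs : List A} {I J : Ideal A} (h : LinkVia xs I J) :
    gradeOf A I = xs.length :=
  gradeOf_eq_length (IsLocalRing.le_maximalIdeal h.1) h.3 h.5 h.hasSocle

lemma LinkVia.mem_maximalIdeal {xs : List A} {I J : Ideal A} (h : LinkVia xs I J) :
    ∀ x ∈ xs, x ∈ maximalIdeal A :=
  fun x hx => IsLocalRing.le_maximalIdeal h.1 (h.3 x hx)

lemma LinkVia.cmGrade {xs : List A} {I J : Ideal A} (h : LinkVia xs I J) {D g : ℕ}
    (hI : CMGrade D g I) : CMGrade D g J := by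
  have hl : xs.length = g := h.length_eq.symm.trans hI.gradeOf_eq
  refine ⟨hI.nice, hI.le, hI.pos, h.2, by rw [h.symm.length_eq, hl], ?_⟩
  have := (Nice.duality (ofList_le_of_forall_mem h.mem_left)
    (hI.nice.ofList hI.le h.mem_maximalIdeal h.regSeq hl) hI.dp).2.2
  rwa [h.colon_left] at this

lemma IsDirectlyLinked.cmGrade {I J : Ideal A} (h : IsDirectlyLinked A I J) {D g : ℕ}
    (hI : CMGrade D g I) : CMGrade D g J := by
  obtain ⟨xs, h⟩ := isDirectlyLinked_iff.1 h
  exact h.cmGrade hI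

lemma CMGrade.linkVia {D g : ℕ} {I : Ideal A} (h : CMGrade D g I) {xs : List A}
    (hx : ∀ x ∈ xs, x ∈ I) (hr : RegSeq ⊥ xs) (hl : xs.length = g)
    (hne : ¬ I ≤ Ideal.ofList xs) :
    LinkVia xs I ((Ideal.ofList xs).colon (I : Set A)) := by
  refine ⟨h.ne_top, fun h' => hne (colon_eq_top_iff.1 h'), hx,
    fun x hx => Ideal.le_colon (mem_ofList hx), hr, ?_, rfl⟩
  exact (Nice.duality (ofList_le_of_forall_mem hx) (h.nice.ofList h.le
    (fun x h' => IsLocalRing.le_maximalIdeal h.ne_top (hx x h')) hr hl) h.dp).2.1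

lemma CMGrade.exists_isDirectlyLinked {D g : ℕ} {I : Ideal A} (h : CMGrade D g I) :
    ∃ J, IsDirectlyLinked A I J := by
  have hI := IsLocalRing.le_maximalIdeal h.ne_top
  obtain ⟨xs, hx, hr, -, hl⟩ := exists_regSeq_length_eq_gradeOf hI
  rw [h.gradeOf_eq] at hl
  by_cases hne : I ≤ Ideal.ofList xs
  · have heq : I = Ideal.ofList xs := le_antisymm hne (ofList_le_of_forall_mem hx)
    refine ⟨I, ?_⟩
    conv => rw [heq]
    refine isDirectlyLinked_self_ofList ?_ (fun x h => hI (hx x h)) hr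
    rintro rfl
    have := h.pos
    simp at hl
    omega
  · exact ⟨_, isDirectlyLinked_iff.2 ⟨xs, h.linkVia hx hr hl hne⟩⟩

lemma CMGrade.not_le_ofList {D g : ℕ} {I : Ideal A} (h : CMGrade D g I) {C : Ideal A}
    (hC : C < maximalIdeal A) (hlink : ∀ J, IsDirectlyLinked A I J → J ≤ C) {xs : List A}
    (hx : ∀ x ∈ xs, x ∈ I) (hr : RegSeq ⊥ xs) (hl : xs.length = g) : ¬ I ≤ Ideal.ofList xs := by
  intro hne
  have heq : I = Ideal.ofList xs := le_antisymm hne (ofList_le_of_forall_mem hx)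
  obtain ⟨J, hJ, hJC⟩ := exists_isDirectlyLinked_not_le hC (xs := xs) (by
    rintro rfl
    have := h.pos
    simp at hl
    omega) (fun x h' => IsLocalRing.le_maximalIdeal h.ne_top (hx x h')) hr
  exact hJC (hlink J (by rwa [heq]))

end Links

section GenericPoints

open Polynomial

set_option linter.unusedSectionVars false

/-- An ultrafilter of `R`-points of `P` that behaves like a generic point with respect to
membership in extended ideals and to the formation of colon ideals. -/
structure IsGenericPoints {R P : Type} [CommRing R] [CommRing P] [Algebra R P]
    (G : Ultrafilter (P →ₐ[R] R)) : Prop where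
  noetherian : IsNoetherianRing P
  mem_map : ∀ (C : Ideal R) (F : P), (∀ᶠ ev : P →ₐ[R] R in G, ev F ∈ C) →
    F ∈ C.map (algebraMap R P)
  map_colon : ∀ c J : Ideal P, ∀ᶠ ev : P →ₐ[R] R in G,
    (c.colon (J : Set P)).map ev = (c.map ev).colon (J.map ev : Ideal R)

lemma isGenericPoints_pure (R : Type) [CommRing R] [IsNoetherianRing R] :
    IsGenericPoints (pure (AlgHom.id R R) : Ultrafilter (R →ₐ[R] R)) where
  noetherian := inferInstance
  mem_map C F h := by
    have h : (AlgHom.id R R) F ∈ C := h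
    simpa using h
  map_colon c J := by
    change (c.colon (J : Set R)).map (AlgHom.id R R) =
      (c.map (AlgHom.id R R)).colon (J.map (AlgHom.id R R) : Ideal R)
    have : ∀ I : Ideal R, I.map (AlgHom.id R R) = I := fun I => Ideal.map_id I
    rw [this, this, this]

lemma map_colon_of_ringEquiv {P P' : Type} [CommRing P] [CommRing P'] (e : P ≃+* P')
    (c J : Ideal P) : (c.colon (J : Set P)).map (e : P →+* P') =
      (c.map (e : P →+* P')).colon (J.map (e : P →+* P') : Ideal P') := by
  ext x
  obtain ⟨x, rfl⟩ := e.surjective x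
  have h : ∀ (I : Ideal P) (y : P), e y ∈ I.map (e : P →+* P') ↔ y ∈ I := by
    intro I y
    rw [Ideal.map_comap_of_equiv e, Ideal.mem_comap]
    simp
  rw [h, mem_colon_iff, mem_colon_iff]
  constructor
  · intro hx l hl
    obtain ⟨l, rfl⟩ := e.surjective l
    rw [h] at hl
    rw [← map_mul, h]
    exact hx l hl
  · intro hx l hl
    rw [← h, map_mul]
    exact hx _ ((h J l).2 hl)

lemma IsGenericPoints.of_algEquiv {R P P' : Type} [CommRing R] [CommRing P] [CommRing P']
    [Algebra R P] [Algebra R P'] {G : Ultrafilter (P →ₐ[R] R)} (h : IsGenericPoints G)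
    (e : P ≃ₐ[R] P') :
    IsGenericPoints (G.map fun ev : P →ₐ[R] R => ev.comp (e.symm : P' →ₐ[R] P)) where
  noetherian := by
    have := h.noetherian
    exact isNoetherianRing_of_ringEquiv P e.toRingEquiv
  mem_map C F hF := by
    have h1 := h.mem_map C (e.symm F) hF
    have h2 := Ideal.mem_map_of_mem (e : P →+* P') h1
    rw [Ideal.map_map] at h2
    have h3 : (e : P →+* P').comp (algebraMap R P) = algebraMap R P' := by
      ext r; exact e.commutes r
    rw [h3] at h2
    simpa using h2
  map_colon c J := by
    have key : ∀ (I : Ideal P') (ev : P →ₐ[R] R),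
        I.map (ev.comp (e.symm : P' →ₐ[R] P)) =
          (I.map (e.symm.toRingEquiv : P' →+* P)).map ev := by
      intro I ev
      exact (Ideal.map_map (e.symm.toRingEquiv : P' →+* P) (ev : P →+* R)).symm
    have h1 := h.map_colon (c.map (e.symm.toRingEquiv : P' →+* P))
      (J.map (e.symm.toRingEquiv : P' →+* P))
    change ∀ᶠ ev : P →ₐ[R] R in G, (c.colon (J : Set P')).map (ev.comp (e.symm : P' →ₐ[R] P)) =
      (c.map (ev.comp (e.symm : P' →ₐ[R] P))).colon
        (J.map (ev.comp (e.symm : P' →ₐ[R] P)) : Ideal R)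
    filter_upwards [h1] with ev hev
    rw [key, key, key, map_colon_of_ringEquiv, hev]

lemma eq_zero_of_forall_eval_eq_zero {B : Type} [CommRing B] (n : ℕ) :
    ∀ (f : B[X]) (s : Finset B), f.natDegree < n → n ≤ s.card →
      (∀ a ∈ s, ∀ b ∈ s, a ≠ b → IsUnit (a - b)) → (∀ a ∈ s, f.eval a = 0) → f = 0 := by
  classical
  induction n with
  | zero => intro f s h; omega
  | succ n ih =>
    intro f s hf hs hu hz
    nontriviality B
    obtain ⟨a, ha⟩ : s.Nonempty := Finset.card_pos.1 (by omega)
    obtain ⟨g, hg⟩ : X - C a ∣ f := dvd_iff_isRoot.2 (hz a ha)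
    by_cases hg0 : g = 0
    · rw [hg, hg0, mul_zero]
    have hdeg : f.natDegree = 1 + g.natDegree := by
      rw [hg, (monic_X_sub_C a).natDegree_mul' hg0, natDegree_X_sub_C]
    refine absurd (ih g (s.erase a) (by omega) ?_ ?_ ?_) hg0
    · rw [Finset.card_erase_of_mem ha]; omega
    · exact fun b hb c hc => hu b (Finset.mem_of_mem_erase hb) c (Finset.mem_of_mem_erase hc)
    · intro b hb
      have h1 := hz b (Finset.mem_of_mem_erase hb)
      rw [hg, eval_mul, eval_sub, eval_X, eval_C] at h1
      exact (hu b (Finset.mem_of_mem_erase hb) a ha (Finset.ne_of_mem_erase hb)).mul_right_eq_zero.1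
        h1

variable {R : Type} [CommRing R] [IsLocalRing R]

lemma isUnit_sub_of_residue_ne {a b : R} (h : residue R a ≠ residue R b) : IsUnit (a - b) := by
  by_contra hcon
  refine h (sub_eq_zero.1 ?_)
  rw [← map_sub, residue_eq_zero_iff]
  exact (mem_maximalIdeal _).2 hcon

lemma exists_ultrafilter_residue (hres : Infinite (ResidueField R)) :
    ∃ U : Ultrafilter R, (U : Filter R) ≤ Filter.comap (residue R) Filter.cofinite := by
  have h1 : (Filter.comap (residue R) Filter.cofinite).NeBot :=
    Filter.NeBot.comap_of_surj inferInstance residue_surjective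
  exact ⟨Ultrafilter.of _, Ultrafilter.of_le _⟩

lemma finite_residue_not_regular {A M : Type} [CommRing A] [Algebra R A] [IsNoetherianRing A]
    [AddCommGroup M] [Module A M] [Module.Finite A M] (t : A) :
    {k : ResidueField R | ∃ a : R, residue R a = k ∧
      ∃ x : M, x ≠ 0 ∧ (t - algebraMap R A a) • x = 0}.Finite := by
  classical
  refine Set.Finite.subset (s := ⋃ p ∈ associatedPrimes A M,
    {k : ResidueField R | p.IsPrime ∧ ∃ a : R, residue R a = k ∧ t - algebraMap R A a ∈ p}) ?_ ?_
  · refine Set.Finite.biUnion (associatedPrimes.finite A M) fun p _ => Set.Subsingleton.finite ?_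
    rintro k ⟨hp, a, rfl, ha⟩ k' ⟨-, b, rfl, hb⟩
    by_contra hne
    have h1 := (isUnit_sub_of_residue_ne hne).map (algebraMap R A)
    refine hp.ne_top (Ideal.eq_top_of_isUnit_mem _ ?_ h1)
    have := sub_mem hb ha
    rw [map_sub]
    convert this using 1
    ring
  · rintro k ⟨a, rfl, x, hx, hax⟩
    obtain ⟨p, hp, hle⟩ := exists_le_isAssociatedPrime_of_isNoetherianRing A x hx
    refine Set.mem_biUnion (x := p) hp ⟨hp.1, a, rfl, hle ?_⟩
    simpa using hax

lemma eventually_map_colon_eval {U : Ultrafilter R}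
    (hU : (U : Filter R) ≤ Filter.comap (residue R) Filter.cofinite) {P : Type} [CommRing P]
    [Algebra R P] [IsNoetherianRing P] (c J : Ideal P[X]) :
    ∀ᶠ a in (U : Filter R), (c.colon (J : Set P[X])).map (evalRingHom (algebraMap R P a)) =
      (c.map (evalRingHom (algebraMap R P a))).colon
        (J.map (evalRingHom (algebraMap R P a)) : Ideal P) := by
  obtain ⟨n, f, rfl⟩ := exists_fin_generators J
  let W : Submodule P[X] (Fin n → P[X]) :=
    { carrier := {b | ∃ s, ∀ j, b j - s * f j ∈ c}
      add_mem' := by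
        rintro b b' ⟨s, hs⟩ ⟨s', hs'⟩
        refine ⟨s + s', fun j => ?_⟩
        convert add_mem (hs j) (hs' j) using 1
        simp only [Pi.add_apply]
        ring
      zero_mem' := ⟨0, fun j => by simp⟩
      smul_mem' := by
        rintro r b ⟨s, hs⟩
        refine ⟨r * s, fun j => ?_⟩
        convert Ideal.mul_mem_left _ r (hs j) using 1
        simp only [Pi.smul_apply, smul_eq_mul]
        ring }
  have hfin := finite_residue_not_regular (R := R) (A := P[X]) (M := (Fin n → P[X]) ⧸ W) X
  filter_upwards [hU (Filter.preimage_mem_comap hfin.compl_mem_cofinite)] with a ha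
  set e := evalRingHom (algebraMap R P a) with he
  have hsurj : Function.Surjective e := fun r => ⟨C r, by simp [he]⟩
  have hker : ∀ {F : P[X]} {d : Ideal P[X]}, e F ∈ d.map e →
      ∃ G, F - (X - C (algebraMap R P a)) * G ∈ d := by
    intro F d hF
    obtain ⟨G, hG, hGF⟩ := (Ideal.mem_map_iff_of_surjective e hsurj).1 hF
    have : F - G ∈ RingHom.ker e := by
      rw [RingHom.mem_ker, map_sub, hGF, sub_self]
    rw [he, ker_evalRingHom, Ideal.mem_span_singleton] at this
    obtain ⟨H, hH⟩ := this
    exact ⟨H, by rw [← hH]; simpa using hG⟩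
  refine le_antisymm ?_ ?_
  · refine Ideal.map_le_iff_le_comap.2 fun r hr => ?_
    rw [Ideal.mem_comap, mem_colon_iff]
    intro l hl
    obtain ⟨l', hl', rfl⟩ := (Ideal.mem_map_iff_of_surjective e hsurj).1 hl
    rw [← map_mul]
    exact Ideal.mem_map_of_mem e (mem_colon_iff.1 hr l' hl')
  · intro r hr
    obtain ⟨r, rfl⟩ := hsurj r
    rw [mem_colon_iff] at hr
    have h1 : ∀ j, ∃ G, r * f j - (X - C (algebraMap R P a)) * G ∈ c := fun j =>
      hker (by
        rw [map_mul]
        exact hr _ (Ideal.mem_map_of_mem e (Ideal.subset_span ⟨j, rfl⟩)))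
    choose b hb using h1
    have hbW : b ∈ W := by
      by_contra hcon
      refine ha ⟨a, rfl, W.mkQ b, ?_, ?_⟩
      · rwa [Ne, Submodule.mkQ_apply, Submodule.Quotient.mk_eq_zero]
      · rw [← map_smul, Submodule.mkQ_apply, Submodule.Quotient.mk_eq_zero]
        refine ⟨r, fun j => ?_⟩
        rw [← neg_mem_iff, neg_sub]
        exact hb j
    obtain ⟨s, hs⟩ := hbW
    have h2 : r - (X - C (algebraMap R P a)) * s ∈
        c.colon (Ideal.span (Set.range f) : Ideal P[X]) := by
      refine mem_colon_span_range.2 fun j => ?_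
      have : (r - (X - C (algebraMap R P a)) * s) * f j =
        (r * f j - (X - C (algebraMap R P a)) * b j) +
          (X - C (algebraMap R P a)) * (b j - s * f j) := by ring
      rw [this]
      exact add_mem (hb j) (Ideal.mul_mem_left _ _ (hs j))
    have h3 := Ideal.mem_map_of_mem e h2
    have h4 : e (X - C (algebraMap R P a)) = 0 := by simp [he]
    rwa [map_sub, map_mul, h4, zero_mul, sub_zero] at h3

lemma mem_map_C_of_eventually {U : Ultrafilter R}
    (hU : (U : Filter R) ≤ Filter.comap (residue R) Filter.cofinite) {P : Type} [CommRing P]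
    [Algebra R P] (c : Ideal P) (F : P[X])
    (h : ∀ᶠ a in (U : Filter R), F.eval (algebraMap R P a) ∈ c) :
    F ∈ c.map (C : P →+* P[X]) := by
  classical
  have hinf : (residue R '' {a | F.eval (algebraMap R P a) ∈ c}).Infinite := by
    intro hfin
    have h1 := hU (Filter.preimage_mem_comap hfin.compl_mem_cofinite)
    obtain ⟨a, ha, ha'⟩ := U.nonempty_of_mem (Filter.inter_mem h h1)
    exact ha' ⟨a, ha, rfl⟩
  set q : R →+* P ⧸ c := (Ideal.Quotient.mk c).comp (algebraMap R P) with hq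
  have hzero : F.map (Ideal.Quotient.mk c) = 0 := by
    obtain ⟨T, hT, hcard⟩ := hinf.exists_subset_card_eq ((F.map (Ideal.Quotient.mk c)).natDegree + 1)
    choose! g hg hg' using fun k (hk : k ∈ T) => hT hk
    by_cases htriv : Subsingleton (P ⧸ c)
    · exact Subsingleton.elim _ _
    rw [not_subsingleton_iff_nontrivial] at htriv
    have hunit : ∀ k ∈ T, ∀ l ∈ T, k ≠ l → IsUnit (q (g k) - q (g l)) := by
      intro k hk l hl hkl
      rw [← map_sub]
      exact (isUnit_sub_of_residue_ne (by rwa [hg' k hk, hg' l hl])).map q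
    refine eq_zero_of_forall_eval_eq_zero _ _ (T.image fun k => q (g k)) (Nat.lt_succ_self _) ?_ ?_ ?_
    · rw [Finset.card_image_of_injOn, hcard]
      intro k hk l hl hkl
      by_contra hne
      have := hunit k hk l hl hne
      rw [sub_eq_zero.2 hkl] at this
      exact not_isUnit_zero this
    · simp only [Finset.mem_image]
      rintro _ ⟨k, hk, rfl⟩ _ ⟨l, hl, rfl⟩ hne
      exact hunit k hk l hl fun h => hne (by rw [h])
    · simp only [Finset.mem_image]
      rintro _ ⟨k, hk, rfl⟩
      rw [hq, RingHom.comp_apply, eval_map_apply, Ideal.Quotient.eq_zero_iff_mem]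
      exact hg k hk
  rw [Ideal.mem_map_C_iff]
  intro n
  have := congrArg (fun f => f.coeff n) hzero
  simpa [coeff_map, Ideal.Quotient.eq_zero_iff_mem] using this

lemma IsGenericPoints.polynomial (hres : Infinite (ResidueField R)) {P : Type} [CommRing P]
    [Algebra R P] {G : Ultrafilter (P →ₐ[R] R)} (h : IsGenericPoints G) :
    ∃ G' : Ultrafilter (P[X] →ₐ[R] R), IsGenericPoints G' := by
  have := h.noetherian
  obtain ⟨U, hU⟩ := exists_ultrafilter_residue hres
  let pt : R → P[X] →ₐ[R] P := fun a => (aeval (algebraMap R P a) : P[X] →ₐ[P] P).restrictScalars R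
  have hpt : ∀ a, (pt a : P[X] →+* P) = evalRingHom (algebraMap R P a) := by
    intro a; ext <;> simp [pt]
  have hmap : ∀ (I : Ideal P[X]) (a : R) (ev : P →ₐ[R] R),
      I.map (ev.comp (pt a)) = (I.map (evalRingHom (algebraMap R P a))).map ev := by
    intro I a ev
    rw [← hpt]
    exact (Ideal.map_map (pt a : P[X] →+* P) (ev : P →+* R)).symm
  refine ⟨U.bind fun a => G.map fun ev => ev.comp (pt a), inferInstance, ?_, ?_⟩
  · intro C' F hF
    have hF : ∀ᶠ a in (U : Filter R), ∀ᶠ ev : P →ₐ[R] R in G, (ev.comp (pt a)) F ∈ C' := hF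
    have h1 : ∀ᶠ a in (U : Filter R), F.eval (algebraMap R P a) ∈ C'.map (algebraMap R P) := by
      filter_upwards [hF] with a ha
      refine h.mem_map C' _ ?_
      filter_upwards [ha] with ev hev
      have : pt a F = F.eval (algebraMap R P a) := congrArg (fun f : P[X] →+* P => f F) (hpt a)
      rw [← this]
      exact hev
    have h2 := mem_map_C_of_eventually hU _ F h1
    rwa [Ideal.map_map] at h2
  · intro c J
    change ∀ᶠ a in (U : Filter R), ∀ᶠ ev : P →ₐ[R] R in G, _
    filter_upwards [eventually_map_colon_eval hU c J] with a ha
    change ∀ᶠ ev : P →ₐ[R] R in G, (c.colon (J : Set P[X])).map (ev.comp (pt a)) =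
      (c.map (ev.comp (pt a))).colon (J.map (ev.comp (pt a)) : Ideal R)
    filter_upwards [h.map_colon (c.map (evalRingHom (algebraMap R P a)))
      (J.map (evalRingHom (algebraMap R P a)))] with ev hev
    rw [hmap, hmap, hmap, ha, hev]

theorem exists_isGenericPoints [IsNoetherianRing R] (hres : Infinite (ResidueField R)) (σ : Type)
    [Finite σ] : ∃ G : Ultrafilter (MvPolynomial σ R →ₐ[R] R), IsGenericPoints G := by
  refine Finite.induction_empty_option (P := fun σ =>
    ∃ G : Ultrafilter (MvPolynomial σ R →ₐ[R] R), IsGenericPoints G) ?_ ?_ ?_ σ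
  · rintro α β e ⟨G, hG⟩
    exact ⟨_, hG.of_algEquiv (MvPolynomial.renameEquiv R e)⟩
  · exact ⟨_, (isGenericPoints_pure R).of_algEquiv (MvPolynomial.isEmptyAlgEquiv R PEmpty).symm⟩
  · rintro α _ ⟨G, hG⟩
    obtain ⟨G', hG'⟩ := hG.polynomial hres
    exact ⟨_, hG'.of_algEquiv (MvPolynomial.optionEquivLeft R α).symm⟩

end GenericPoints

section Specialization

set_option linter.unusedSectionVars false

variable {R P B : Type} [CommRing R] [CommRing P] [CommRing B] [Algebra R P] [Algebra P B]

/-- The specialization of an ideal of a localization of `P` at a point of `P`. -/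
def specialize (J : Ideal B) (ev : P →ₐ[R] R) : Ideal R := (J.comap (algebraMap P B)).map ev

lemma specialize_mono {J K : Ideal B} (h : J ≤ K) (ev : P →ₐ[R] R) :
    specialize J ev ≤ specialize K ev := Ideal.map_mono (Ideal.comap_mono h)

lemma map_map_algHom (C : Ideal R) (ev : P →ₐ[R] R) :
    (C.map (algebraMap R P)).map ev = C := by
  have h : (ev : P →+* R).comp (algebraMap R P) = RingHom.id R := by
    ext r; exact ev.commutes r
  have := Ideal.map_map (I := C) (algebraMap R P) (ev : P →+* R)
  rw [h, Ideal.map_id] at this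
  exact this

lemma colon_comap_of_isLocalization (M : Submonoid P) [IsLocalization M B] (c J : Ideal B) :
    (c.colon (J : Set B)).comap (algebraMap P B) =
      (c.comap (algebraMap P B)).colon (J.comap (algebraMap P B) : Ideal P) := by
  ext x
  rw [Ideal.mem_comap, mem_colon_iff, mem_colon_iff]
  constructor
  · intro h l hl
    rw [Ideal.mem_comap, map_mul]
    exact h _ hl
  · intro h l hl
    obtain ⟨⟨y, s⟩, hy⟩ := IsLocalization.surj M l
    have h1 : y ∈ J.comap (algebraMap P B) := by
      rw [Ideal.mem_comap, ← hy]
      exact Ideal.mul_mem_right _ _ hl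
    have h2 := h y h1
    rw [Ideal.mem_comap, map_mul, ← hy, ← mul_assoc] at h2
    exact (Ideal.mul_unit_mem_iff_mem c (IsLocalization.map_units B s)).1 h2

lemma exists_numerators (M : Submonoid P) [IsLocalization M B] (xs : List B) :
    ∃ Fs : List P, Ideal.ofList (Fs.map (algebraMap P B)) = Ideal.ofList xs ∧
      ∀ c, RegSeq c xs → RegSeq c (Fs.map (algebraMap P B)) := by
  induction xs with
  | nil => exact ⟨[], rfl, fun c _ => trivial⟩
  | cons x xs ih =>
    obtain ⟨Fs, h1, h2⟩ := ih
    obtain ⟨⟨F, s⟩, hF⟩ := IsLocalization.surj M x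
    have hu := IsLocalization.map_units B s
    have hspan : Ideal.span {algebraMap P B F} = Ideal.span {x} := by
      rw [← hF]
      exact Ideal.span_singleton_mul_right_unit hu x
    refine ⟨F :: Fs, ?_, ?_⟩
    · rw [List.map_cons, Ideal.ofList_cons, Ideal.ofList_cons, h1, hspan]
    · rintro c ⟨h3, h4⟩
      rw [List.map_cons]
      refine ⟨?_, ?_⟩
      · rw [regMod_iff_colon_le, hspan, ← regMod_iff_colon_le]
        exact h3
      · rw [hspan]
        exact h2 _ h4

variable [IsLocalRing R]

lemma specialize_ne_top {M : Submonoid P} [IsLocalization M B]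
    (hM : ∀ u, u ∈ M ↔ u ∉ (maximalIdeal R).map (algebraMap R P)) {J : Ideal B} (hJ : J ≠ ⊤)
    (ev : P →ₐ[R] R) : specialize J ev ≠ ⊤ := by
  have h1 : J.comap (algebraMap P B) ≤ (maximalIdeal R).map (algebraMap R P) := by
    intro u hu
    by_contra hcon
    exact hJ (Ideal.eq_top_of_isUnit_mem _ hu (IsLocalization.map_units B ⟨u, (hM u).2 hcon⟩))
  have h2 := Ideal.map_mono (f := ev) h1
  rw [map_map_algHom] at h2
  exact fun h => (maximalIdeal.isMaximal R).ne_top (top_le_iff.1 (h ▸ h2))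

variable {G : Ultrafilter (P →ₐ[R] R)}

lemma IsGenericPoints.eventually_isUnit (hG : IsGenericPoints G)
    {u : P}
    (hu : u ∉ (maximalIdeal R).map (algebraMap R P)) : ∀ᶠ ev : P →ₐ[R] R in G, IsUnit (ev u) := by
  by_contra hcon
  rw [← Ultrafilter.eventually_not] at hcon
  refine hu (hG.mem_map _ _ ?_)
  filter_upwards [hcon] with ev hev
  exact (mem_maximalIdeal _).2 hev

variable {M : Submonoid P} [IsLocalization M B]

lemma IsGenericPoints.comap_map (hG : IsGenericPoints G)
    (hM : ∀ u, u ∈ M ↔ u ∉ (maximalIdeal R).map (algebraMap R P))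
    (C : Ideal R) :
    ((C.map (algebraMap R P)).map (algebraMap P B)).comap (algebraMap P B) =
      C.map (algebraMap R P) := by
  refine le_antisymm (fun F hF => ?_) Ideal.le_comap_map
  obtain ⟨u, hu, hF⟩ := (IsLocalization.algebraMap_mem_map_algebraMap_iff M B _ _).1 hF
  refine hG.mem_map _ _ ?_
  filter_upwards [hG.eventually_isUnit ((hM u).1 hu)] with ev hev
  have h1 := Ideal.mem_map_of_mem ev hF
  rw [map_map_algHom, map_mul] at h1
  exact (Ideal.unit_mul_mem_iff_mem C hev).1 h1

lemma IsGenericPoints.specialize_map (hG : IsGenericPoints G)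
    (hM : ∀ u, u ∈ M ↔ u ∉ (maximalIdeal R).map (algebraMap R P))
    (c : Ideal P) :
    ∀ᶠ ev : P →ₐ[R] R in G, specialize (c.map (algebraMap P B)) ev = c.map ev := by
  have := hG.noetherian
  obtain ⟨n, f, hf⟩ := exists_fin_generators ((c.map (algebraMap P B)).comap (algebraMap P B))
  have h1 : ∀ i, ∃ u ∈ M, u * f i ∈ c := fun i =>
    (IsLocalization.algebraMap_mem_map_algebraMap_iff M B _ _).1
      (show f i ∈ (c.map (algebraMap P B)).comap (algebraMap P B) from
        hf ▸ Ideal.subset_span ⟨i, rfl⟩)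
  choose u hu hfu using h1
  have h2 : ∀ᶠ ev : P →ₐ[R] R in G, ∀ i, IsUnit (ev (u i)) :=
    Filter.eventually_all.2 fun i => hG.eventually_isUnit ((hM _).1 (hu i))
  filter_upwards [h2] with ev hev
  refine le_antisymm ?_ (Ideal.map_mono Ideal.le_comap_map)
  rw [specialize, ← hf, Ideal.map_span, Ideal.span_le]
  rintro _ ⟨_, ⟨i, rfl⟩, rfl⟩
  have h3 := Ideal.mem_map_of_mem ev (hfu i)
  rw [map_mul] at h3
  exact (Ideal.unit_mul_mem_iff_mem _ (hev i)).1 h3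

lemma IsGenericPoints.specialize_map_map (hG : IsGenericPoints G)
    (hM : ∀ u, u ∈ M ↔ u ∉ (maximalIdeal R).map (algebraMap R P))
    (C : Ideal R) :
    ∀ᶠ ev : P →ₐ[R] R in G,
      specialize ((C.map (algebraMap R P)).map (algebraMap P B)) ev = C := by
  filter_upwards [hG.specialize_map (B := B) hM (C.map (algebraMap R P))] with ev hev
  rw [hev, map_map_algHom]

lemma IsGenericPoints.specialize_colon (hG : IsGenericPoints G)
    (M : Submonoid P) [IsLocalization M B] (c J : Ideal B) :
    ∀ᶠ ev : P →ₐ[R] R in G, specialize (c.colon (J : Set B)) ev =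
      (specialize c ev).colon (specialize J ev : Ideal R) := by
  filter_upwards [hG.map_colon (c.comap (algebraMap P B)) (J.comap (algebraMap P B))] with ev hev
  rw [specialize, colon_comap_of_isLocalization M, hev]
  rfl

lemma IsGenericPoints.specialize_sup (hG : IsGenericPoints G)
    (hM : ∀ u, u ∈ M ↔ u ∉ (maximalIdeal R).map (algebraMap R P))
    (c : Ideal B) (d : Ideal P) :
    ∀ᶠ ev : P →ₐ[R] R in G,
      specialize (c ⊔ d.map (algebraMap P B)) ev = specialize c ev ⊔ d.map ev := by
  filter_upwards [hG.specialize_map (B := B) hM (c.comap (algebraMap P B) ⊔ d)] with ev hev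
  rw [Ideal.map_sup, Ideal.map_sup, IsLocalization.map_under M] at hev
  exact hev

lemma IsGenericPoints.specialize_regSeq (hG : IsGenericPoints G)
    (hM : ∀ u, u ∈ M ↔ u ∉ (maximalIdeal R).map (algebraMap R P))
    (Fs : List P) :
    ∀ c : Ideal B, RegSeq c (Fs.map (algebraMap P B)) →
      ∀ᶠ ev : P →ₐ[R] R in G, RegSeq (specialize c ev) (Fs.map ev) := by
  induction Fs with
  | nil => intro c _; exact Filter.Eventually.of_forall fun _ => trivial
  | cons F Fs ih =>
    rintro c ⟨h1, h2⟩
    rw [regMod_iff_colon_le] at h1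
    have hspan : Ideal.span {algebraMap P B F} = (Ideal.span {F}).map (algebraMap P B) := by
      rw [Ideal.map_span, Set.image_singleton]
    have hspan' : ∀ ev : P →ₐ[R] R, (Ideal.span {F}).map ev = Ideal.span {ev F} := by
      intro ev
      rw [Ideal.map_span, Set.image_singleton]
    filter_upwards [ih _ h2, hG.specialize_colon M c (Ideal.span {algebraMap P B F}),
      hG.specialize_sup hM c (Ideal.span {F}), hG.specialize_map (B := B) hM (Ideal.span {F})]
      with ev e1 e2 e3 e4
    rw [hspan, e3, hspan'] at e1
    refine ⟨?_, e1⟩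
    rw [regMod_iff_colon_le, ← hspan', ← e4, ← hspan, ← e2]
    exact specialize_mono h1 ev

lemma IsGenericPoints.specialize_isDirectlyLinked (hG : IsGenericPoints G)
    (hM : ∀ u, u ∈ M ↔ u ∉ (maximalIdeal R).map (algebraMap R P))
    {J K : Ideal B} (h : IsDirectlyLinked B J K) :
    ∀ᶠ ev : P →ₐ[R] R in G, IsDirectlyLinked R (specialize J ev) (specialize K ev) := by
  obtain ⟨xs, h⟩ := isDirectlyLinked_iff.1 h
  obtain ⟨Fs, h1, h2⟩ := exists_numerators M xs
  filter_upwards [hG.specialize_regSeq hM Fs _ (h2 _ h.regSeq),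
    hG.specialize_map (B := B) hM (Ideal.ofList Fs), hG.specialize_map (B := B) hM ⊥,
    hG.specialize_colon M (Ideal.ofList xs) J, hG.specialize_colon M (Ideal.ofList xs) K]
    with ev e1 e2 e3 e4 e5
  rw [Ideal.map_bot, Ideal.map_bot] at e3
  have hmap : (Ideal.ofList Fs).map ev = Ideal.ofList (Fs.map ev) :=
    map_ofList (ev : P →+* R) Fs
  rw [map_ofList, h1, hmap] at e2
  rw [e3] at e1
  rw [h.colon_left, e2] at e4
  rw [h.colon_right, e2] at e5
  have hmem : ∀ L : Ideal B, (∀ x ∈ xs, x ∈ L) → ∀ y ∈ Fs.map ev, y ∈ specialize L ev := by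
    intro L hL y hy
    obtain ⟨F, hF, rfl⟩ := List.mem_map.1 hy
    refine Ideal.mem_map_of_mem ev (Ideal.mem_comap.2 (ofList_le_of_forall_mem hL ?_))
    rw [← h1]
    exact mem_ofList (List.mem_map_of_mem hF)
  exact isDirectlyLinked_iff.2 ⟨Fs.map ev, specialize_ne_top hM h.ne_top_left ev,
    specialize_ne_top hM h.ne_top_right ev, hmem _ h.mem_left, hmem _ h.mem_right, e1,
    e5.symm, e4.symm⟩

lemma IsGenericPoints.specialize_inSameLinkageClass (hG : IsGenericPoints G)
    (hM : ∀ u, u ∈ M ↔ u ∉ (maximalIdeal R).map (algebraMap R P))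
    {J K : Ideal B}
    (h : InSameLinkageClass B J K) :
    ∀ᶠ ev : P →ₐ[R] R in G, InSameLinkageClass R (specialize J ev) (specialize K ev) := by
  induction h with
  | rel x y h =>
    filter_upwards [hG.specialize_isDirectlyLinked hM h] with ev hev
    exact .rel _ _ hev
  | refl x => exact Filter.Eventually.of_forall fun _ => .refl _
  | symm x y _ ih =>
    filter_upwards [ih] with ev hev
    exact .symm _ _ hev
  | trans x y z _ _ h1 h2 =>
    filter_upwards [h1, h2] with ev e1 e2
    exact .trans _ _ _ e1 e2

theorem IsGenericPoints.le_map_of_inSameLinkageClass (hG : IsGenericPoints G)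
    (hM : ∀ u, u ∈ M ↔ u ∉ (maximalIdeal R).map (algebraMap R P))
    {I C : Ideal R}
    (h : ∀ J, InSameLinkageClass R I J → J ≤ C) {K : Ideal B}
    (hK : InSameLinkageClass B ((I.map (algebraMap R P)).map (algebraMap P B)) K) :
    K ≤ (C.map (algebraMap R P)).map (algebraMap P B) := by
  have h1 := hG.specialize_inSameLinkageClass hM hK
  have h2 := hG.specialize_map_map (B := B) hM I
  rw [← IsLocalization.map_under M B K]
  refine Ideal.map_mono fun F hF => hG.mem_map _ _ ?_
  filter_upwards [h1, h2] with ev e1 e2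
  rw [e2] at e1
  exact h _ e1 (Ideal.mem_map_of_mem ev hF)

end Specialization

section FlatLocal

set_option linter.unusedSectionVars false

variable {A B : Type} [CommRing A] [CommRing B] [IsLocalRing A] [IsLocalRing B]
  [IsNoetherianRing A] [IsNoetherianRing B] [Algebra A B] [Module.Flat A B]
  [IsLocalHom (algebraMap A B)]

variable (B) in
lemma map_comap_of_flat_local (c : Ideal A) :
    (c.map (algebraMap A B)).comap (algebraMap A B) = c := by
  have : Module.FaithfullyFlat A B := Module.FaithfullyFlat.of_flat_of_isLocalHom
  exact Ideal.comap_map_eq_self_of_faithfullyFlat c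

lemma algebraMap_mem_map_iff {c : Ideal A} {x : A} :
    algebraMap A B x ∈ c.map (algebraMap A B) ↔ x ∈ c := by
  rw [← Ideal.mem_comap, map_comap_of_flat_local B]

lemma map_le_map_iff_of_flat_local {c d : Ideal A} :
    c.map (algebraMap A B) ≤ d.map (algebraMap A B) ↔ c ≤ d := by
  rw [Ideal.map_le_iff_le_comap, map_comap_of_flat_local]

lemma map_ne_top_of_flat_local {c : Ideal A} (h : c ≠ ⊤) : c.map (algebraMap A B) ≠ ⊤ := by
  intro h'
  rw [Ideal.eq_top_iff_one, ← map_one (algebraMap A B), algebraMap_mem_map_iff] at h'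
  exact h ((Ideal.eq_top_iff_one _).2 h')

lemma algebraMap_mem_maximalIdeal {x : A} (h : x ∈ maximalIdeal A) :
    algebraMap A B x ∈ maximalIdeal B :=
  (mem_maximalIdeal _).2 fun hu => (mem_maximalIdeal _).1 h ((isUnit_map_iff (algebraMap A B) x).1 hu)

lemma map_list_mem_maximalIdeal {xs : List A} (h : ∀ x ∈ xs, x ∈ maximalIdeal A) :
    ∀ y ∈ xs.map (algebraMap A B), y ∈ maximalIdeal B := by
  intro y hy
  obtain ⟨x, hx, rfl⟩ := List.mem_map.1 hy
  exact algebraMap_mem_maximalIdeal (h x hx)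

lemma map_list_mem_map {φ : A →+* B} {xs : List A} {I : Ideal A} (h : ∀ x ∈ xs, x ∈ I) :
    ∀ y ∈ xs.map φ, y ∈ I.map φ := by
  intro y hy
  obtain ⟨x, hx, rfl⟩ := List.mem_map.1 hy
  exact Ideal.mem_map_of_mem _ (h x hx)

lemma Dp.map {c : Ideal A} {t : ℕ} (h : Dp c t) : Dp (c.map (algebraMap A B)) t := by
  obtain ⟨ys, rfl, h2, h3⟩ := h
  exact ⟨ys.map (algebraMap A B), by simp, map_list_mem_maximalIdeal h2, h3.map_of_flat⟩

lemma HasSocle.map {I c : Ideal A} (h : HasSocle I c) :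
    HasSocle (I.map (algebraMap A B)) (c.map (algebraMap A B)) := by
  obtain ⟨b, hb, hI⟩ := h
  refine ⟨algebraMap A B b, fun h => hb (algebraMap_mem_map_iff.1 h), fun r hr => ?_⟩
  have h1 : b ∈ c.colon (I : Set A) := mem_colon_iff.2 fun r hr => by
    rw [mul_comm]; exact hI r hr
  have h2 := Ideal.mem_map_of_mem (algebraMap A B) h1
  rw [map_colon_of_flat] at h2
  rw [mul_comm]
  exact mem_colon_iff.1 h2 r hr

lemma Nice.map (hm : (maximalIdeal A).map (algebraMap A B) = maximalIdeal B) {c : Ideal A} {t : ℕ}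
    (h : Nice c t) : Nice (c.map (algebraMap A B)) t := by
  obtain ⟨ys, rfl, h2, h3, ⟨k, hk⟩, σ, hσ, h5, h6⟩ := h
  have hmap : c.map (algebraMap A B) ⊔ Ideal.ofList (ys.map (algebraMap A B)) =
      (c ⊔ Ideal.ofList ys).map (algebraMap A B) := by
    rw [Ideal.map_sup, map_ofList]
  refine ⟨ys.map (algebraMap A B), by simp, map_list_mem_maximalIdeal h2, h3.map_of_flat,
    ⟨k, ?_⟩, algebraMap A B σ, ?_, ?_, ?_⟩
  · rw [hmap, ← hm, ← Ideal.map_pow]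
    exact Ideal.map_mono hk
  · rwa [hmap, algebraMap_mem_map_iff]
  · intro r hr
    have h1 : σ ∈ (c ⊔ Ideal.ofList ys).colon (maximalIdeal A : Set A) :=
      mem_colon_iff.2 fun r hr => by rw [mul_comm]; exact h5 r hr
    have h1 := Ideal.mem_map_of_mem (algebraMap A B) h1
    rw [map_colon_of_flat, hm, mem_colon_iff] at h1
    rw [hmap, mul_comm]
    exact h1 r hr
  · intro b hb
    have h1 : (c ⊔ Ideal.ofList ys).colon (maximalIdeal A : Set A) ≤
        (c ⊔ Ideal.ofList ys) ⊔ Ideal.span {σ} := by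
      intro x hx
      refine mem_sup_span_singleton.2 (h6 x fun r hr => ?_)
      rw [mul_comm]
      exact mem_colon_iff.1 hx r hr
    have h1 := Ideal.map_mono (f := algebraMap A B) h1
    rw [map_colon_of_flat, hm, Ideal.map_sup (J := Ideal.span {σ}), Ideal.map_span,
      Set.image_singleton] at h1
    rw [hmap]
    refine mem_sup_span_singleton.1 (h1 (mem_colon_iff.2 fun r hr => ?_))
    rw [mul_comm, ← hmap]
    exact hb r hr

lemma LinkVia.map {xs : List A} {I J : Ideal A} (h : LinkVia xs I J) :
    LinkVia (xs.map (algebraMap A B)) (I.map (algebraMap A B)) (J.map (algebraMap A B)) := by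
  refine ⟨map_ne_top_of_flat_local h.1, map_ne_top_of_flat_local h.2, map_list_mem_map h.3,
    map_list_mem_map h.4, ?_, ?_, ?_⟩
  · have := h.5.map_of_flat (B := B)
    rwa [Ideal.map_bot] at this
  · rw [← map_ofList, ← map_colon_of_flat, h.6]
  · rw [← map_ofList, ← map_colon_of_flat, h.7]

lemma IsDirectlyLinked.map {I J : Ideal A} (h : IsDirectlyLinked A I J) :
    IsDirectlyLinked B (I.map (algebraMap A B)) (J.map (algebraMap A B)) := by
  obtain ⟨xs, h⟩ := isDirectlyLinked_iff.1 h
  exact isDirectlyLinked_iff.2 ⟨_, h.map⟩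

lemma InSameLinkageClass.map {I J : Ideal A} (h : InSameLinkageClass A I J) :
    InSameLinkageClass B (I.map (algebraMap A B)) (J.map (algebraMap A B)) := by
  induction h with
  | rel x y h => exact .rel _ _ h.map
  | refl x => exact .refl _
  | symm x y _ ih => exact .symm _ _ ih
  | trans x y z _ _ h1 h2 => exact .trans _ _ _ h1 h2

lemma CMGrade.map (hm : (maximalIdeal A).map (algebraMap A B) = maximalIdeal B) {D g : ℕ}
    {I : Ideal A} (h : CMGrade D g I) : CMGrade D g (I.map (algebraMap A B)) := by
  refine ⟨?_, h.le, h.pos, map_ne_top_of_flat_local h.ne_top, ?_, h.dp.map⟩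
  · have := h.nice.map hm
    rwa [Ideal.map_bot] at this
  · obtain ⟨xs, hx, hr, hs, hl⟩ :=
      exists_regSeq_length_eq_gradeOf (IsLocalRing.le_maximalIdeal h.ne_top)
    have h1 := hr.map_of_flat (B := B)
    have h2 := hs.map (B := B)
    rw [Ideal.map_bot] at h1
    rw [map_ofList] at h2
    rw [gradeOf_eq_length (IsLocalRing.le_maximalIdeal (map_ne_top_of_flat_local h.ne_top))
      (map_list_mem_map hx) h1 h2, List.length_map, hl, h.gradeOf_eq]

end FlatLocal

section RegularPoints

open Polynomial

set_option linter.unusedSectionVars false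

variable {R : Type} [CommRing R]

variable (R) in
/-- Every `R`-point of `P` is cut out by a sequence which is regular modulo every extended ideal. -/
def HasRegularPoints (P : Type) [CommRing P] [Algebra R P] : Prop :=
  ∀ ev : P →ₐ[R] R, ∃ zs : List P, Ideal.ofList zs = RingHom.ker ev ∧
    ∀ c : Ideal R, RegSeq (c.map (algebraMap R P)) zs

lemma HasRegularPoints.of_algEquiv {P P' : Type} [CommRing P] [CommRing P'] [Algebra R P]
    [Algebra R P'] (h : HasRegularPoints R P) (e : P ≃ₐ[R] P') : HasRegularPoints R P' := by
  intro ev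
  obtain ⟨zs, h1, h2⟩ := h (ev.comp (e : P →ₐ[R] P'))
  let φ : P →+* P' := e.toRingEquiv
  let π : P' →+* P := e.symm.toRingEquiv
  have hπ : Function.Surjective π := e.symm.surjective
  have hφπ : ∀ x, φ (π x) = x := e.apply_symm_apply
  have hπφ : ∀ x, π (φ x) = x := e.symm_apply_apply
  have hcomap : ∀ I : Ideal P, I.comap π = I.map φ := by
    intro I
    refine le_antisymm (fun x hx => ?_) (Ideal.map_le_iff_le_comap.2 fun x hx => ?_)
    · rw [← hφπ x]
      exact Ideal.mem_map_of_mem _ hx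
    · rw [Ideal.mem_comap, Ideal.mem_comap, hπφ]
      exact hx
  have hmm : (zs.map φ).map π = zs := by
    rw [List.map_map]
    conv_rhs => rw [← List.map_id zs]
    exact List.map_congr_left fun x _ => hπφ x
  refine ⟨zs.map φ, ?_, fun c => ?_⟩
  · rw [← map_ofList, h1, ← hcomap]
    ext x
    rw [Ideal.mem_comap, RingHom.mem_ker, RingHom.mem_ker]
    change ev (φ (π x)) = 0 ↔ _
    rw [hφπ]
  · have h3 : c.map (algebraMap R P') = (c.map (algebraMap R P)).comap π := by
      rw [hcomap, Ideal.map_map]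
      congr 1
      ext r
      exact (e.commutes r).symm
    rw [h3, regSeq_comap_iff hπ, hmm]
    exact h2 c

lemma HasRegularPoints.self : HasRegularPoints R R := by
  intro ev
  refine ⟨[], ?_, fun _ => trivial⟩
  rw [Ideal.ofList_nil, eq_comm, RingHom.ker_eq_bot_iff_eq_zero]
  intro x hx
  rw [← hx]
  exact (ev.commutes x).symm

lemma regMod_map_C_X_sub_C {P : Type} [CommRing P] (c : Ideal P) (a : P) :
    RegMod (c.map (C : P →+* P[X])) (X - C a) := by
  have key : ∀ F : P[X], F ∈ c.map (C : P →+* P[X]) ↔ F.map (Ideal.Quotient.mk c) = 0 := by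
    intro F
    rw [Ideal.mem_map_C_iff, Polynomial.ext_iff]
    simp [Ideal.Quotient.eq_zero_iff_mem]
  intro F hF
  rw [key, Polynomial.map_mul, (monic_X_sub_C a |>.map _).mul_right_eq_zero_iff] at hF
  exact (key F).2 hF

lemma HasRegularPoints.polynomial {P : Type} [CommRing P] [Algebra R P]
    (h : HasRegularPoints R P) : HasRegularPoints R P[X] := by
  intro ev
  let ev' : P →ₐ[R] R := ev.comp ((CAlgHom : P →ₐ[P] P[X]).restrictScalars R)
  obtain ⟨zs, h1, h2⟩ := h ev'
  set a : P := algebraMap R P (ev X) with ha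
  set e : P[X] →+* P := evalRingHom a with he
  have hsurj : Function.Surjective e := fun r => ⟨C r, by simp [he]⟩
  have hker : (⊥ : Ideal P).comap e = Ideal.span {X - C a} := ker_evalRingHom a
  have hC : (zs.map (C : P →+* P[X])).map e = zs := by
    rw [List.map_map]
    conv_rhs => rw [← List.map_id zs]
    exact List.map_congr_left fun x _ => by simp [he]
  have hev : ∀ F, ev F = ev' (e F) := by
    intro F
    have : (ev : P[X] →+* R) = (ev' : P →+* R).comp e := by
      refine Polynomial.ringHom_ext (fun r => ?_) ?_
      · simp [he, ev']
      · simp only [he, RingHom.comp_apply, coe_evalRingHom, eval_X, ha, RingHom.coe_coe]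
        rw [AlgHom.commutes]
        rfl
    exact congrArg (fun f : P[X] →+* R => f F) this
  refine ⟨(X - C a) :: zs.map (C : P →+* P[X]), ?_, fun c => ⟨?_, ?_⟩⟩
  · have := comap_sup_ofList hsurj ⊥ (zs.map (C : P →+* P[X]))
    rw [hC, h1, bot_sup_eq, hker] at this
    rw [Ideal.ofList_cons, ← this]
    ext F
    rw [Ideal.mem_comap, RingHom.mem_ker, RingHom.mem_ker, hev]
  · rw [show algebraMap R P[X] = (C : P →+* P[X]).comp (algebraMap R P) from rfl, ← Ideal.map_map]
    exact regMod_map_C_X_sub_C _ _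
  · have := comap_sup_map hsurj ⊥ (c.map (algebraMap R P[X]))
    rw [hker, bot_sup_eq, Ideal.map_map] at this
    have h4 : e.comp (algebraMap R P[X]) = algebraMap R P := by
      ext r; simp [he]
    rw [sup_comm, ← this, h4, regSeq_comap_iff hsurj, hC]
    exact h2 c

theorem hasRegularPoints_mvPolynomial (σ : Type) [Finite σ] :
    HasRegularPoints R (MvPolynomial σ R) := by
  refine Finite.induction_empty_option (P := fun σ => HasRegularPoints R (MvPolynomial σ R))
    ?_ ?_ ?_ σ
  · intro α β e h
    exact h.of_algEquiv (MvPolynomial.renameEquiv R e)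
  · exact HasRegularPoints.self.of_algEquiv (MvPolynomial.isEmptyAlgEquiv R PEmpty).symm
  · intro α _ h
    exact h.polynomial.of_algEquiv (MvPolynomial.optionEquivLeft R α).symm

end RegularPoints

section GaussExtension

set_option linter.unusedSectionVars false

lemma isPrime_map_C (R σ : Type) [CommRing R] (p : Ideal R) [hp : p.IsPrime] :
    (p.map (MvPolynomial.C : R →+* MvPolynomial σ R)).IsPrime := by
  rw [← Ideal.Quotient.isDomain_iff_prime]
  exact (MvPolynomial.quotientEquivQuotientMvPolynomial (σ := σ) p).symm.toMulEquiv.isDomain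

/-- `B` is a flat Noetherian local extension of `R` with the same maximal ideal. -/
structure IsUnramifiedFlat (R B : Type) [CommRing R] [CommRing B] [IsLocalRing R] [IsLocalRing B]
    [Algebra R B] : Prop where
  noetherian : IsNoetherianRing B
  flat : Module.Flat R B
  isLocalHom : IsLocalHom (algebraMap R B)
  map_maximalIdeal : (maximalIdeal R).map (algebraMap R B) = maximalIdeal B

lemma infinite_residueField {R B : Type} [CommRing R] [CommRing B] [IsLocalRing R] [IsLocalRing B]
    (φ : R →+* B) [IsLocalHom φ] (h : Infinite (ResidueField R)) : Infinite (ResidueField B) :=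
  Infinite.of_injective _ (ResidueField.map φ).injective

variable {R σ B : Type} [CommRing R] [IsLocalRing R] [IsNoetherianRing R] [Finite σ] [CommRing B]
  [IsLocalRing B] [Algebra (MvPolynomial σ R) B] [Algebra R B]
  [IsScalarTower R (MvPolynomial σ R) B]

theorem IsLocalization.AtPrime.isUnramifiedFlat {q : Ideal (MvPolynomial σ R)} [q.IsPrime]
    [IsLocalization.AtPrime B q]
    (hq : q = (maximalIdeal R).map (MvPolynomial.C : R →+* MvPolynomial σ R)) :
    IsUnramifiedFlat R B := by
  have hmap : (maximalIdeal R).map (algebraMap R B) = maximalIdeal B := by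
    rw [← IsLocalization.AtPrime.map_eq_maximalIdeal q B, hq, Ideal.map_map]
    rw [IsScalarTower.algebraMap_eq R (MvPolynomial σ R) B]
    rfl
  refine ⟨IsLocalization.isNoetherianRing q.primeCompl B inferInstance, ?_, ?_, hmap⟩
  · have : Module.Flat (MvPolynomial σ R) B := IsLocalization.flat B q.primeCompl
    exact Module.Flat.trans R (MvPolynomial σ R) B
  · exact ((IsLocalRing.local_hom_TFAE (algebraMap R B)).out 0 2).2 hmap.le

end GaussExtension

section PointRing

set_option linter.unusedSectionVars false

variable {R P : Type} [CommRing R] [IsLocalRing R] [CommRing P] [Algebra R P]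

instance isPrime_comap_maximalIdeal (ev : P →ₐ[R] R) : ((maximalIdeal R).comap ev).IsPrime :=
  Ideal.IsPrime.comap ev

/-- The localization of `P` at the maximal ideal of a point `ev`. -/
abbrev PointRing (ev : P →ₐ[R] R) : Type := Localization.AtPrime ((maximalIdeal R).comap ev)

/-- Evaluation at the point `ev`. -/
noncomputable def pointProj (ev : P →ₐ[R] R) : PointRing ev →+* R :=
  IsLocalization.lift (M := ((maximalIdeal R).comap ev).primeCompl) (g := (ev : P →+* R))
    fun u => by
      by_contra h
      exact u.2 ((mem_maximalIdeal _).2 h)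

variable (ev : P →ₐ[R] R)

@[simp] lemma pointProj_algebraMap (F : P) :
    pointProj ev (algebraMap P (PointRing ev) F) = ev F :=
  IsLocalization.lift_eq _ F

@[simp] lemma pointProj_algebraMap' (r : R) :
    pointProj ev (algebraMap R (PointRing ev) r) = r := by
  rw [IsScalarTower.algebraMap_apply R P (PointRing ev), pointProj_algebraMap, AlgHom.commutes]
  rfl

lemma pointProj_comp_algebraMap :
    (pointProj ev).comp (algebraMap R (PointRing ev)) = RingHom.id R := by
  ext r
  exact pointProj_algebraMap' ev r

instance isNoetherianRing_pointRing [IsNoetherianRing P] : IsNoetherianRing (PointRing ev) :=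
  IsLocalization.isNoetherianRing ((maximalIdeal R).comap ev).primeCompl _ inferInstance

lemma map_ker_eq_comap_pointProj :
    (RingHom.ker ev).map (algebraMap P (PointRing ev)) = (⊥ : Ideal R).comap (pointProj ev) := by
  refine le_antisymm (Ideal.map_le_iff_le_comap.2 fun F hF => ?_) fun x hx => ?_
  · rw [Ideal.mem_comap, Ideal.mem_comap, pointProj_algebraMap]
    exact hF
  · obtain ⟨⟨F, s⟩, hF⟩ := IsLocalization.surj ((maximalIdeal R).comap ev).primeCompl x
    have h1 := congrArg (pointProj ev) hF
    rw [map_mul, show pointProj ev x = 0 from hx, zero_mul, pointProj_algebraMap] at h1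
    refine (Ideal.mul_unit_mem_iff_mem _ (IsLocalization.map_units (PointRing ev) s)).1 ?_
    rw [hF]
    exact Ideal.mem_map_of_mem _ h1.symm

lemma HasRegularPoints.exists_regSeq_pointRing [IsNoetherianRing P] (h : HasRegularPoints R P) :
    ∃ zs : List (PointRing ev), Ideal.ofList zs = (⊥ : Ideal R).comap (pointProj ev) ∧
      ∀ c : Ideal R, RegSeq (c.map (algebraMap R (PointRing ev))) zs := by
  obtain ⟨zs, h1, h2⟩ := h ev
  refine ⟨zs.map (algebraMap P (PointRing ev)), ?_, fun c => ?_⟩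
  · rw [← map_ofList, h1, map_ker_eq_comap_pointProj]
  · have : Module.Flat P (PointRing ev) :=
      IsLocalization.flat _ ((maximalIdeal R).comap ev).primeCompl
    rw [IsScalarTower.algebraMap_eq R P (PointRing ev), ← Ideal.map_map]
    exact (h2 c).map_of_flat

variable {B : Type} [CommRing B] [Algebra P B]

lemma flat_of_pointRing [Algebra (PointRing ev) B] [IsScalarTower P (PointRing ev) B]
    (M : Submonoid P) [IsLocalization M B] : Module.Flat (PointRing ev) B := by
  rw [Module.flat_iff_of_isLocalization (PointRing ev) ((maximalIdeal R).comap ev).primeCompl]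
  exact IsLocalization.flat B M

lemma map_le_maximalIdeal_comap :
    (maximalIdeal R).map (algebraMap R P) ≤ (maximalIdeal R).comap ev := by
  refine Ideal.map_le_iff_le_comap.2 fun r hr => ?_
  rw [Ideal.mem_comap, Ideal.mem_comap, AlgHom.commutes]
  exact hr

lemma IsGenericPoints.comap_map_pointRing {G : Ultrafilter (P →ₐ[R] R)} (hG : IsGenericPoints G)
    {M : Submonoid P} [IsLocalization M B]
    (hM : ∀ u, u ∈ M ↔ u ∉ (maximalIdeal R).map (algebraMap R P))
    [Algebra (PointRing ev) B] [IsScalarTower P (PointRing ev) B] (C : Ideal R) :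
    ((C.map (algebraMap R P)).map (algebraMap P B)).comap (algebraMap (PointRing ev) B) ≤
      C.map (algebraMap R (PointRing ev)) := by
  intro x hx
  obtain ⟨⟨F, s⟩, hF⟩ := IsLocalization.surj ((maximalIdeal R).comap ev).primeCompl x
  refine (Ideal.mul_unit_mem_iff_mem _ (IsLocalization.map_units (PointRing ev) s)).1 ?_
  have h1 : F ∈ ((C.map (algebraMap R P)).map (algebraMap P B)).comap (algebraMap P B) := by
    rw [Ideal.mem_comap, IsScalarTower.algebraMap_apply P (PointRing ev) B, ← hF, map_mul]
    exact Ideal.mul_mem_right _ _ hx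
  rw [hG.comap_map hM] at h1
  rw [hF, IsScalarTower.algebraMap_eq R P (PointRing ev), ← Ideal.map_map]
  exact Ideal.mem_map_of_mem _ h1

end PointRing

section Deformation

set_option linter.unusedSectionVars false

variable {S R : Type} [CommRing S] [CommRing R]

/-- `K` is a deformation of `I` along `π : S → R`, the kernel of `π` being generated by `zs`. -/
structure IsDeformation (π : S →+* R) (zs : List S) (K : Ideal S) (I : Ideal R) : Prop where
  sup_eq : K ⊔ Ideal.ofList zs = I.comap π
  regSeq : RegSeq K zs

lemma colon_comap_of_surjective {π : S →+* R} (hπ : Function.Surjective π) (c I : Ideal R) :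
    (c.comap π).colon (I.comap π : Set S) = (c.colon (I : Set R)).comap π := by
  ext x
  rw [Ideal.mem_comap, mem_colon_iff]
  constructor
  · intro h
    rw [mem_colon_iff]
    intro l hl
    obtain ⟨l, rfl⟩ := hπ l
    rw [← map_mul]
    exact h l hl
  · intro h l hl
    rw [mem_colon_iff] at h
    rw [Ideal.mem_comap, map_mul]
    exact h _ hl

variable {π : S →+* R} {zs : List S}

lemma IsDeformation.map_eq (hπ : Function.Surjective π)
    (hz : Ideal.ofList zs = (⊥ : Ideal R).comap π) {K : Ideal S} {I : Ideal R}
    (h : IsDeformation π zs K I) : K.map π = I := by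
  have h1 := congrArg (Ideal.map π) h.sup_eq
  rw [Ideal.map_sup (J := Ideal.ofList zs), hz, Ideal.map_comap_of_surjective π hπ,
    Ideal.map_comap_of_surjective π hπ, sup_bot_eq] at h1
  exact h1

lemma IsDeformation.exists_lift (hπ : Function.Surjective π)
    (hz : Ideal.ofList zs = (⊥ : Ideal R).comap π) {K : Ideal S} {I : Ideal R}
    (h : IsDeformation π zs K I) {ws : List R} (hw : ∀ w ∈ ws, w ∈ I) :
    ∃ us : List S, us.map π = ws ∧ ∀ u ∈ us, u ∈ K := by
  rw [← h.map_eq hπ hz] at hw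
  clear h
  induction ws with
  | nil => exact ⟨[], rfl, by simp⟩
  | cons w ws ih =>
    obtain ⟨us, rfl, h2⟩ := ih fun w h => hw w (List.mem_cons_of_mem _ h)
    obtain ⟨u, hu, rfl⟩ := (Ideal.mem_map_iff_of_surjective π hπ).1 (hw w List.mem_cons_self)
    exact ⟨u :: us, rfl, by simpa using ⟨hu, h2⟩⟩

variable [IsLocalRing R] [IsNoetherianRing R] [IsLocalRing S] [IsNoetherianRing S]

lemma mem_maximalIdeal_of_ofList_eq (hπ : Function.Surjective π)
    (hz : Ideal.ofList zs = (⊥ : Ideal R).comap π) : ∀ z ∈ zs, z ∈ maximalIdeal S := by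
  intro z h
  rw [← comap_maximalIdeal_of_surjective hπ]
  exact Ideal.comap_mono (f := π) bot_le (hz ▸ mem_ofList h)

lemma regSeq_append_of_map (hπ : Function.Surjective π)
    (hz : Ideal.ofList zs = (⊥ : Ideal R).comap π) (hzr : RegSeq ⊥ zs) {us : List S}
    (hu : ∀ u ∈ us, u ∈ maximalIdeal S) (hr : RegSeq ⊥ (us.map π)) : RegSeq ⊥ (us ++ zs) := by
  have h1 : RegSeq ⊥ (zs ++ us) := by
    rw [regSeq_append, bot_sup_eq, hz, regSeq_comap_iff hπ]
    exact ⟨hzr, hr⟩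
  refine regSeq_perm List.perm_append_comm ?_ h1
  intro x hx
  rcases List.mem_append.1 hx with hx | hx
  · exact mem_maximalIdeal_of_ofList_eq hπ hz x hx
  · exact hu x hx

theorem IsDeformation.colon (hπ : Function.Surjective π)
    (hz : Ideal.ofList zs = (⊥ : Ideal R).comap π) (hzr : RegSeq ⊥ zs) {K : Ideal S}
    {I I' : Ideal R} (h : IsDeformation π zs K I) {us : List S} (huK : ∀ u ∈ us, u ∈ K)
    (hl : LinkVia (us.map π) I I') {D g : ℕ} (hI : CMGrade D g I) :
    IsDeformation π zs ((Ideal.ofList us).colon (K : Set S)) I' ∧ RegSeq ⊥ us := by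
  have hzm := mem_maximalIdeal_of_ofList_eq hπ hz
  have hKm : K ≤ maximalIdeal S := by
    rw [← comap_maximalIdeal_of_surjective hπ]
    exact (le_sup_left.trans h.sup_eq.le).trans
      (Ideal.comap_mono (IsLocalRing.le_maximalIdeal hI.ne_top))
  have h1 := regSeq_append_of_map hπ hz hzr (fun u hu => hKm (huK u hu)) hl.regSeq
  rw [regSeq_append, bot_sup_eq] at h1
  have h2 : Ideal.ofList us ⊔ Ideal.ofList zs = (Ideal.ofList (us.map π)).comap π := by
    have := comap_sup_ofList hπ (⊥ : Ideal R) us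
    rw [bot_sup_eq, ← hz, sup_comm] at this
    exact this.symm
  have hn : Nice (Ideal.ofList us) (D - g + zs.length) := by
    refine Nice.of_sup ?_ hzm h1.2
    rw [h2]
    refine Nice.comap hπ (hI.nice.ofList hI.le hl.mem_maximalIdeal hl.regSeq ?_)
    exact hl.length_eq.symm.trans hI.gradeOf_eq
  have hd : Dp K (D - g + zs.length) := by
    refine Dp.of_sup ?_ hzm h.regSeq
    rw [h.sup_eq]
    exact Dp.comap hπ hI.dp
  obtain ⟨h3, h4⟩ := Nice.colon_sup_ofList (ofList_le_of_forall_mem huK) hn hd hzm h1.2 h.regSeq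
  refine ⟨⟨?_, h4⟩, h1.1⟩
  rw [← h3, h2, h.sup_eq, colon_comap_of_surjective hπ, hl.colon_left]

lemma isDeformation_map [Algebra R S] (hπ : Function.Surjective π)
    (hid : π.comp (algebraMap R S) = RingHom.id R)
    (hz : Ideal.ofList zs = (⊥ : Ideal R).comap π)
    (hzr : ∀ c : Ideal R, RegSeq (c.map (algebraMap R S)) zs) (I : Ideal R) :
    IsDeformation π zs (I.map (algebraMap R S)) I := by
  refine ⟨?_, hzr I⟩
  have := comap_sup_map hπ ⊥ (I.map (algebraMap R S))
  rw [Ideal.map_map, hid, Ideal.map_id, bot_sup_eq, ← hz] at this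
  rw [this, sup_comm]

end Deformation

section PointExtension

set_option linter.unusedSectionVars false

/-- `S` sits between `R` and `B`, is flat below `B`, and has an `R`-point `π` whose kernel is
generated by a sequence regular modulo every ideal extended from `R`. -/
structure IsPointExtension {R S B : Type} [CommRing R] [CommRing S] [CommRing B] [Algebra R S]
    [Algebra S B] [Algebra R B] (π : S →+* R) (zs : List S) : Prop where
  tower : IsScalarTower R S B
  flat : Module.Flat S B
  comp_algebraMap : π.comp (algebraMap R S) = RingHom.id R
  ofList_eq : Ideal.ofList zs = (⊥ : Ideal R).comap π
  regSeq : ∀ c : Ideal R, RegSeq (c.map (algebraMap R S)) zs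
  comap_map_le : ∀ c : Ideal R,
    (c.map (algebraMap R B)).comap (algebraMap S B) ≤ c.map (algebraMap R S)

section

variable {R S B : Type} [CommRing R] [CommRing S] [CommRing B] [Algebra R S]
    [Algebra S B] [Algebra R B] {π : S →+* R} {zs : List S}

lemma IsPointExtension.surjective (h : IsPointExtension (B := B) π zs) : Function.Surjective π :=
  fun r => ⟨_, congrArg (· r) h.comp_algebraMap⟩

lemma IsPointExtension.regSeq_bot (h : IsPointExtension (B := B) π zs) : RegSeq ⊥ zs := by
  simpa using h.regSeq ⊥

end

/-- The generic combinations of `f`. -/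
noncomputable def genericCombinations {R : Type} [CommRing R] {n : ℕ} (g : ℕ) (f : Fin n → R) :
    List (MvPolynomial (Fin n × Fin g) R) :=
  List.ofFn fun i : Fin g => ∑ j : Fin n, MvPolynomial.X (j, i) * MvPolynomial.C (f j)

lemma ofList_ofFn {A : Type} [CommRing A] {g : ℕ} (v : Fin g → A) :
    Ideal.ofList (List.ofFn v) = Ideal.span (Set.range v) := by
  unfold Ideal.ofList
  congr 1
  ext x
  simp [List.mem_ofFn]

variable {R : Type} [CommRing R] {n g : ℕ} {f : Fin n → R}

lemma genericLinkIdeal_eq (L : Ideal R) : genericLinkIdeal g f L =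
    (Ideal.ofList (genericCombinations g f)).colon
      (L.map (algebraMap R (MvPolynomial (Fin n × Fin g) R)) : Set _) := by
  rw [genericCombinations, ofList_ofFn]
  rfl

lemma mem_map_of_mem_genericCombinations {x : MvPolynomial (Fin n × Fin g) R}
    (hx : x ∈ genericCombinations g f) :
    x ∈ (Ideal.span (Set.range f)).map (algebraMap R (MvPolynomial (Fin n × Fin g) R)) := by
  obtain ⟨i, rfl⟩ := List.mem_ofFn.1 hx
  exact Ideal.sum_mem _ fun j _ => Ideal.mul_mem_left _ _
    (Ideal.mem_map_of_mem (algebraMap R (MvPolynomial (Fin n × Fin g) R))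
      (Ideal.subset_span (Set.mem_range_self j)))

lemma exists_map_genericCombinations_eq {xs : List R} (hl : xs.length = g)
    (hx : ∀ x ∈ xs, x ∈ Ideal.span (Set.range f)) :
    ∃ ev : MvPolynomial (Fin n × Fin g) R →ₐ[R] R, (genericCombinations g f).map ev = xs := by
  subst hl
  have h (i : Fin xs.length) : ∃ a : Fin n → R, ∑ j, a j * f j = xs.get i :=
    mem_span_range_iff.1 (hx _ (List.get_mem xs i))
  choose a ha using h
  refine ⟨MvPolynomial.aeval fun p => a p.2 p.1, ?_⟩
  rw [genericCombinations, List.map_ofFn]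
  conv_rhs => rw [← List.ofFn_get xs]
  congr 1
  funext i
  simp only [Function.comp, map_sum, map_mul, MvPolynomial.aeval_X, ← MvPolynomial.algebraMap_eq,
    AlgHom.commutes]
  exact ha i

variable [IsLocalRing R] [IsNoetherianRing R] {B : Type} [CommRing B]
  [Algebra (MvPolynomial (Fin n × Fin g) R) B] [Algebra R B]
  [IsScalarTower R (MvPolynomial (Fin n × Fin g) R) B]
  {q : Ideal (MvPolynomial (Fin n × Fin g) R)} [q.IsPrime] [IsLocalization.AtPrime B q]

variable (B) in
lemma map_genericLinkIdeal [Module.Flat (MvPolynomial (Fin n × Fin g) R) B] (L : Ideal R) :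
    (genericLinkIdeal g f L).map (algebraMap (MvPolynomial (Fin n × Fin g) R) B) =
      (Ideal.ofList ((genericCombinations g f).map (algebraMap _ B))).colon
        (L.map (algebraMap R B) : Set B) := by
  rw [genericLinkIdeal_eq, map_colon_of_flat, map_ofList, Ideal.map_map,
    ← IsScalarTower.algebraMap_eq]

theorem exists_isPointExtension (hres : Infinite (ResidueField R))
    (hq : q = (maximalIdeal R).map
      (MvPolynomial.C : R →+* MvPolynomial (Fin n × Fin g) R)) {xs : List R} (hl : xs.length = g)
    (hx : ∀ x ∈ xs, x ∈ Ideal.span (Set.range f)) :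
    ∃ (S : Type) (_ : CommRing S) (_ : IsLocalRing S) (_ : IsNoetherianRing S) (_ : Algebra R S)
      (_ : Algebra S B) (π : S →+* R) (zs us : List S),
      IsPointExtension (B := B) π zs ∧ us.map π = xs ∧
      (∀ u ∈ us, u ∈ (Ideal.span (Set.range f)).map (algebraMap R S)) ∧
      us.map (algebraMap S B) = (genericCombinations g f).map (algebraMap _ B) := by
  obtain ⟨ev, hev⟩ := exists_map_genericCombinations_eq hl hx
  obtain ⟨G, hG⟩ := exists_isGenericPoints hres (Fin n × Fin g)
  have hM : ∀ u, u ∈ q.primeCompl ↔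
      u ∉ (maximalIdeal R).map (algebraMap R (MvPolynomial (Fin n × Fin g) R)) := by
    intro u
    rw [MvPolynomial.algebraMap_eq, ← hq]
    rfl
  have hle : ((maximalIdeal R).comap ev).primeCompl ≤ q.primeCompl := by
    intro u hu
    rw [hM]
    exact fun h => hu (map_le_maximalIdeal_comap ev h)
  let _ : Algebra (PointRing ev) B := IsLocalization.localizationAlgebraOfSubmonoidLe _ _ _ _ hle
  have : IsScalarTower (MvPolynomial (Fin n × Fin g) R) (PointRing ev) B :=
    IsLocalization.localization_isScalarTower_of_submonoid_le _ _ _ _ hle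
  obtain ⟨zs, h1, h2⟩ :=
    (hasRegularPoints_mvPolynomial (R := R) (Fin n × Fin g)).exists_regSeq_pointRing ev
  refine ⟨PointRing ev, inferInstance, inferInstance, inferInstance, inferInstance, inferInstance,
    pointProj ev, zs, (genericCombinations g f).map (algebraMap _ _),
    ⟨?_, flat_of_pointRing ev q.primeCompl, pointProj_comp_algebraMap ev, h1, h2, fun c => ?_⟩,
    ?_, ?_, ?_⟩
  · refine IsScalarTower.of_algebraMap_eq fun r => ?_
    rw [IsScalarTower.algebraMap_apply R (MvPolynomial (Fin n × Fin g) R) B,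
      IsScalarTower.algebraMap_apply R (MvPolynomial (Fin n × Fin g) R) (PointRing ev),
      ← IsScalarTower.algebraMap_apply (MvPolynomial (Fin n × Fin g) R) (PointRing ev) B]
  · have := hG.comap_map_pointRing ev hM (B := B) c
    rwa [Ideal.map_map, ← IsScalarTower.algebraMap_eq] at this
  · rw [← hev, List.map_map]
    exact List.map_congr_left fun F _ => pointProj_algebraMap ev F
  · intro u hu
    obtain ⟨F, hF, rfl⟩ := List.mem_map.1 hu
    have := Ideal.mem_map_of_mem (algebraMap _ (PointRing ev)) (mem_map_of_mem_genericCombinations hF)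
    rwa [Ideal.map_map, ← IsScalarTower.algebraMap_eq] at this
  · rw [List.map_map]
    exact List.map_congr_left fun F _ => (IsScalarTower.algebraMap_apply _ _ _ F).symm

end PointExtension

section FirstUniversalLink

set_option linter.unusedSectionVars false

/-- The properties of a first universal link `L ⊆ B` of `I ⊆ R`, given by the sequence `as`. -/
structure IsFirstUniversalLink {R B : Type} [CommRing R] [CommRing B] [IsLocalRing R]
    [IsLocalRing B] [Algebra R B] (I : Ideal R) (as : List B) (L : Ideal B) : Prop where
  unramified : IsUnramifiedFlat R B
  eq_colon : L = (Ideal.ofList as).colon (I.map (algebraMap R B) : Set B)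
  exists_isPointExtension : ∀ xs : List R, xs.length = gradeOf R I → (∀ x ∈ xs, x ∈ I) →
    ∃ (S : Type) (_ : CommRing S) (_ : IsLocalRing S) (_ : IsNoetherianRing S) (_ : Algebra R S)
      (_ : Algebra S B) (π : S →+* R) (zs us : List S),
      IsPointExtension (B := B) π zs ∧ us.map π = xs ∧ (∀ u ∈ us, u ∈ I.map (algebraMap R S)) ∧
      us.map (algebraMap S B) = as
  le_map_of_inSameLinkageClass : ∀ C : Ideal R, (∀ J, InSameLinkageClass R I J → J ≤ C) →
    ∀ K, InSameLinkageClass B (I.map (algebraMap R B)) K → K ≤ C.map (algebraMap R B)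

theorem isFirstUniversalLink {R : Type} [CommRing R] [IsLocalRing R] [IsNoetherianRing R]
    (hres : Infinite (ResidueField R)) {I : Ideal R} {n : ℕ} {f : Fin n → R}
    (hf : Ideal.span (Set.range f) = I)
    (q : Ideal (MvPolynomial (Fin n × Fin (gradeOf R I)) R)) [q.IsPrime]
    (hq : (maximalIdeal R).map
      (MvPolynomial.C : R →+* MvPolynomial (Fin n × Fin (gradeOf R I)) R) = q) :
    IsFirstUniversalLink I ((genericCombinations (gradeOf R I) f).map (algebraMap _ _))
      ((genericLinkIdeal (gradeOf R I) f I).map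
        (algebraMap (MvPolynomial (Fin n × Fin (gradeOf R I)) R) (Localization.AtPrime q))) := by
  have : Module.Flat (MvPolynomial (Fin n × Fin (gradeOf R I)) R) (Localization.AtPrime q) :=
    IsLocalization.flat _ q.primeCompl
  refine ⟨IsLocalization.AtPrime.isUnramifiedFlat hq.symm, map_genericLinkIdeal _ I,
    fun xs hl hx => ?_, fun C hC K hK => ?_⟩
  · generalize gradeOf R I = g at *
    subst hf
    exact exists_isPointExtension (f := f) hres hq.symm hl hx
  · obtain ⟨G, hG⟩ := exists_isGenericPoints hres (Fin n × Fin (gradeOf R I))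
    have hM : ∀ u, u ∈ q.primeCompl ↔ u ∉ (maximalIdeal R).map
        (algebraMap R (MvPolynomial (Fin n × Fin (gradeOf R I)) R)) := by
      intro u
      rw [MvPolynomial.algebraMap_eq, hq]
      rfl
    have := hG.le_map_of_inSameLinkageClass (B := Localization.AtPrime q) hM hC (K := K)
    rw [Ideal.map_map, Ideal.map_map, ← IsScalarTower.algebraMap_eq] at this
    exact this hK

variable {R B : Type} [CommRing R] [CommRing B] [IsLocalRing R] [IsLocalRing B]
  [IsNoetherianRing R] [Algebra R B]

lemma IsUnramifiedFlat.cmGrade (h : IsUnramifiedFlat R B) {I : Ideal R} {D g : ℕ}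
    (hI : CMGrade D g I) :
    have := h.noetherian
    CMGrade D g (I.map (algebraMap R B)) := by
  have := h.noetherian
  have := h.flat
  have := h.isLocalHom
  exact hI.map h.map_maximalIdeal

lemma IsUnramifiedFlat.map_lt (h : IsUnramifiedFlat R B) {C : Ideal R} (hC : C < maximalIdeal R) :
    C.map (algebraMap R B) < maximalIdeal B := by
  have := h.noetherian
  have := h.flat
  have := h.isLocalHom
  rw [← h.map_maximalIdeal]
  exact lt_of_le_not_ge (Ideal.map_mono hC.le) fun hle =>
    hC.not_ge (map_le_map_iff_of_flat_local.1 hle)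

variable {I : Ideal R} {as : List B} {L : Ideal B}

lemma IsFirstUniversalLink.regSeq (h : IsFirstUniversalLink I as L) {D g : ℕ}
    (hI : CMGrade D g I) :
    RegSeq ⊥ as ∧ (∀ x ∈ as, x ∈ I.map (algebraMap R B)) ∧ as.length = g := by
  have := h.unramified.noetherian
  obtain ⟨xs, hx, hr, -, hl⟩ :=
    exists_regSeq_length_eq_gradeOf (IsLocalRing.le_maximalIdeal hI.ne_top)
  obtain ⟨S, _, _, _, _, _, π, zs, us, hπ, rfl, hu, rfl⟩ := h.exists_isPointExtension xs hl hx
  have := hπ.flat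
  have := hπ.tower
  have hsurj := hπ.surjective
  have hum : ∀ u ∈ us, u ∈ maximalIdeal S := by
    intro u huS
    rw [← comap_maximalIdeal_of_surjective hsurj]
    exact IsLocalRing.le_maximalIdeal hI.ne_top (hx _ (List.mem_map_of_mem huS))
  have h1 := (regSeq_append _ _ _).1
    (regSeq_append_of_map hsurj hπ.ofList_eq hπ.regSeq_bot hum hr)
  have h2 := h1.1.map_of_flat (B := B)
  rw [Ideal.map_bot] at h2
  refine ⟨h2, ?_, ?_⟩
  · intro x hx
    obtain ⟨u, huS, rfl⟩ := List.mem_map.1 hx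
    have := Ideal.mem_map_of_mem (algebraMap S B) (hu u huS)
    rwa [Ideal.map_map, ← IsScalarTower.algebraMap_eq] at this
  · rw [List.length_map, ← List.length_map (f := π), hl, hI.gradeOf_eq]

lemma IsFirstUniversalLink.linkVia (h : IsFirstUniversalLink I as L) {D g : ℕ}
    (hI : CMGrade D g I) (hne : ¬ I.map (algebraMap R B) ≤ Ideal.ofList as) :
    LinkVia as (I.map (algebraMap R B)) L := by
  have := h.unramified.noetherian
  obtain ⟨h1, h2, h3⟩ := h.regSeq hI
  rw [h.eq_colon]
  exact (h.unramified.cmGrade hI).linkVia h2 h1 h3 hne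

end FirstUniversalLink

section UniversalLinks

set_option linter.unusedSectionVars false

lemma IsUniversalLinkOf.trans {R : Type} [CommRing R] {d e : ℕ} {I : Ideal R}
    {A : CommRingCat.{0}} {ψ : R →+* A} {K : Ideal A} (hK : IsUniversalLinkOf R d I A ψ K)
    {B : CommRingCat.{0}} {φ : A →+* B} {L : Ideal B} (hL : IsUniversalLinkOf A e K B φ L) :
    IsUniversalLinkOf R (d + e) I B (φ.comp ψ) L := by
  induction hL with
  | zero I => exact hK
  | succ h hB n f hf hQ ih => exact (ih hK).succ hB n f hf hQ

lemma InSameLinkageClass.trans {A : Type} [CommRing A] {I J K : Ideal A}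
    (h : InSameLinkageClass A I J) (h' : InSameLinkageClass A J K) : InSameLinkageClass A I K :=
  Relation.EqvGen.trans _ _ _ h h'

lemma InSameLinkageClass.symm {A : Type} [CommRing A] {I J : Ideal A}
    (h : InSameLinkageClass A I J) : InSameLinkageClass A J I :=
  Relation.EqvGen.symm _ _ h

lemma IsDirectlyLinked.inSameLinkageClass {A : Type} [CommRing A] {I J : Ideal A}
    (h : IsDirectlyLinked A I J) : InSameLinkageClass A I J :=
  Relation.EqvGen.rel _ _ h

/-- The properties of universal links propagated by induction when `C` contains the linkage class
of `I`. -/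
lemma IsUniversalLinkOf.inSameLinkageClass {R : Type} [CommRing R] [IsLocalRing R]
    [IsNoetherianRing R] (hres : Infinite (ResidueField R)) {I C : Ideal R} {D g : ℕ}
    (hI : CMGrade D g I) (hC : C < maximalIdeal R)
    (hcl : ∀ J, InSameLinkageClass R I J → J ≤ C) {e : ℕ} {B : CommRingCat.{0}} {φ : R →+* B}
    {L : Ideal B} (h : IsUniversalLinkOf R e I B φ L) :
    ∃ (_ : IsLocalRing B) (_ : IsNoetherianRing B), Infinite (ResidueField B) ∧ CMGrade D g L ∧
      C.map φ < maximalIdeal B ∧ InSameLinkageClass B (I.map φ) L ∧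
      ∀ J, InSameLinkageClass B (I.map φ) J → J ≤ C.map φ := by
  induction h with
  | zero I =>
    refine ⟨inferInstance, inferInstance, hres, hI, ?_, ?_, ?_⟩
    · rwa [Ideal.map_id]
    · rw [Ideal.map_id]; exact Relation.EqvGen.refl _
    · rwa [Ideal.map_id, Ideal.map_id]
  | @succ e I A ψ L h hA n f hf hQ ih =>
    obtain ⟨_, _, hresA, hL, hCA, h1, h2⟩ := ih hI hcl
    have := hQ
    have hlink := isFirstUniversalLink hresA hf _ rfl
    have hu := hlink.unramified
    have := hu.noetherian
    have := hu.flat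
    have := hu.isLocalHom
    have hcl' := hlink.le_map_of_inSameLinkageClass _ fun J hJ => h2 J (h1.trans hJ)
    obtain ⟨h3, h4, h5⟩ := hlink.regSeq hL
    have hvia := hlink.linkVia hL <| (hu.cmGrade hL).not_le_ofList (hu.map_lt hCA)
      (fun J hJ => hcl' J hJ.inSameLinkageClass) h4 h3 h5
    have h6 := h1.map (B := Localization (@Ideal.primeCompl _ _ _ hQ))
    refine ⟨inferInstance, inferInstance, infinite_residueField (algebraMap A _) hresA,
      hvia.cmGrade (hu.cmGrade hL), ?_, ?_, ?_⟩
    · have := hu.map_lt hCA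
      rw [Ideal.map_map] at this
      exact this
    · have := h6.trans (isDirectlyLinked_iff.2 ⟨_, hvia⟩).inSameLinkageClass
      rw [Ideal.map_map] at this
      exact this
    · intro J hJ
      have := hcl' J (h6.symm.trans (by rw [Ideal.map_map]; exact hJ))
      rw [Ideal.map_map] at this
      exact this

end UniversalLinks

section Converse

set_option linter.unusedSectionVars false

lemma LinkedInSteps.snoc {A : Type} [CommRing A] {k : ℕ} {I J K : Ideal A}
    (h : LinkedInSteps A k I J) (h' : IsDirectlyLinked A J K) : LinkedInSteps A (k + 1) I K := by
  induction k generalizing I with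
  | zero => cases h; exact ⟨K, h', rfl⟩
  | succ k ih =>
    obtain ⟨I', h1, h2⟩ := h
    exact ⟨I', h1, ih h2⟩

lemma LinkedInSteps.append {A : Type} [CommRing A] {k l : ℕ} {I J K : Ideal A}
    (h : LinkedInSteps A k I J) (h' : LinkedInSteps A l J K) : LinkedInSteps A (k + l) I K := by
  induction l generalizing J k with
  | zero => cases h'; exact h
  | succ l ih =>
    obtain ⟨J', h1, h2⟩ := h'
    have := ih (h.snoc h1) h2
    rwa [Nat.add_right_comm] at this

lemma LinkedInSteps.symm {A : Type} [CommRing A] [IsLocalRing A] [IsNoetherianRing A] {k : ℕ}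
    {I J : Ideal A} (h : LinkedInSteps A k I J) : LinkedInSteps A k J I := by
  induction k generalizing I with
  | zero => exact Eq.symm h
  | succ k ih =>
    obtain ⟨I', h1, h2⟩ := h
    exact (ih h2).snoc h1.symm

lemma InSameLinkageClass.exists_linkedInSteps {A : Type} [CommRing A] [IsLocalRing A]
    [IsNoetherianRing A] {I J : Ideal A} (h : InSameLinkageClass A I J) :
    ∃ k, LinkedInSteps A k I J := by
  induction h with
  | rel x y h => exact ⟨1, y, h, rfl⟩
  | refl x => exact ⟨0, rfl⟩
  | symm x y _ ih =>
    obtain ⟨k, h⟩ := ih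
    exact ⟨k, h.symm⟩
  | trans x y z _ _ ih1 ih2 =>
    obtain ⟨k, h⟩ := ih1
    obtain ⟨l, h'⟩ := ih2
    exact ⟨k + l, h.append h'⟩

lemma LinkedInSteps.cmGrade {A : Type} [CommRing A] [IsLocalRing A] [IsNoetherianRing A] {k : ℕ}
    {I J : Ideal A} (h : LinkedInSteps A k I J) {D g : ℕ} (hI : CMGrade D g I) :
    CMGrade D g J := by
  induction k generalizing I with
  | zero => cases h; exact hI
  | succ k ih =>
    obtain ⟨I', h1, h2⟩ := h
    exact ih h2 (h1.cmGrade hI)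

/-- `C` contains all universal links of `I`, up to extension. -/
def ContainsUniversalLinks {R : Type} [CommRing R] (I C : Ideal R) : Prop :=
  ∀ e : ℕ, 1 ≤ e → ∀ (B : CommRingCat.{0}) (φ : R →+* B) (L : Ideal B),
    IsUniversalLinkOf R e I B φ L → L ≤ C.map φ

theorem ContainsUniversalLinks.exists_isFirstUniversalLink {R : Type} [CommRing R] [IsLocalRing R]
    [IsNoetherianRing R] (hres : Infinite (ResidueField R)) {I C : Ideal R}
    (h : ContainsUniversalLinks I C) :
    ∃ (B : Type) (_ : CommRing B) (_ : IsLocalRing B) (_ : Algebra R B) (as : List B)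
      (L : Ideal B), IsFirstUniversalLink I as L ∧ L ≤ C.map (algebraMap R B) ∧
        ContainsUniversalLinks L (C.map (algebraMap R B)) := by
  obtain ⟨n, f, hf⟩ := exists_fin_generators I
  have hQ := isPrime_map_C R (Fin n × Fin (gradeOf R I)) (maximalIdeal R)
  have h1 := (IsUniversalLinkOf.zero I).succ inferInstance n f hf hQ
  refine ⟨_, inferInstance, inferInstance, inferInstance, _, _, isFirstUniversalLink hres hf _ rfl,
    h 1 le_rfl _ _ _ h1, fun e he B φ L hL => ?_⟩
  have := h _ (by omega) _ _ _ (h1.trans hL)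
  rw [← Ideal.map_map] at this
  exact this

theorem ContainsUniversalLinks.le_of_linkedInSteps (e : ℕ) : 1 ≤ e → ∀ {R : Type} [CommRing R]
    [IsLocalRing R] [IsNoetherianRing R], Infinite (ResidueField R) → ∀ {D g : ℕ} {I C : Ideal R},
    CMGrade D g I → C < maximalIdeal R → ContainsUniversalLinks I C →
    ∀ J, LinkedInSteps R e I J → J ≤ C := by
  induction e using Nat.strong_induction_on with
  | _ e IH =>
  intro he R _ _ _ hres D g I C hI hC hU J hJ
  obtain ⟨e, rfl⟩ := Nat.exists_eq_add_of_le' he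
  obtain ⟨I₁, hI₁, hJ⟩ := hJ
  obtain ⟨xs, hxs⟩ := isDirectlyLinked_iff.1 hI₁
  obtain ⟨B, _, _, _, as, L, hL, hLC, hUL⟩ := hU.exists_isFirstUniversalLink hres
  have hu := hL.unramified
  have := hu.noetherian
  have := hu.isLocalHom
  have hCB := hu.map_lt hC
  have hvia : LinkVia as (I.map (algebraMap R B)) L := by
    refine hL.linkVia hI fun hle => (hLC.trans_lt hCB).ne ?_
    rw [hL.eq_colon, colon_eq_top_iff.2 hle] at *
    exact absurd (hLC.trans_lt hCB) not_top_lt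
  have hLcm := hvia.cmGrade (hu.cmGrade hI)
  have claim : ∀ k, k ≤ e → ∀ K, LinkedInSteps B k L K → K ≤ C.map (algebraMap R B) := by
    intro k hk K hK
    rcases Nat.eq_zero_or_pos k with rfl | hk'
    · cases hK; exact hLC
    · exact IH k (by omega) hk' (infinite_residueField (algebraMap R B) hres) hLcm hCB hUL K hK
  obtain ⟨S, _, _, _, _, _, π, zs, us, hπ, rfl, hu, rfl⟩ :=
    hL.exists_isPointExtension xs hxs.length_eq.symm hxs.mem_left
  have := hπ.flat
  have := hπ.tower
  have hsurj := hπ.surjective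
  have hdef := isDeformation_map hsurj hπ.comp_algebraMap hπ.ofList_eq hπ.regSeq I
  obtain ⟨hdef₁, -⟩ := hdef.colon hsurj hπ.ofList_eq hπ.regSeq_bot hu hxs hI
  have hmap : ((Ideal.ofList us).colon (I.map (algebraMap R S) : Set S)).map (algebraMap S B) =
      L := by
    rw [map_colon_of_flat, map_ofList, Ideal.map_map, ← IsScalarTower.algebraMap_eq, hL.eq_colon]
  have lift : ∀ (m k : ℕ) (K : Ideal S) (I' : Ideal R), k + m = e → IsDeformation π zs K I' →
      CMGrade D g I' → LinkedInSteps B k L (K.map (algebraMap S B)) → LinkedInSteps R m I' J →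
      ∃ K', IsDeformation π zs K' J ∧ K'.map (algebraMap S B) ≤ C.map (algebraMap R B) := by
    intro m
    induction m with
    | zero =>
      rintro k K I' hk hK - hlink rfl
      exact ⟨K, hK, claim k (by omega) _ hlink⟩
    | succ m ih =>
      rintro k K I' hk hK hI' hlink ⟨I'', hI'', hJ⟩
      obtain ⟨ws, hws⟩ := isDirectlyLinked_iff.1 hI''
      obtain ⟨vs, rfl, hvs⟩ := hK.exists_lift hsurj hπ.ofList_eq hws.mem_left
      obtain ⟨hK', hr⟩ := hK.colon hsurj hπ.ofList_eq hπ.regSeq_bot hvs hws hI'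
      refine ih (k + 1) _ I'' (by omega) hK' (hws.cmGrade hI') (hlink.snoc ?_) hJ
      have hr' := hr.map_of_flat (B := B)
      rw [Ideal.map_bot] at hr'
      have hmem : ∀ x ∈ vs.map (algebraMap S B), x ∈ K.map (algebraMap S B) := by
        simpa using fun v hv => Ideal.mem_map_of_mem (algebraMap S B) (hvs v hv)
      have hlen : (vs.map (algebraMap S B)).length = g := by
        rw [List.length_map, ← List.length_map (f := π), ← hws.length_eq, hI'.gradeOf_eq]
      have hKcm := hlink.cmGrade hLcm
      have hvia' := hKcm.linkVia hmem hr' hlen <| hKcm.not_le_ofList hCB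
        (fun J hJ => claim (k + 1) (by omega) J (hlink.snoc hJ)) hmem hr' hlen
      rw [map_colon_of_flat, map_ofList]
      exact isDirectlyLinked_iff.2 ⟨_, hvia'⟩
  obtain ⟨K', hK', hle⟩ := lift e 0 _ I₁ (by omega) hdef₁ (hxs.cmGrade hI) hmap.symm hJ
  rw [← hK'.map_eq hsurj hπ.ofList_eq]
  have h1 : K' ≤ C.map (algebraMap R S) := (Ideal.map_le_iff_le_comap.1 hle).trans
    (hπ.comap_map_le C)
  have h2 := Ideal.map_mono (f := π) h1
  rwa [Ideal.map_map, hπ.comp_algebraMap, Ideal.map_id] at h2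

theorem ContainsUniversalLinks.le_of_inSameLinkageClass {R : Type} [CommRing R]
    [IsLocalRing R] [IsNoetherianRing R] (hres : Infinite (ResidueField R)) {D g : ℕ}
    {I C : Ideal R} (hI : CMGrade D g I) (hC : C < maximalIdeal R)
    (hU : ContainsUniversalLinks I C) {J : Ideal R} (hJ : InSameLinkageClass R I J) : J ≤ C := by
  obtain ⟨k, hk⟩ := hJ.exists_linkedInSteps
  obtain ⟨I', hI'⟩ := hI.exists_isDirectlyLinked
  exact le_of_linkedInSteps (2 + k) (by omega) hres hI hC hU J
    (LinkedInSteps.append (k := 2) ⟨I', hI', I, hI'.symm, rfl⟩ hk)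

end Converse

/-- Theorem 2.4. Let `I` be a Cohen-Macaulay ideal of positive grade
in a Noetherian local Gorenstein ring with infinite residue field, and let `C ⊊ m` be an
`R`-ideal. The following are equivalent: (a) `L^e(I) ⊆ C·R(X)` for every `e ≥ 1`;
(b) `C` contains every ideal in the linkage class of `I`. -/
theorem statement3 (R : Type) [CommRing R] [IsLocalRing R] [IsNoetherianRing R]
    (hGor : IsGorensteinLocalRing R) (hres : Infinite (IsLocalRing.ResidueField R))
    (I : Ideal R) (hCM : IsCMIdeal R I) (hgrade : ∃ r ∈ I, r ∈ nonZeroDivisors R)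
    (C : Ideal R) (hC : C < IsLocalRing.maximalIdeal R) :
    (∀ e : ℕ, 1 ≤ e →
      ∀ (B : CommRingCat.{0}) (φ : R →+* B) (L : Ideal B),
        IsUniversalLinkOf R e I B φ L → L ≤ C.map φ) ↔
    (∀ J : Ideal R, InSameLinkageClass R I J → J ≤ C) := by
  obtain ⟨D, hD⟩ := hGor.exists_nice
  have hne : I ≠ ⊤ := by
    obtain ⟨h, -⟩ := id hCM
    exact Ideal.Quotient.nontrivial_iff.1 h.toNontrivial
  have hI : CMGrade D (gradeOf R I) I := ⟨hD, (hCM.dp hD).1,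
    one_le_gradeOf (IsLocalRing.le_maximalIdeal hne) hgrade, hne, rfl, (hCM.dp hD).2⟩
  constructor
  · exact fun h J hJ => ContainsUniversalLinks.le_of_inSameLinkageClass hres hI hC h hJ
  · intro h e _ B φ L hL
    obtain ⟨_, _, -, -, -, h1, h2⟩ := hL.inSameLinkageClass hres hI hC h
    exact h2 L h1
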